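/- arXiv:1409.0810 — 2 statements merged into one kernel-verified Lean document; each statement's English description precedes it below -/
import Mathlib

section
/- Let p > 2, N ≥ 1, r < 1 and γ ∈ (0,1). There exists a constant C depending only on p, γ, N, r such that for every f continuous on closure(B₁) and every bounded continuous viscosity solution u of Σᵢ₌₁ᴺ |∂ᵢu|^{p-2} ∂ᵢᵢu = f in B₁, one has, for all x, y ∈ B_r: |u(x) − u(y)| ≤ C (‖u‖_{L^∞(B₁)} + ‖f‖_{L^∞(B₁)}^{1/(p−1)}) |x − y|^γ. -/
open Metric MeasureTheory Topology Filter Set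

/-- The pseudo-p-Laplacian operator (non-divergence form)
`Σᵢ |∂ᵢφ(x)|^(p-2) ∂ᵢᵢφ(x)` applied to a test function `φ` at `x`. -/
noncomputable def pseudoPOp (p : ℝ) {N : ℕ} (φ : EuclideanSpace ℝ (Fin N) → ℝ)
    (x : EuclideanSpace ℝ (Fin N)) : ℝ :=
  ∑ i : Fin N, |fderiv ℝ φ x (EuclideanSpace.single i 1)| ^ (p - 2) *
    fderiv ℝ (fun y => fderiv ℝ φ y (EuclideanSpace.single i 1)) x (EuclideanSpace.single i 1)

/-- `u` is a viscosity subsolution of `Σᵢ |∂ᵢu|^(p-2) ∂ᵢᵢu = f` on `Ω`: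
for every `x₀ ∈ Ω` and every `φ` which is `C²` in a neighborhood of `x₀` such that
`u - φ` has a local maximum equal to `0` at `x₀`, one has `Σᵢ |∂ᵢφ(x₀)|^(p-2) ∂ᵢᵢφ(x₀) ≥ f(x₀)`. -/
def IsViscSubsol (p : ℝ) {N : ℕ} (Ω : Set (EuclideanSpace ℝ (Fin N)))
    (u f : EuclideanSpace ℝ (Fin N) → ℝ) : Prop :=
  ∀ x₀ ∈ Ω, ∀ φ : EuclideanSpace ℝ (Fin N) → ℝ,
    (∃ ε > 0, ContDiffOn ℝ 2 φ (ball x₀ ε)) →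
    u x₀ = φ x₀ → (∀ᶠ x in 𝓝 x₀, u x ≤ φ x) →
    f x₀ ≤ pseudoPOp p φ x₀

/-- `u` is a viscosity supersolution of `Σᵢ |∂ᵢu|^(p-2) ∂ᵢᵢu = f` on `Ω`. -/
def IsViscSupersol (p : ℝ) {N : ℕ} (Ω : Set (EuclideanSpace ℝ (Fin N)))
    (u f : EuclideanSpace ℝ (Fin N) → ℝ) : Prop :=
  ∀ x₀ ∈ Ω, ∀ φ : EuclideanSpace ℝ (Fin N) → ℝ,
    (∃ ε > 0, ContDiffOn ℝ 2 φ (ball x₀ ε)) →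
    u x₀ = φ x₀ → (∀ᶠ x in 𝓝 x₀, φ x ≤ u x) →
    pseudoPOp p φ x₀ ≤ f x₀

theorem lip_good {F : Type*} [NormedAddCommGroup F] [NormedSpace ℝ F] [FiniteDimensional ℝ F]
    {C : NNReal} {T : F → F} (hT : LipschitzWith C T) {V : Set F} (hV : IsOpen V)
    (hne : V.Nonempty) : ∃ q ∈ V, ∀ z, T z = q → DifferentiableAt ℝ T z := by
  let _ : MeasurableSpace F := borel F
  have : BorelSpace F := ⟨rfl⟩
  let μ : Measure F := Measure.hausdorffMeasure (Module.finrank ℝ F)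
  have : μ.IsAddHaarMeasure := isAddHaarMeasure_hausdorffMeasure
  have h0 : μ {z | ¬ DifferentiableAt ℝ T z} = 0 := hT.ae_differentiableAt (μ := μ)
  have h1 : μ (T '' {z | ¬ DifferentiableAt ℝ T z}) = 0 := by
    have := hT.hausdorffMeasure_image_le (d := Module.finrank ℝ F) (by positivity)
      {z | ¬ DifferentiableAt ℝ T z}
    refine le_antisymm (this.trans ?_) bot_le
    change _ * μ _ ≤ _
    rw [h0, mul_zero]
  have h2 : 0 < μ V := hV.measure_pos μ hne
  by_contra hcon
  push Not at hcon
  have : V ⊆ T '' {z | ¬ DifferentiableAt ℝ T z} := by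
    intro q hq
    obtain ⟨z, hz, hd⟩ := hcon q hq
    exact ⟨z, hd, hz⟩
  exact absurd (measure_mono_null this h1) h2.ne'

theorem taylor2_local {E : Type*} [NormedAddCommGroup E] [InnerProductSpace ℝ E]
    {e : E → ℝ} {G : E → E} {ξ : E}
    (hG : ∀ᶠ x in 𝓝 ξ, HasFDerivAt e (innerSL ℝ (G x)) x) {X : E →L[ℝ] E} (hX : HasFDerivAt G X ξ) {η : ℝ} (hη : 0 < η) :
    ∀ᶠ k in 𝓝 (0 : E), |e (ξ + k) - e ξ - inner ℝ (G ξ) k - 1 / 2 * inner ℝ (X k) k|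
      ≤ η * ‖k‖ ^ 2 := by
  have h1 := (hasFDerivAt_iff_isLittleO_nhds_zero.1 hX).def hη
  have h2 : ∀ᶠ k in 𝓝 (0 : E), HasFDerivAt e (innerSL ℝ (G (ξ + k))) (ξ + k) := by
    have : Tendsto (fun k : E => ξ + k) (𝓝 0) (𝓝 ξ) := by
      have h3 : Continuous fun k : E => ξ + k := by fun_prop
      simpa using h3.tendsto 0
    exact this.eventually hG
  obtain ⟨ε, hε, hb⟩ := Metric.eventually_nhds_iff_ball.1 (h1.and h2)
  refine Metric.eventually_nhds_iff_ball.2 ⟨ε, hε, fun k hk => ?_⟩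
  let φ : ℝ → ℝ := fun t => e (ξ + t • k) - t * inner ℝ (G ξ) k - t ^ 2 / 2 * inner ℝ (X k) k
  have hkt : ∀ t ∈ Set.Icc (0:ℝ) 1, t • k ∈ ball (0:E) ε := by
    intro t ht
    rw [mem_ball_zero_iff] at hk ⊢
    rw [norm_smul, Real.norm_eq_abs, abs_of_nonneg ht.1]
    nlinarith [norm_nonneg k, ht.2]
  have hd : ∀ t ∈ Set.Icc (0:ℝ) 1, HasDerivAt φ (inner ℝ (G (ξ + t • k)) k - inner ℝ (G ξ) k
      - t * inner ℝ (X k) k) t := by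
    intro t ht
    have a1 : HasDerivAt (fun t : ℝ => ξ + t • k) k t := by
      simpa using ((hasDerivAt_id t).smul_const k).const_add ξ
    have a2 : HasDerivAt (fun t : ℝ => e (ξ + t • k)) (inner ℝ (G (ξ + t • k)) k) t := by
      exact (hb _ (hkt t ht)).2.comp_hasDerivAt t a1
    have a3 : HasDerivAt (fun t : ℝ => t * inner ℝ (G ξ) k) (inner ℝ (G ξ) k) t := by
      simpa using (hasDerivAt_id t).mul_const (inner ℝ (G ξ) k)
    have a4 : HasDerivAt (fun t : ℝ => t ^ 2 / 2 * inner ℝ (X k) k) (t * inner ℝ (X k) k) t := by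
      have := (((hasDerivAt_id' t).pow 2).div_const 2).mul_const (inner ℝ (X k) k)
      refine this.congr_deriv ?_
      simp
    exact (a2.sub a3).sub a4
  have hbd : ∀ t ∈ Set.Icc (0:ℝ) 1, ‖inner ℝ (G (ξ + t • k)) k - inner ℝ (G ξ) k
      - t * inner ℝ (X k) k‖ ≤ η * ‖k‖ ^ 2 := by
    intro t ht
    have := (hb _ (hkt t ht)).1
    have e1 : inner ℝ (G (ξ + t • k)) k - inner ℝ (G ξ) k - t * inner ℝ (X k) k
        = inner ℝ (G (ξ + t • k) - G ξ - X (t • k)) k := by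
      rw [inner_sub_left, inner_sub_left, map_smul, inner_smul_left]; simp
    rw [e1]
    refine (norm_inner_le_norm _ _).trans ?_
    have h3 : ‖t • k‖ ≤ ‖k‖ := by
      rw [norm_smul, Real.norm_eq_abs, abs_of_nonneg ht.1]
      nlinarith [norm_nonneg k, ht.2]
    nlinarith [norm_nonneg k, mul_le_mul_of_nonneg_left h3 hη.le]
  have := (convex_Icc (0:ℝ) 1).norm_image_sub_le_of_norm_hasDerivWithin_le
    (fun t ht => (hd t ht).hasDerivWithinAt) hbd (left_mem_Icc.2 zero_le_one)
    (right_mem_Icc.2 zero_le_one)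
  simp only [φ, Real.norm_eq_abs] at this
  simp only [one_smul, zero_smul, add_zero] at this
  convert this using 1
  · congr 1; ring
  · simp

theorem taylor2 {E : Type*} [NormedAddCommGroup E] [InnerProductSpace ℝ E]
    {e : E → ℝ} {G : E → E} (hG : ∀ x, HasFDerivAt e (innerSL ℝ (G x)) x)
    {X : E →L[ℝ] E} {ξ : E} (hX : HasFDerivAt G X ξ) {η : ℝ} (hη : 0 < η) :
    ∀ᶠ k in 𝓝 (0 : E), |e (ξ + k) - e ξ - inner ℝ (G ξ) k - 1 / 2 * inner ℝ (X k) k|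
      ≤ η * ‖k‖ ^ 2 :=
  taylor2_local (Eventually.of_forall hG) hX hη

set_option maxHeartbeats 1000000 in
theorem envelope {E : Type*} [NormedAddCommGroup E] [InnerProductSpace ℝ E]
    [FiniteDimensional ℝ E] {g : E → ℝ} {ρ κ : ℝ} (hρ : 0 < ρ) (hκ : 0 < κ)
    (hg : ContinuousOn g (closedBall 0 ρ)) :
    ∃ (e : E → ℝ) (G : E → E) (C : NNReal), LipschitzWith C G ∧
      (∀ x, HasFDerivAt e (innerSL ℝ (G x)) x) ∧
      g 0 ≤ e 0 ∧
      (∀ x, ∃ z ∈ closedBall (0:E) ρ, e x ≤ g z - κ * ‖x - z‖ ^ 2) ∧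
      (∀ x, ∀ z ∈ closedBall (0:E) ρ, g z - 2 * κ * ‖x - z‖ ^ 2 ≤ e x) ∧
      (∀ x, ∀ X : E →L[ℝ] E, HasFDerivAt G X x →
        (∃ c < 4 * κ, ∀ a, inner ℝ (X a) a ≤ c * ‖a‖ ^ 2) →
        x + (1 / (4 * κ)) • G x ∈ closedBall (0:E) ρ ∧
        e x = g (x + (1 / (4 * κ)) • G x) - 2 * κ * ‖(1 / (4 * κ)) • G x‖ ^ 2) := by
  have h0K : (0:E) ∈ closedBall (0:E) ρ := by simp [hρ.le]
  have hZ : ∀ y : E, ∃ z ∈ closedBall (0:E) ρ, ∀ z' ∈ closedBall (0:E) ρ,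
      g z' - κ * ‖y - z'‖ ^ 2 ≤ g z - κ * ‖y - z‖ ^ 2 := by
    intro y
    obtain ⟨z, hz, hm⟩ := (isCompact_closedBall (0:E) ρ).exists_isMaxOn ⟨0, h0K⟩
      (f := fun z => g z - κ * ‖y - z‖ ^ 2) (hg.sub (by fun_prop))
    exact ⟨z, hz, fun z' hz' => hm hz'⟩
  choose Z hZK hZm using hZ
  let U : E → ℝ := fun y => g (Z y) - κ * ‖y - Z y‖ ^ 2
  have hU : ∀ y, ∀ z ∈ closedBall (0:E) ρ, g z - κ * ‖y - z‖ ^ 2 ≤ U y := hZm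
  have hUlsc : LowerSemicontinuous U := by
    intro y c hc
    have : ∀ᶠ y' in 𝓝 y, c < g (Z y) - κ * ‖y' - Z y‖ ^ 2 := by
      have hcont : Continuous fun y' => g (Z y) - κ * ‖y' - Z y‖ ^ 2 := by fun_prop
      exact hcont.continuousAt.eventually (lt_mem_nhds hc)
    filter_upwards [this] with y' hy'
    exact hy'.trans_le (hU y' _ (hZK y))
  have hJ : ∀ x : E, ∃ y, ∀ y', U y + 2 * κ * ‖x - y‖ ^ 2 ≤ U y' + 2 * κ * ‖x - y'‖ ^ 2 := by
    intro x
    let D := U 0 + 2 * κ * ‖x - 0‖ ^ 2 - g 0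
    let R := 4 * ‖x‖ + 1 + |D| / κ
    have hR : 0 ≤ R := by positivity
    have hl : LowerSemicontinuousOn (fun y => U y + 2 * κ * ‖x - y‖ ^ 2) (closedBall 0 R) := by
      apply LowerSemicontinuous.lowerSemicontinuousOn
      apply hUlsc.add
      apply Continuous.lowerSemicontinuous
      fun_prop
    obtain ⟨y, hy, hm⟩ := hl.exists_isMinOn ⟨0, by simp [hR]⟩ (isCompact_closedBall (0:E) R)
    refine ⟨y, fun y' => ?_⟩
    by_cases hy' : y' ∈ closedBall (0:E) R
    · exact hm hy'
    · have h1 : U y + 2 * κ * ‖x - y‖ ^ 2 ≤ U 0 + 2 * κ * ‖x - 0‖ ^ 2 := hm (by simp [hR])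
      refine h1.trans ?_
      have h2 := hU y' 0 h0K
      simp only [sub_zero] at h2
      have h3 : R < ‖y'‖ := by simpa using hy'
      have h4 : ‖y'‖ - ‖x‖ ≤ ‖x - y'‖ := by
        rw [norm_sub_rev]; exact norm_sub_norm_le _ _
      have h5 : (‖y'‖ - ‖x‖) ^ 2 ≤ ‖x - y'‖ ^ 2 := by
        apply pow_le_pow_left₀ _ h4
        have : 0 ≤ |D| / κ := by positivity
        have := norm_nonneg x
        simp only [R] at h3; linarith
      have h6 : D ≤ κ * (‖y'‖ * (‖y'‖ - 4 * ‖x‖)) := by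
        have a1 : |D| / κ ≤ ‖y'‖ - 4 * ‖x‖ := by simp only [R] at h3; linarith
        have a2 : 1 ≤ ‖y'‖ := by
          have : 0 ≤ |D| / κ := by positivity
          have := norm_nonneg x
          simp only [R] at h3; linarith
        have a4 : 0 ≤ |D| / κ := by positivity
        have a3 : |D| / κ ≤ ‖y'‖ * (‖y'‖ - 4 * ‖x‖) := by nlinarith
        rw [div_le_iff₀ hκ] at a3
        linarith [le_abs_self D]
      have : U 0 + 2 * κ * ‖x - 0‖ ^ 2 = D + g 0 := by simp only [D]; ring
      rw [this]
      nlinarith [sq_nonneg ‖x‖, mul_le_mul_of_nonneg_left h5 hκ.le]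
  choose J hJm using hJ
  let e : E → ℝ := fun x => U (J x) + 2 * κ * ‖x - J x‖ ^ 2
  let G : E → E := fun x => (4 * κ) • (x - J x)
  -- strong convexity
  have hstrong : ∀ x y, e x + κ / 2 * ‖y - J x‖ ^ 2 ≤ U y + 2 * κ * ‖x - y‖ ^ 2 := by
    intro x y
    set m : E := (1 / 2 : ℝ) • (J x + y) with hm
    have h1 := hJm x m
    have h2 := hU (J x) (Z m) (hZK m)
    have h3 := hU y (Z m) (hZK m)
    have h4 : U m = g (Z m) - κ * ‖m - Z m‖ ^ 2 := rfl
    have key : ∀ w : E, ‖m - w‖ ^ 2 = ‖J x - w‖ ^ 2 / 2 + ‖y - w‖ ^ 2 / 2 - ‖y - J x‖ ^ 2 / 4 := by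
      intro w
      have p := parallelogram_law_with_norm ℝ (J x - w) (y - w)
      have q1 : J x - w + (y - w) = (2:ℝ) • (m - w) := by rw [hm]; module
      have q2 : J x - w - (y - w) = - (y - J x) := by abel
      rw [q1, q2, norm_neg, norm_smul] at p
      norm_num at p
      nlinarith
    have k1 := key (Z m)
    have k2 := key x
    rw [norm_sub_rev m x, norm_sub_rev (J x) x, norm_sub_rev y x] at k2
    change U (J x) + 2 * κ * ‖x - J x‖ ^ 2 + _ ≤ _
    rw [h4, k1, k2] at h1
    nlinarith
  have hJlip : ∀ x x', ‖J x - J x'‖ ≤ 4 * ‖x - x'‖ := by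
    intro x x'
    have h1 := hstrong x (J x')
    have h2 := hstrong x' (J x)
    have h3 : ‖x - J x'‖ ^ 2 - ‖x' - J x'‖ ^ 2 + ‖x' - J x‖ ^ 2 - ‖x - J x‖ ^ 2
        = 2 * inner ℝ (x - x') (J x - J x') := by
      simp only [← real_inner_self_eq_norm_sq, inner_sub_left, inner_sub_right]
      rw [real_inner_comm x (J x'), real_inner_comm x (J x), real_inner_comm x' (J x'),
        real_inner_comm x' (J x)]
      ring
    have h4 := real_inner_le_norm (x - x') (J x - J x')
    simp only [e] at h1 h2
    rw [norm_sub_rev (J x') (J x)] at h1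
    have h5 : κ * ‖J x - J x'‖ ^ 2 ≤ κ * (4 * (‖x - x'‖ * ‖J x - J x'‖)) := by nlinarith
    have h6 := le_of_mul_le_mul_left h5 hκ
    by_contra hcon
    push Not at hcon
    have : 0 < ‖J x - J x'‖ := lt_of_le_of_lt (by positivity) hcon
    nlinarith
  have hGlip : ∀ x x', ‖G x - G x'‖ ≤ 20 * κ * ‖x - x'‖ := by
    intro x x'
    have : G x - G x' = (4 * κ) • ((x - x') - (J x - J x')) := by simp only [G]; module
    rw [this, norm_smul, Real.norm_eq_abs, abs_of_pos (by positivity)]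
    have := norm_sub_le (x - x') (J x - J x')
    nlinarith [hJlip x x']
  have hup : ∀ x x', e x' ≤ e x + inner ℝ (G x) (x' - x) + 2 * κ * ‖x' - x‖ ^ 2 := by
    intro x x'
    have h1 : e x' ≤ U (J x) + 2 * κ * ‖x' - J x‖ ^ 2 := hJm x' (J x)
    have h2 : ‖x' - J x‖ ^ 2 = ‖x - J x‖ ^ 2 + 2 * inner ℝ (x - J x) (x' - x) + ‖x' - x‖ ^ 2 := by
      rw [← norm_add_sq_real]; congr 2; abel
    have h3 : inner ℝ (G x) (x' - x) = 4 * κ * inner ℝ (x - J x) (x' - x) := by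
      simp only [G, inner_smul_left]; simp
    simp only [e] at h1 ⊢
    rw [h3]
    rw [h2] at h1
    linarith
  have hder : ∀ x, HasFDerivAt e (innerSL ℝ (G x)) x := by
    intro x
    rw [hasFDerivAt_iff_isLittleO]
    have : (fun x' => e x' - e x - (innerSL ℝ (G x)) (x' - x)) =O[𝓝 x] fun x' => ‖x' - x‖ ^ 2 := by
      refine Asymptotics.IsBigO.of_bound (22 * κ) (Eventually.of_forall fun x' => ?_)
      have h1 := hup x x'
      have h2 := hup x' x
      have h3 : inner ℝ (G x') (x - x') = - inner ℝ (G x) (x' - x)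
          - inner ℝ (G x' - G x) (x' - x) := by
        rw [inner_sub_left, ← neg_sub x' x, inner_neg_right]; ring
      have h4 := real_inner_le_norm (G x' - G x) (x' - x)
      have h5 := abs_real_inner_le_norm (G x' - G x) (x' - x)
      have h6 := hGlip x' x
      rw [h3, norm_sub_rev x x'] at h2
      have h7 : |inner ℝ (G x' - G x) (x' - x)| ≤ 20 * κ * ‖x' - x‖ ^ 2 := by
        nlinarith [norm_nonneg (x' - x)]
      rw [abs_le] at h7
      rw [innerSL_apply_apply, Real.norm_eq_abs, Real.norm_eq_abs,
        abs_of_nonneg (sq_nonneg ‖x' - x‖), abs_le]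
      constructor <;> nlinarith [h7.1, h7.2, sq_nonneg ‖x' - x‖]
    refine this.trans_isLittleO ?_
    have h8 : (fun x' => ‖x' - x‖ ^ 2) =o[𝓝 x] fun x' => ‖x' - x‖ ^ 1 :=
      (Asymptotics.isLittleO_pow_pow (𝕜 := ℝ) (m := 1) (n := 2) (by norm_num)).comp_tendsto
        (k := fun x' => ‖x' - x‖) (by
          have : Continuous fun x' => ‖x' - x‖ := by fun_prop
          simpa using this.tendsto x)
    simpa using h8
  have hlow : ∀ x, ∀ z ∈ closedBall (0:E) ρ, g z - 2 * κ * ‖x - z‖ ^ 2 ≤ e x := by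
    intro x z hz
    have h1 := hU (J x) z hz
    have h2 : ‖J x - z‖ ^ 2 ≤ 2 * ‖x - J x‖ ^ 2 + 2 * ‖x - z‖ ^ 2 := by
      have p := parallelogram_law_with_norm ℝ (x - J x) (x - z)
      have q2 : x - J x - (x - z) = -(J x - z) := by abel
      rw [q2, norm_neg] at p
      nlinarith [norm_nonneg (x - J x + (x - z))]
    simp only [e]
    nlinarith
  refine ⟨e, G, (20 * κ).toNNReal, ?_, hder, ?_, ?_, hlow, ?_⟩
  · refine LipschitzWith.of_dist_le_mul fun x x' => ?_
    rw [dist_eq_norm, dist_eq_norm, Real.coe_toNNReal _ (by positivity)]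
    exact hGlip x x'
  · simpa using hlow 0 0 h0K
  · intro x
    refine ⟨Z x, hZK x, ?_⟩
    simpa using hJm x x
  · rintro x X hX ⟨c, hc, hXc⟩
    set z := Z (J x) with hz
    set y := J x with hy
    set d : E := (1 / 2 : ℝ) • (z + y - (2:ℝ) • x) with hd
    have hray : ∀ t ∈ Icc (0:ℝ) 1, e x + inner ℝ (G x) (t • d) + 2 * κ * ‖t • d‖ ^ 2
        ≤ e (x + t • d) := by
      intro t ht
      set y' := J (x + t • d) with hy'
      set k := y' - y with hk
      -- two lower bounds
      have b1 : U y + 2 * κ * ‖x - y‖ ^ 2 ≤ U y' + 2 * κ * ‖x - y'‖ ^ 2 := hJm x y'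
      have b2 : g z - κ * ‖y' - z‖ ^ 2 ≤ U y' := hU y' z (hZK _)
      have b3 : U y = g z - κ * ‖y - z‖ ^ 2 := rfl
      have c1 : ‖x - y'‖ ^ 2 = ‖x - y‖ ^ 2 - 2 * inner ℝ (x - y) k + ‖k‖ ^ 2 := by
        rw [← norm_sub_sq_real]; congr 2; rw [hk]; abel
      have c2 : ‖y' - z‖ ^ 2 = ‖y - z‖ ^ 2 + 2 * inner ℝ (y - z) k + ‖k‖ ^ 2 := by
        rw [← norm_add_sq_real]; congr 2; rw [hk]; abel
      have c3 : ‖x + t • d - y'‖ ^ 2 = ‖x - y + t • d‖ ^ 2 - 2 * inner ℝ (x - y + t • d) k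
          + ‖k‖ ^ 2 := by
        rw [← norm_sub_sq_real]; congr 2; rw [hk]; abel
      have c4 : ‖x - y + t • d‖ ^ 2 = ‖x - y‖ ^ 2 + 2 * inner ℝ (x - y) (t • d) + ‖t • d‖ ^ 2 := by
        rw [← norm_add_sq_real]
      have c5 : inner ℝ (x - y + t • d) k = inner ℝ (x - y) k + t * inner ℝ d k := by
        rw [inner_add_left, inner_smul_left]; simp
      have c6 : inner ℝ (y - z) k = - 2 * inner ℝ d k - 2 * inner ℝ (x - y) k := by
        have : y - z = (-2 : ℝ) • d - (2:ℝ) • (x - y) := by rw [hd]; module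
        rw [this, inner_sub_left, real_inner_smul_left d k (-2), real_inner_smul_left (x - y) k 2]
      have c7 : inner ℝ (G x) (t • d) = 4 * κ * inner ℝ (x - y) (t • d) := by
        simp only [G, inner_smul_left]; simp [hy]
      change U y + 2 * κ * ‖x - y‖ ^ 2 + _ + _ ≤ U y' + 2 * κ * ‖x + t • d - y'‖ ^ 2
      rw [c3, c4, c5, c7]
      rw [c1] at b1
      rw [c2, c6] at b2
      have b1' : U y - U y' ≤ - 4 * κ * inner ℝ (x - y) k + 2 * κ * ‖k‖ ^ 2 := by linarith
      have b2' : U y - U y' ≤ κ * (- 4 * inner ℝ d k - 4 * inner ℝ (x - y) k + ‖k‖ ^ 2) := by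
        rw [b3]; linarith
      have b3' := mul_le_mul_of_nonneg_left b1' (sub_nonneg.2 ht.2)
      have b4' := mul_le_mul_of_nonneg_left b2' ht.1
      have b5' : 0 ≤ t * (κ * ‖k‖ ^ 2) := mul_nonneg ht.1 (by positivity)
      nlinarith
    have hd0 : d = 0 := by
      by_contra hne
      have hdpos : 0 < ‖d‖ ^ 2 := by have := norm_pos_iff.2 hne; positivity
      have ht := taylor2 hder hX (η := (4 * κ - c) / 4) (by linarith)
      have hcont : Tendsto (fun t : ℝ => t • d) (𝓝[>] 0) (𝓝 0) := by
        have : Continuous fun t : ℝ => t • d := by fun_prop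
        have := this.tendsto 0
        rw [zero_smul] at this
        exact this.mono_left nhdsWithin_le_nhds
      have h1 := hcont.eventually ht
      have h2 : ∀ᶠ t : ℝ in 𝓝[>] 0, t ∈ Ioo (0:ℝ) 1 := Ioo_mem_nhdsGT zero_lt_one
      obtain ⟨t, h1, h2⟩ := (h1.and h2).exists
      have h3 := hray t ⟨h2.1.le, h2.2.le⟩
      have h4 := (abs_le.1 h1).2
      have h5 := hXc (t • d)
      have h6 : 0 < ‖t • d‖ ^ 2 := by
        rw [norm_smul, mul_pow]; have := h2.1; rw [Real.norm_eq_abs]; positivity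
      have h7 := mul_pos (sub_pos.2 hc) h6
      clear hray hlow hder hup hGlip hJlip hstrong hJm hUlsc hU hZm
      linarith
    have hzz : x + (1 / (4 * κ)) • G x = z := by
      have h1 : (1 / (4 * κ)) • G x = x - y := by
        simp only [G, smul_smul]
        rw [one_div_mul_cancel (by positivity), one_smul]
      rw [h1]
      have : z = (2:ℝ) • d + (2:ℝ) • x - y := by rw [hd]; module
      rw [this, hd0]; module
    have hzz' : (1 / (4 * κ)) • G x = x - y := by
      simp only [G, smul_smul]
      rw [one_div_mul_cancel (by positivity), one_smul]
    rw [hzz]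
    refine ⟨hZK _, ?_⟩
    rw [hzz']
    rw [hzz'] at hzz
    change g z - κ * ‖y - z‖ ^ 2 + 2 * κ * ‖x - y‖ ^ 2 = _
    have : ‖y - z‖ ^ 2 = 4 * ‖x - y‖ ^ 2 := by
      have : y - z = (-2 : ℝ) • (x - y) := by rw [← hzz]; module
      rw [this, norm_smul, mul_pow]; norm_num
    rw [this]; ring

/-- The quadratic form used in the doubling argument. -/
noncomputable def qS {E : Type*} [NormedAddCommGroup E] [InnerProductSpace ℝ E]
    (β θ Λ : ℝ) (n : E) (a b : E) : ℝ :=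
  β * ‖a - b‖ ^ 2 - θ * (inner ℝ n (a - b)) ^ 2 + Λ * (‖a‖ ^ 2 + ‖b‖ ^ 2)

theorem qS_add {E : Type*} [NormedAddCommGroup E] [InnerProductSpace ℝ E]
    (β θ Λ : ℝ) (n x y a b : E) :
    qS β θ Λ n (x + a) (y + b) = qS β θ Λ n x y
      + 2 * (inner ℝ (β • (x - y) - (θ * inner ℝ n (x - y)) • n + Λ • x) a
        + inner ℝ (-(β • (x - y) - (θ * inner ℝ n (x - y)) • n) + Λ • y) b)
      + qS β θ Λ n a b := by
  unfold qS
  have h1 : x + a - (y + b) = (x - y) + (a - b) := by abel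
  rw [h1, norm_add_sq_real, norm_add_sq_real, norm_add_sq_real]
  simp only [inner_add_left, inner_sub_left, inner_neg_left, real_inner_smul_left,
    inner_add_right, inner_sub_right]
  ring

set_option maxHeartbeats 1000000 in
theorem qS_sup {E : Type*} [NormedAddCommGroup E] [InnerProductSpace ℝ E]
    {β θ Λ η : ℝ} (hβ : 0 ≤ β) (hθ : 0 ≤ θ) (hΛ : 0 ≤ Λ) (hη : 0 < η) {n : E} (hn : ‖n‖ ≤ 1)
    {κ : ℝ} (hκ : 4 * (β + θ + Λ) ^ 2 / η + (β + θ + Λ) ≤ κ) (x y a b : E) :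
    qS β θ Λ n (x + a) (y + b) - 2 * κ * (‖a‖ ^ 2 + ‖b‖ ^ 2)
      ≤ qS β θ Λ n x y + η / 2 * (‖x‖ ^ 2 + ‖y‖ ^ 2) := by
  set H := β + θ + Λ with hH
  set s := ‖x‖ + ‖y‖ with hs
  set w := ‖a‖ + ‖b‖ with hw
  have hs0 : 0 ≤ s := by positivity
  have hw0 : 0 ≤ w := by positivity
  have hH0 : 0 ≤ H := by positivity
  have ht : ‖x - y‖ ≤ s := norm_sub_le _ _
  have hσ : ‖a - b‖ ≤ w := norm_sub_le _ _
  have hnt : |inner ℝ n (x - y)| ≤ s :=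
    (abs_real_inner_le_norm _ _).trans (by nlinarith [norm_nonneg (x - y)])
  have hnσ : |inner ℝ n (a - b)| ≤ w :=
    (abs_real_inner_le_norm _ _).trans (by nlinarith [norm_nonneg (a - b)])
  have i1 : inner ℝ (x - y) (a - b) ≤ s * w :=
    (real_inner_le_norm _ _).trans (mul_le_mul ht hσ (norm_nonneg _) hs0)
  have i2 : - (inner ℝ n (x - y) * inner ℝ n (a - b)) ≤ s * w := by
    refine (neg_le_abs _).trans ?_
    rw [abs_mul]
    exact mul_le_mul hnt hnσ (abs_nonneg _) hs0
  have i3 : inner ℝ x a + inner ℝ y b ≤ s * w := by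
    have e1 := real_inner_le_norm x a
    have e2 := real_inner_le_norm y b
    have := mul_nonneg (norm_nonneg x) (norm_nonneg b)
    have := mul_nonneg (norm_nonneg y) (norm_nonneg a)
    rw [hs, hw]; nlinarith
  have i4 : ‖a - b‖ ^ 2 ≤ w ^ 2 := pow_le_pow_left₀ (norm_nonneg _) hσ 2
  have i5 : ‖a‖ ^ 2 + ‖b‖ ^ 2 ≤ w ^ 2 := by
    rw [hw]; nlinarith [mul_nonneg (norm_nonneg a) (norm_nonneg b)]
  have i6 : w ^ 2 ≤ 2 * (‖a‖ ^ 2 + ‖b‖ ^ 2) := by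
    rw [hw]; nlinarith [sq_nonneg (‖a‖ - ‖b‖)]
  have i7 : s ^ 2 ≤ 2 * (‖x‖ ^ 2 + ‖y‖ ^ 2) := by
    rw [hs]; nlinarith [sq_nonneg (‖x‖ - ‖y‖)]
  have hexp : qS β θ Λ n (x + a) (y + b) = qS β θ Λ n x y
      + 2 * (β * inner ℝ (x - y) (a - b) + θ * (- (inner ℝ n (x - y) * inner ℝ n (a - b)))
        + Λ * (inner ℝ x a + inner ℝ y b))
      + (β * ‖a - b‖ ^ 2 - θ * (inner ℝ n (a - b)) ^ 2 + Λ * (‖a‖ ^ 2 + ‖b‖ ^ 2)) := by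
    rw [qS_add]
    simp only [qS, inner_add_left, inner_sub_left, inner_neg_left, real_inner_smul_left,
      inner_add_right, inner_sub_right]
    ring
  have j1 := mul_le_mul_of_nonneg_left i1 hβ
  have j2 := mul_le_mul_of_nonneg_left i2 hθ
  have j3 := mul_le_mul_of_nonneg_left i3 hΛ
  have j4 := mul_le_mul_of_nonneg_left i4 hβ
  have j5 := mul_le_mul_of_nonneg_left i5 hΛ
  have j6 : 0 ≤ θ * (inner ℝ n (a - b)) ^ 2 := by positivity
  have j7 : 0 ≤ θ * w ^ 2 := by positivity
  have k1 : qS β θ Λ n (x + a) (y + b) ≤ qS β θ Λ n x y + 2 * H * (s * w) + H * w ^ 2 := by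
    rw [hexp, hH]; linarith
  have k2 : 2 * H * (s * w) ≤ η / 4 * s ^ 2 + 4 * H ^ 2 / η * w ^ 2 := by
    have : η / 4 * s ^ 2 + 4 * H ^ 2 / η * w ^ 2 - 2 * H * (s * w)
        = (η * s - 4 * H * w) ^ 2 / (4 * η) := by field_simp; ring
    have h2 : 0 ≤ (η * s - 4 * H * w) ^ 2 / (4 * η) := by positivity
    linarith
  have k3 : (4 * H ^ 2 / η + H) * w ^ 2 ≤ κ * (2 * (‖a‖ ^ 2 + ‖b‖ ^ 2)) :=
    mul_le_mul hκ i6 (by positivity) (le_trans (by positivity) hκ)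
  have k4 := mul_le_mul_of_nonneg_left i7 (show 0 ≤ η / 4 by positivity)
  linarith

set_option maxHeartbeats 1000000 in
theorem core_sums {E : Type*} [NormedAddCommGroup E] [InnerProductSpace ℝ E]
    [FiniteDimensional ℝ E] {g₁ g₂ : E → ℝ} {ρ : ℝ} (hρ : 0 < ρ)
    (hg₁ : ContinuousOn g₁ (closedBall 0 ρ)) (hg₂ : ContinuousOn g₂ (closedBall 0 ρ))
    (h01 : g₁ 0 = 0) (h02 : g₂ 0 = 0)
    {β θ Λ η : ℝ} (hβ : 0 ≤ β) (hθ : 0 ≤ θ) (hΛ : 0 ≤ Λ) (hη : 0 < η) {n : E} (hn : ‖n‖ ≤ 1)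
    (hS : ∀ x ∈ closedBall (0:E) ρ, ∀ y ∈ closedBall (0:E) ρ,
      g₁ x + g₂ y ≤ 1 / 2 * qS β θ Λ n x y) :
    ∃ (z₁ z₂ q₁ q₂ : E) (X₁ X₂ : E →L[ℝ] E), ‖z₁‖ < η ∧ ‖z₂‖ < η ∧ ‖q₁‖ < η ∧ ‖q₂‖ < η ∧
      (∀ᶠ k in 𝓝 (0:E), g₁ (z₁ + k) ≤ g₁ z₁ + inner ℝ q₁ k + 1 / 2 * inner ℝ (X₁ k) k) ∧
      (∀ᶠ k in 𝓝 (0:E), g₂ (z₂ + k) ≤ g₂ z₂ + inner ℝ q₂ k + 1 / 2 * inner ℝ (X₂ k) k) ∧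
      (∀ a b, inner ℝ (X₁ a) a + inner ℝ (X₂ b) b ≤ qS β θ (Λ + 2 * η) n a b) := by
  obtain ⟨κ, hκdef⟩ : ∃ κ, κ = 4 * (β + θ + Λ) ^ 2 / η + (β + θ + Λ) + 1 + η := ⟨_, rfl⟩
  have hκ1 : 1 ≤ κ := by
    have : 0 ≤ 4 * (β + θ + Λ) ^ 2 / η := by positivity
    linarith
  have hκ : 0 < κ := by linarith
  obtain ⟨e₁, G₁, C₁, hL₁, hd₁, he₁, hu₁, hl₁, hc₁⟩ := envelope hρ hκ hg₁
  obtain ⟨e₂, G₂, C₂, hL₂, hd₂, he₂, hu₂, hl₂, hc₂⟩ := envelope hρ hκ hg₂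
  rw [h01] at he₁
  rw [h02] at he₂
  set S := qS β θ (Λ + η) n with hSdef
  have hΘ : ∀ x y, e₁ x + e₂ y - 1 / 2 * S x y ≤ - (η / 4) * (‖x‖ ^ 2 + ‖y‖ ^ 2) := by
    intro x y
    obtain ⟨z, hz, h1⟩ := hu₁ x
    obtain ⟨z', hz', h2⟩ := hu₂ y
    have h3 := hS z hz z' hz'
    have h4 := qS_sup hβ hθ hΛ hη hn (κ := κ) (by rw [hκdef]; linarith) x y (z - x) (z' - y)
    rw [add_sub_cancel, add_sub_cancel, norm_sub_rev z x, norm_sub_rev z' y] at h4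
    have h5 : S x y = qS β θ Λ n x y + η * (‖x‖ ^ 2 + ‖y‖ ^ 2) := by
      rw [hSdef]; unfold qS; ring
    rw [h5]; linarith
  -- the linear part
  let τ : E × E →L[ℝ] E := ContinuousLinearMap.fst ℝ E E - ContinuousLinearMap.snd ℝ E E
  let W : E × E →L[ℝ] E := β • τ - θ • ((innerSL ℝ n).comp τ).smulRight n
  let D : E × E →L[ℝ] E × E :=
    (W + (Λ + η) • ContinuousLinearMap.fst ℝ E E).prod
      (-W + (Λ + η) • ContinuousLinearMap.snd ℝ E E)
  have hDadd : ∀ x y a b : E, S (x + a) (y + b) = S x y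
      + 2 * (inner ℝ (D (x, y)).1 a + inner ℝ (D (x, y)).2 b) + S a b := by
    intro x y a b
    rw [hSdef, qS_add]
    simp [D, W, τ, mul_smul, inner_sub_right]
  let T : E × E → E × E := fun ζ => (G₁ ζ.1, G₂ ζ.2) - D ζ
  obtain ⟨CT, hT⟩ : ∃ C, LipschitzWith C T :=
    ⟨_, ((hL₁.comp LipschitzWith.prod_fst).prodMk (hL₂.comp LipschitzWith.prod_snd)).sub
      D.lipschitz⟩
  obtain ⟨R, hRdef⟩ : ∃ R, R = min η ρ / (3 + ‖D‖) := ⟨_, rfl⟩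
  have hmin : 0 < min η ρ := lt_min hη hρ
  have hR : 0 < R := by rw [hRdef]; positivity
  have hRD : (2 + ‖D‖) * R < min η ρ := by
    have : (3 + ‖D‖) * R = min η ρ := by rw [hRdef]; field_simp
    linarith
  have hRD1 := hRD.trans_le (min_le_left _ _)
  have hRD2 := hRD.trans_le (min_le_right _ _)
  obtain ⟨ν, hνdef⟩ : ∃ ν, ν = min (η * R / 16) R := ⟨_, rfl⟩
  have hν : 0 < ν := by rw [hνdef]; positivity
  have hν1 : ν ≤ η * R / 16 := by rw [hνdef]; exact min_le_left _ _
  have hν2 : ν ≤ R := by rw [hνdef]; exact min_le_right _ _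
  obtain ⟨⟨p₁, p₂⟩, hp, hgood⟩ := lip_good hT (V := ball 0 ν) isOpen_ball ⟨0, by simp [hν]⟩
  have hp12 : ‖p₁‖ < ν ∧ ‖p₂‖ < ν := by
    rw [mem_ball_zero_iff, Prod.norm_def] at hp
    exact max_lt_iff.1 hp
  obtain ⟨hp1, hp2⟩ := hp12
  have hce₁ : Continuous e₁ := continuous_iff_continuousAt.2 fun x => (hd₁ x).continuousAt
  have hce₂ : Continuous e₂ := continuous_iff_continuousAt.2 fun x => (hd₂ x).continuousAt
  let Ψ : E × E → ℝ := fun ζ => e₁ ζ.1 + e₂ ζ.2 - 1 / 2 * S ζ.1 ζ.2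
    - inner ℝ p₁ ζ.1 - inner ℝ p₂ ζ.2
  have hΨc : Continuous Ψ := by
    simp only [Ψ, hSdef, qS]
    fun_prop
  obtain ⟨⟨x, y⟩, hxy, hmax⟩ := (isCompact_closedBall (0 : E × E) R).exists_isMaxOn
    ⟨0, by simp [hR.le]⟩ hΨc.continuousOn
  have hxR : ‖x‖ ≤ R ∧ ‖y‖ ≤ R := by
    rw [mem_closedBall_zero_iff, Prod.norm_def] at hxy
    exact max_le_iff.1 hxy
  have hint : ‖x‖ < R ∧ ‖y‖ < R := by
    have h1 : Ψ 0 ≤ Ψ (x, y) := hmax (by simp [hR.le])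
    have h2 : 0 ≤ Ψ 0 := by
      simp only [Ψ, hSdef, qS]; simp; linarith
    have h3 := hΘ x y
    have h4 : - inner ℝ p₁ x ≤ ν * ‖x‖ := by
      refine (neg_le_abs _).trans ((abs_real_inner_le_norm _ _).trans ?_)
      exact mul_le_mul_of_nonneg_right hp1.le (norm_nonneg _)
    have h5 : - inner ℝ p₂ y ≤ ν * ‖y‖ := by
      refine (neg_le_abs _).trans ((abs_real_inner_le_norm _ _).trans ?_)
      exact mul_le_mul_of_nonneg_right hp2.le (norm_nonneg _)
    have h6 : η / 4 * (‖x‖ ^ 2 + ‖y‖ ^ 2) ≤ ν * (‖x‖ + ‖y‖) := by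
      simp only [Ψ] at h1 h2
      linarith
    have h7 : ν * (‖x‖ + ‖y‖) ≤ η * R / 16 * (2 * R) :=
      mul_le_mul hν1 (by linarith [hxR.1, hxR.2]) (by positivity) (by positivity)
    have h8 : ‖x‖ ^ 2 + ‖y‖ ^ 2 ≤ R ^ 2 / 2 := by
      have : η * (‖x‖ ^ 2 + ‖y‖ ^ 2) ≤ η * (R ^ 2 / 2) := by linarith
      exact le_of_mul_le_mul_left this hη
    constructor
    · refine lt_of_pow_lt_pow_left₀ 2 hR.le ?_
      nlinarith [sq_nonneg ‖y‖, pow_pos hR 2]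
    · refine lt_of_pow_lt_pow_left₀ 2 hR.le ?_
      nlinarith [sq_nonneg ‖x‖, pow_pos hR 2]
  -- inequality along lines
  have hline : ∀ a b : E, ∀ᶠ t : ℝ in 𝓝 0,
      e₁ (x + t • a) - e₁ x + (e₂ (y + t • b) - e₂ y)
        - t * (inner ℝ ((D (x, y)).1 + p₁) a + inner ℝ ((D (x, y)).2 + p₂) b)
        - t ^ 2 / 2 * S a b ≤ 0 := by
    intro a b
    have h1 : ∀ᶠ t : ℝ in 𝓝 0, ‖x + t • a‖ < R := by
      have : Continuous fun t : ℝ => ‖x + t • a‖ := by fun_prop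
      exact this.continuousAt.eventually (gt_mem_nhds (by simpa using hint.1))
    have h2 : ∀ᶠ t : ℝ in 𝓝 0, ‖y + t • b‖ < R := by
      have : Continuous fun t : ℝ => ‖y + t • b‖ := by fun_prop
      exact this.continuousAt.eventually (gt_mem_nhds (by simpa using hint.2))
    filter_upwards [h1, h2] with t h1 h2
    have h3 : Ψ (x + t • a, y + t • b) ≤ Ψ (x, y) := hmax (by
      rw [mem_closedBall_zero_iff, Prod.norm_def]
      exact max_le h1.le h2.le)
    have h4 := hDadd x y (t • a) (t • b)
    have h5 : S (t • a) (t • b) = t ^ 2 * S a b := by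
      rw [hSdef]; unfold qS
      rw [← smul_sub, norm_smul, norm_smul, norm_smul, real_inner_smul_right]
      simp only [mul_pow, Real.norm_eq_abs, sq_abs]
      ring
    simp only [Ψ] at h3
    rw [h4, h5] at h3
    simp only [inner_add_right, real_inner_smul_right, inner_add_left] at h3 ⊢
    linarith
  have hgrad : ∀ a b : E, inner ℝ (G₁ x) a + inner ℝ (G₂ y) b
      = inner ℝ ((D (x, y)).1 + p₁) a + inner ℝ ((D (x, y)).2 + p₂) b := by
    intro a b
    have a1 : HasDerivAt (fun t : ℝ => e₁ (x + t • a)) (inner ℝ (G₁ x) a) 0 := by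
      have : HasDerivAt (fun t : ℝ => x + t • a) a 0 := by
        simpa using ((hasDerivAt_id (0:ℝ)).smul_const a).const_add x
      have h2 := hd₁ (x + (0:ℝ) • a)
      have h3 := h2.comp_hasDerivAt (0:ℝ) this
      rw [zero_smul, add_zero] at h3
      exact h3
    have a2 : HasDerivAt (fun t : ℝ => e₂ (y + t • b)) (inner ℝ (G₂ y) b) 0 := by
      have : HasDerivAt (fun t : ℝ => y + t • b) b 0 := by
        simpa using ((hasDerivAt_id (0:ℝ)).smul_const b).const_add y
      have h2 := hd₂ (y + (0:ℝ) • b)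
      have h3 := h2.comp_hasDerivAt (0:ℝ) this
      rw [zero_smul, add_zero] at h3
      exact h3
    set ℓ := inner ℝ ((D (x, y)).1 + p₁) a + inner ℝ ((D (x, y)).2 + p₂) b with hℓ
    have a3 : HasDerivAt (fun t : ℝ => t * ℓ) ℓ 0 := by
      simpa using (hasDerivAt_id (0:ℝ)).mul_const ℓ
    have a4 : HasDerivAt (fun t : ℝ => t ^ 2 / 2 * S a b) 0 0 := by
      have := (((hasDerivAt_id' (0:ℝ)).pow 2).div_const 2).mul_const (S a b)
      refine this.congr_deriv ?_
      simp
    have a5 := ((((a1.sub_const (e₁ x)).add (a2.sub_const (e₂ y))).sub a3).sub a4)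
    have a6 : IsLocalMax (fun t : ℝ => e₁ (x + t • a) - e₁ x + (e₂ (y + t • b) - e₂ y)
        - t * ℓ - t ^ 2 / 2 * S a b) 0 := by
      filter_upwards [hline a b] with t ht
      simpa using ht
    have a7 := a6.hasDerivAt_eq_zero a5
    linarith
  have hG1 : G₁ x = (D (x, y)).1 + p₁ := by
    refine ext_inner_right ℝ fun a => ?_
    simpa using hgrad a 0
  have hG2 : G₂ y = (D (x, y)).2 + p₂ := by
    refine ext_inner_right ℝ fun b => ?_
    simpa using hgrad 0 b
  have hTd : DifferentiableAt ℝ T (x, y) := by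
    apply hgood
    simp only [T]
    rw [hG1, hG2]
    ext <;> simp
  have hG1d : DifferentiableAt ℝ G₁ x := by
    have h1 : G₁ = fun x' => (T (x', y)).1 + (D (x', y)).1 := by
      funext x'; simp only [T]; simp
    rw [h1]
    have h2 : DifferentiableAt ℝ (fun x' : E => (x', y)) x := by fun_prop
    have h3 : DifferentiableAt ℝ (fun x' => T (x', y)) x := hTd.comp x h2
    exact h3.fst.add (by fun_prop)
  have hG2d : DifferentiableAt ℝ G₂ y := by
    have h1 : G₂ = fun y' => (T (x, y')).2 + (D (x, y')).2 := by
      funext x'; simp only [T]; simp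
    rw [h1]
    have h2 : DifferentiableAt ℝ (fun y' : E => (x, y')) y := by fun_prop
    have h3 : DifferentiableAt ℝ (fun y' => T (x, y')) y := hTd.comp y h2
    exact h3.snd.add (by fun_prop)
  obtain ⟨X₁, hX₁⟩ := hG1d
  obtain ⟨X₂, hX₂⟩ := hG2d
  have hsec : ∀ a b, inner ℝ (X₁ a) a + inner ℝ (X₂ b) b ≤ S a b := by
    intro a b
    by_contra hcon
    push Not at hcon
    obtain ⟨Δ, hΔ⟩ : ∃ Δ, Δ = inner ℝ (X₁ a) a + inner ℝ (X₂ b) b - S a b := ⟨_, rfl⟩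
    have hΔ0 : 0 < Δ := by linarith
    obtain ⟨m, hm⟩ : ∃ m, m = ‖a‖ ^ 2 + ‖b‖ ^ 2 := ⟨_, rfl⟩
    have hm0 : 0 ≤ m := by rw [hm]; positivity
    have hη2 : 0 < Δ / (4 * (1 + m)) := by positivity
    have tend : ∀ c : E, Tendsto (fun t : ℝ => t • c) (𝓝[>] 0) (𝓝 0) := by
      intro c
      have : Continuous fun t : ℝ => t • c := by fun_prop
      have := this.tendsto 0
      rw [zero_smul] at this
      exact this.mono_left nhdsWithin_le_nhds
    have t1 := (tend a).eventually (taylor2 hd₁ hX₁ hη2)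
    have t2 := (tend b).eventually (taylor2 hd₂ hX₂ hη2)
    have t3 := (hline a b).filter_mono (nhdsWithin_le_nhds (s := Ioi 0))
    have t4 : ∀ᶠ t : ℝ in 𝓝[>] 0, 0 < t := self_mem_nhdsWithin
    obtain ⟨t, ⟨⟨h1, h2⟩, h3⟩, h4⟩ := (((t1.and t2).and t3).and t4).exists
    have g1 := (abs_le.1 h1).1
    have g2 := (abs_le.1 h2).1
    have g3 := hgrad a b
    simp only [map_smul, real_inner_smul_left, real_inner_smul_right, norm_smul, mul_pow,
      Real.norm_eq_abs, sq_abs] at g1 g2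
    rw [← g3] at h3
    have g4 : t ^ 2 * (Δ / 2) ≤ t ^ 2 * (Δ / (4 * (1 + m)) * m) := by
      rw [hΔ] at *
      rw [hm] at *
      linarith
    have g5 := le_of_mul_le_mul_left g4 (by positivity)
    have g6 : Δ / (4 * (1 + m)) * m ≤ Δ / 4 := by
      rw [div_mul_eq_mul_div, div_le_div_iff₀ (by positivity) (by positivity)]
      nlinarith
    linarith
  have hDn : ‖D (x, y)‖ ≤ ‖D‖ * R := by
    refine (D.le_opNorm _).trans ?_
    refine mul_le_mul_of_nonneg_left ?_ (norm_nonneg _)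
    rw [Prod.norm_def]; exact max_le hint.1.le hint.2.le
  have hq1 : ‖G₁ x‖ ≤ (1 + ‖D‖) * R := by
    rw [hG1]
    refine (norm_add_le _ _).trans ?_
    have := (norm_fst_le (D (x, y))).trans hDn
    linarith
  have hq2 : ‖G₂ y‖ ≤ (1 + ‖D‖) * R := by
    rw [hG2]
    refine (norm_add_le _ _).trans ?_
    have := (norm_snd_le (D (x, y))).trans hDn
    linarith
  have hk4 : ∀ v : E, ‖(1 / (4 * κ)) • v‖ ≤ ‖v‖ := by
    intro v
    rw [norm_smul, Real.norm_eq_abs, abs_of_pos (by positivity)]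
    have : 1 / (4 * κ) ≤ 1 := by
      rw [div_le_one (by positivity)]; linarith
    nlinarith [norm_nonneg v]
  have hcb : β + (Λ + η) < 4 * κ := by
    have : 0 ≤ 4 * (β + θ + Λ) ^ 2 / η := by positivity
    rw [hκdef]; linarith
  have hXb1 : ∀ a, inner ℝ (X₁ a) a ≤ (β + (Λ + η)) * ‖a‖ ^ 2 := by
    intro a
    have := hsec a 0
    have h2 : S a 0 ≤ (β + (Λ + η)) * ‖a‖ ^ 2 := by
      rw [hSdef]; unfold qS; simp
      have : 0 ≤ θ * inner ℝ n a ^ 2 := by positivity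
      linarith
    simp only [map_zero, inner_zero_left] at this
    linarith
  have hXb2 : ∀ a, inner ℝ (X₂ a) a ≤ (β + (Λ + η)) * ‖a‖ ^ 2 := by
    intro a
    have := hsec 0 a
    have h2 : S 0 a ≤ (β + (Λ + η)) * ‖a‖ ^ 2 := by
      rw [hSdef]; unfold qS; simp
      have : 0 ≤ θ * inner ℝ n a ^ 2 := by positivity
      linarith
    simp only [map_zero, inner_zero_left] at this
    linarith
  have fin : ∀ (g e : E → ℝ) (G : E → E) (ξ : E) (X : E →L[ℝ] E), ‖ξ‖ < R →
      ‖G ξ‖ ≤ (1 + ‖D‖) * R → (∀ x, HasFDerivAt e (innerSL ℝ (G x)) x) →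
      (∀ x, ∀ z ∈ closedBall (0:E) ρ, g z - 2 * κ * ‖x - z‖ ^ 2 ≤ e x) →
      e ξ = g (ξ + (1 / (4 * κ)) • G ξ) - 2 * κ * ‖(1 / (4 * κ)) • G ξ‖ ^ 2 →
      HasFDerivAt G X ξ →
      ‖ξ + (1 / (4 * κ)) • G ξ‖ < η ∧ ∀ᶠ k in 𝓝 (0:E), g (ξ + (1 / (4 * κ)) • G ξ + k)
        ≤ g (ξ + (1 / (4 * κ)) • G ξ) + inner ℝ (G ξ) k
          + 1 / 2 * inner ℝ ((X + η • ContinuousLinearMap.id ℝ E) k) k := by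
    intro g e G ξ X hξ hGξ hd hl he hX
    set v := (1 / (4 * κ)) • G ξ with hv
    have hvn : ‖v‖ ≤ (1 + ‖D‖) * R := (hk4 _).trans hGξ
    have hzn : ‖ξ + v‖ ≤ (2 + ‖D‖) * R := (norm_add_le _ _).trans (by linarith)
    refine ⟨hzn.trans_lt hRD1, ?_⟩
    have h1 : ∀ᶠ k in 𝓝 (0:E), ‖ξ + v + k‖ < ρ := by
      have : Continuous fun k : E => ‖ξ + v + k‖ := by fun_prop
      exact this.continuousAt.eventually (gt_mem_nhds (by simpa using hzn.trans_lt hRD2))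
    filter_upwards [h1, taylor2 hd hX (half_pos hη)] with k h1 h2
    have h3 := hl (ξ + k) (ξ + v + k) (by simpa using h1.le)
    have h4 : ξ + k - (ξ + v + k) = -v := by abel
    rw [h4, norm_neg] at h3
    have h5 := (abs_le.1 h2).2
    have h6 : inner ℝ ((X + η • ContinuousLinearMap.id ℝ E) k) k
        = inner ℝ (X k) k + η * ‖k‖ ^ 2 := by
      simp [inner_add_left, real_inner_smul_left]
    rw [h6]
    linarith
  have F1 := fin g₁ e₁ G₁ x X₁ hint.1 hq1 hd₁ hl₁
    (hc₁ x X₁ hX₁ ⟨_, hcb, hXb1⟩).2 hX₁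
  have F2 := fin g₂ e₂ G₂ y X₂ hint.2 hq2 hd₂ hl₂
    (hc₂ y X₂ hX₂ ⟨_, hcb, hXb2⟩).2 hX₂
  have hlt : (1 + ‖D‖) * R < η := by linarith
  refine ⟨_, _, G₁ x, G₂ y, _, _, F1.1, F2.1, hq1.trans_lt hlt, hq2.trans_lt hlt, F1.2, F2.2, ?_⟩
  intro a b
  have h1 := hsec a b
  have h2 : qS β θ (Λ + 2 * η) n a b = S a b + η * (‖a‖ ^ 2 + ‖b‖ ^ 2) := by
    rw [hSdef]; unfold qS; ring
  rw [h2]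
  simp only [add_apply, smul_apply,
    ContinuousLinearMap.id_apply, inner_add_left, real_inner_smul_left, real_inner_self_eq_norm_sq]
  linarith

theorem quad_test (p : ℝ) {N : ℕ} (c : ℝ) (P x₁ : EuclideanSpace ℝ (Fin N))
    (X : EuclideanSpace ℝ (Fin N) →L[ℝ] EuclideanSpace ℝ (Fin N)) :
    ContDiff ℝ 2 (fun x => c + inner ℝ P (x - x₁) + 1 / 2 * inner ℝ (X (x - x₁)) (x - x₁)) ∧
    pseudoPOp p (fun x => c + inner ℝ P (x - x₁) + 1 / 2 * inner ℝ (X (x - x₁)) (x - x₁)) x₁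
      = ∑ i : Fin N, |P i| ^ (p - 2) *
        inner ℝ (X (EuclideanSpace.single i 1)) (EuclideanSpace.single i 1) := by
  refine ⟨?_, ?_⟩
  · have h0 : ContDiff ℝ 2 (fun x : EuclideanSpace ℝ (Fin N) => x - x₁) := by fun_prop
    have h1 : ContDiff ℝ 2 (fun x : EuclideanSpace ℝ (Fin N) => X (x - x₁)) :=
      X.contDiff.comp h0
    exact (contDiff_const.add (contDiff_const.inner ℝ h0)).add
      (contDiff_const.mul (h1.inner ℝ h0))
  have hs : ∀ y : EuclideanSpace ℝ (Fin N), HasFDerivAt (fun x => x - x₁)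
      (ContinuousLinearMap.id ℝ (EuclideanSpace ℝ (Fin N))) y := fun y =>
    (hasFDerivAt_id y).sub_const x₁
  have hX : ∀ y : EuclideanSpace ℝ (Fin N), HasFDerivAt (fun x => X (x - x₁)) X y := fun y =>
    ((X.hasFDerivAt (x := y - x₁)).comp y (hs y)).congr_fderiv (by ext; simp)
  have h1 : ∀ y v, fderiv ℝ (fun x => c + inner ℝ P (x - x₁)
      + 1 / 2 * inner ℝ (X (x - x₁)) (x - x₁)) y v
      = inner ℝ P v + 1 / 2 * (inner ℝ (X (y - x₁)) v + inner ℝ (X v) (y - x₁)) := by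
    intro y v
    have a1 := (((hasFDerivAt_const P y).inner ℝ (hs y)).const_add c).add
      (((hX y).inner ℝ (hs y)).const_mul (1 / 2))
    have a2 := a1.fderiv
    have a3 := congrArg (fun T => T v) a2
    refine Eq.trans a3 ?_
    simp
  unfold pseudoPOp
  refine Finset.sum_congr rfl fun i _ => ?_
  have h2 : (fun y => fderiv ℝ (fun x => c + inner ℝ P (x - x₁)
      + 1 / 2 * inner ℝ (X (x - x₁)) (x - x₁)) y (EuclideanSpace.single i 1))
      = fun y => inner ℝ P (EuclideanSpace.single i 1)
        + 1 / 2 * (inner ℝ (X (y - x₁)) (EuclideanSpace.single i 1)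
        + inner ℝ (X (EuclideanSpace.single i 1)) (y - x₁)) := funext fun y => h1 y _
  rw [h2, h1]
  have h3 : ∀ v, fderiv ℝ (fun y => inner ℝ P v + 1 / 2 * (inner ℝ (X (y - x₁)) v
      + inner ℝ (X v) (y - x₁))) x₁ v = inner ℝ (X v) v := by
    intro v
    have a1 := ((((hX x₁).inner ℝ (hasFDerivAt_const v x₁)).add
      ((hasFDerivAt_const (X v) x₁).inner ℝ (hs x₁))).const_mul (1 / 2)).const_add (inner ℝ P v)
    have a3 := congrArg (fun T => T v) a1.fderiv
    refine Eq.trans a3 ?_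
    simp
    ring
  rw [h3]
  congr 3
  simp [EuclideanSpace.inner_single_right]

theorem norm_rpow_hasFDerivAt {E : Type*} [NormedAddCommGroup E] [InnerProductSpace ℝ E]
    (c : ℝ) {x : E} (hx : x ≠ 0) :
    HasFDerivAt (fun y : E => ‖y‖ ^ c) (innerSL ℝ ((c * ‖x‖ ^ (c - 2)) • x)) x := by
  have hpos : 0 < ‖x‖ := norm_pos_iff.2 hx
  have h1 := (hasStrictFDerivAt_norm_sq x).hasFDerivAt.rpow_const (p := c / 2)
    (Or.inl (by positivity))
  have h2 : (fun y : E => ‖y‖ ^ c) = fun y => (‖y‖ ^ 2) ^ (c / 2) := by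
    funext y
    rw [← Real.rpow_natCast, ← Real.rpow_mul (norm_nonneg _)]
    congr 1; push_cast; ring
  rw [h2]
  refine h1.congr_fderiv ?_
  have h3 : (‖x‖ ^ 2) ^ (c / 2 - 1) = ‖x‖ ^ (c - 2) := by
    rw [← Real.rpow_natCast, ← Real.rpow_mul (norm_nonneg _)]
    congr 1; push_cast; ring
  rw [h3]
  ext v
  simp
  ring

theorem pow_taylor {E : Type*} [NormedAddCommGroup E] [InnerProductSpace ℝ E]
    {M γ η : ℝ} (hM : 0 ≤ M) (hη : 0 < η) {t : E} (ht : t ≠ 0) :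
    ∀ᶠ τ in 𝓝 (0 : E), M * ‖t + τ‖ ^ γ ≤ M * ‖t‖ ^ γ
      + inner ℝ ((M * γ * ‖t‖ ^ (γ - 2)) • t) τ
      + 1 / 2 * ((M * γ * ‖t‖ ^ (γ - 2)) * ‖τ‖ ^ 2
        - (M * γ * ‖t‖ ^ (γ - 2) * (2 - γ)) * (inner ℝ (‖t‖⁻¹ • t) τ) ^ 2) + η * ‖τ‖ ^ 2 := by
  have hpos : 0 < ‖t‖ := norm_pos_iff.2 ht
  have hG : ∀ᶠ x in 𝓝 t, HasFDerivAt (fun y : E => ‖y‖ ^ γ)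
      (innerSL ℝ ((γ * ‖x‖ ^ (γ - 2)) • x)) x := by
    filter_upwards [isOpen_ne.mem_nhds ht] with x hx
    exact norm_rpow_hasFDerivAt γ hx
  have hX : HasFDerivAt (fun x : E => (γ * ‖x‖ ^ (γ - 2)) • x)
      ((γ * ‖t‖ ^ (γ - 2)) • ContinuousLinearMap.id ℝ E
        + (γ • innerSL ℝ (((γ - 2) * ‖t‖ ^ (γ - 2 - 2)) • t)).smulRight t) t :=
    ((norm_rpow_hasFDerivAt (γ - 2) ht).const_mul γ).smul (hasFDerivAt_id t)
  have hη' : 0 < η / (M + 1) := by positivity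
  filter_upwards [taylor2_local hG hX hη'] with τ h
  have h1 := (abs_le.1 h).2
  have h2 : M * (η / (M + 1) * ‖τ‖ ^ 2) ≤ η * ‖τ‖ ^ 2 := by
    have : M * (η / (M + 1)) ≤ η := by
      rw [← mul_div_assoc, div_le_iff₀ (by positivity)]; nlinarith
    nlinarith [sq_nonneg ‖τ‖]
  have h3 := mul_le_mul_of_nonneg_left h1 hM
  have h4 : ‖t‖ ^ (γ - 2 - 2) = ‖t‖ ^ (γ - 2) * (‖t‖⁻¹) ^ 2 := by
    rw [Real.rpow_sub hpos (γ - 2) 2]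
    norm_num
    rw [div_eq_mul_inv]
  simp only [add_apply, smul_apply, ContinuousLinearMap.id_apply,
    ContinuousLinearMap.smulRight_apply, innerSL_apply_apply, inner_add_left,
    real_inner_smul_left, real_inner_self_eq_norm_sq, smul_eq_mul, h4] at h3 ⊢
  linarith

theorem rpow_unif {s : ℝ} (hs : 0 < s) {δ : ℝ} (hδ : 0 < δ) :
    ∃ μ > 0, μ ≤ 1 ∧ ∀ a b : ℝ, |a| ≤ 2 → |b| ≤ 2 → |a - b| ≤ μ →
      |(|a| ^ s - |b| ^ s)| ≤ δ := by
  have hc : ContinuousOn (fun a : ℝ => |a| ^ s) (Icc (-2) 2) :=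
    (continuous_abs.rpow_const fun _ => Or.inr hs.le).continuousOn
  have hu := isCompact_Icc.uniformContinuousOn_of_continuous hc
  obtain ⟨μ, hμ, h⟩ := Metric.uniformContinuousOn_iff.1 hu δ hδ
  refine ⟨min 1 (μ / 2), by positivity, min_le_left _ _, fun a b ha hb hab => ?_⟩
  have := h a (abs_le.1 ha) b (abs_le.1 hb) (by
    rw [Real.dist_eq]
    linarith [min_le_right 1 (μ / 2)])
  rw [Real.dist_eq] at this
  exact this.le

theorem quad_jensen {E : Type*} [NormedAddCommGroup E] [InnerProductSpace ℝ E]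
    (Z : E →L[ℝ] E) (hZ : ∀ a, inner ℝ (Z a) a ≤ 0) {N : ℕ} (v : Fin N → E) :
    (N : ℝ) * ∑ k, inner ℝ (Z (v k)) (v k) ≤ inner ℝ (Z (∑ k, v k)) (∑ k, v k) := by
  have h1 : ∑ j, ∑ k, inner ℝ (Z (v j - v k)) (v j - v k) ≤ 0 :=
    Finset.sum_nonpos fun j _ => Finset.sum_nonpos fun k _ => hZ _
  have h2 : ∑ j, ∑ k, inner ℝ (Z (v j - v k)) (v j - v k)
      = 2 * ((N : ℝ) * ∑ k, inner ℝ (Z (v k)) (v k))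
        - 2 * inner ℝ (Z (∑ k, v k)) (∑ k, v k) := by
    have h3 : ∀ j k, inner ℝ (Z (v j - v k)) (v j - v k)
        = inner ℝ (Z (v j)) (v j) + inner ℝ (Z (v k)) (v k)
          - inner ℝ (Z (v j)) (v k) - inner ℝ (Z (v k)) (v j) := by
      intro j k
      rw [map_sub]
      simp only [inner_sub_left, inner_sub_right]; ring
    simp only [h3, Finset.sum_sub_distrib, Finset.sum_add_distrib, Finset.sum_const,
      Finset.card_univ, Fintype.card_fin, nsmul_eq_mul]
    rw [map_sum]
    simp only [sum_inner, inner_sum]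
    rw [Finset.sum_comm (f := fun x y => inner ℝ (Z (v y)) (v x)), ← Finset.mul_sum]
    ring
  linarith

theorem alg_k {α α' ν δ b m Y₁ Y₂ Λ B : ℝ} (hα : 0 ≤ α) (hα' : 0 ≤ α')
    (h1 : |α - ν| ≤ δ) (h2 : |α' - ν| ≤ δ) (hν : ν ≤ 1) (hδ : δ ≤ 1) (hΛ : 0 ≤ Λ) (hB : 0 ≤ B)
    (hm : m ≤ 1) (hb : 0 ≤ b) (hmb : m = 0 ∨ b ≤ ν - δ)
    (hY1 : Y₁ ≤ B) (hY2 : Y₂ ≤ B) (hZ : Y₁ + Y₂ - 2 * Λ ≤ 0) :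
    α * Y₁ + α' * Y₂ ≤ b * (m * (Y₁ + Y₂ - 2 * Λ)) + 4 * Λ + 4 * δ * B := by
  obtain ⟨h1a, h1b⟩ := abs_le.1 h1
  obtain ⟨h2a, h2b⟩ := abs_le.1 h2
  obtain ⟨w, hw⟩ : ∃ w, w = min α α' := ⟨_, rfl⟩
  have w1 : w ≤ α := by rw [hw]; exact min_le_left _ _
  have w2 : w ≤ α' := by rw [hw]; exact min_le_right _ _
  have w3 : 0 ≤ w := by rw [hw]; exact le_min hα hα'
  have w4 : ν - δ ≤ w := by rw [hw]; exact le_min (by linarith) (by linarith)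
  have k1 : b * m ≤ w := by
    rcases hmb with h | h
    · rw [h]; simpa using w3
    · nlinarith
  have k2 : w * (Y₁ + Y₂ - 2 * Λ) ≤ b * m * (Y₁ + Y₂ - 2 * Λ) :=
    mul_le_mul_of_nonpos_right k1 hZ
  have k3 : w * (2 * Λ) ≤ 2 * (2 * Λ) :=
    mul_le_mul_of_nonneg_right (by linarith) (by linarith)
  have k4 : (α - w) * Y₁ ≤ 2 * δ * B :=
    (mul_le_mul_of_nonneg_left hY1 (by linarith)).trans
      (mul_le_mul_of_nonneg_right (by linarith) hB)
  have k5 : (α' - w) * Y₂ ≤ 2 * δ * B :=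
    (mul_le_mul_of_nonneg_left hY2 (by linarith)).trans
      (mul_le_mul_of_nonneg_right (by linarith) hB)
  linarith

set_option maxHeartbeats 1000000 in
theorem alg_main (N : ℕ) (hN : 1 ≤ N) (p : ℝ) (hp : 2 < p) (γ : ℝ) (hγ : γ ∈ Ioo (0 : ℝ) 1) :
    ∃ c > 0, ∃ μ > 0, ∃ lam > 0, ∀ (Q β₀ Λ : ℝ) (n P P' : EuclideanSpace ℝ (Fin N))
      (X₁ X₂ : EuclideanSpace ℝ (Fin N) →L[ℝ] EuclideanSpace ℝ (Fin N)),
      0 < Q → 0 < β₀ → 0 ≤ Λ → Λ ≤ lam * β₀ → ‖n‖ = 1 →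
      (∀ k, |P k - Q * n k| ≤ μ * Q) → (∀ k, |P' k - Q * n k| ≤ μ * Q) →
      (∀ a b, inner ℝ (X₁ a) a + inner ℝ (X₂ b) b ≤ qS β₀ (β₀ * (2 - γ)) Λ n a b) →
      (∑ i : Fin N, |P i| ^ (p - 2) *
        inner ℝ (X₁ (EuclideanSpace.single i 1)) (EuclideanSpace.single i 1)) +
      (∑ i : Fin N, |P' i| ^ (p - 2) *
        inner ℝ (X₂ (EuclideanSpace.single i 1)) (EuclideanSpace.single i 1))
      ≤ - c * β₀ * Q ^ (p - 2) := by
  obtain ⟨hγ0, hγ1⟩ := hγ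
  obtain ⟨s, hs⟩ : ∃ s, s = p - 2 := ⟨_, rfl⟩
  have hs0 : 0 < s := by linarith
  obtain ⟨g, hg⟩ : ∃ g, g = 1 - γ := ⟨_, rfl⟩
  have hg0 : 0 < g := by linarith
  have hg1 : g < 1 := by linarith
  have hNr : (1:ℝ) ≤ N := by exact_mod_cast hN
  obtain ⟨σ, hσ⟩ : ∃ σ, σ = Real.sqrt (g / (4 * N)) := ⟨_, rfl⟩
  have hσ0 : 0 < σ := by rw [hσ]; positivity
  have hσ2 : N * σ ^ 2 = g / 4 := by
    rw [hσ, Real.sq_sqrt (by positivity)]; field_simp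
  have hσ1 : σ ≤ 1 := by
    by_contra hcon
    push Not at hcon
    nlinarith
  obtain ⟨b, hb⟩ : ∃ b, b = 1 / 2 * σ ^ s := ⟨_, rfl⟩
  have hb0 : 0 < b := by rw [hb]; positivity
  have hb1 : b ≤ 1 / 2 := by
    have := Real.rpow_le_one hσ0.le hσ1 hs0.le
    linarith
  obtain ⟨δ, hδ⟩ : ∃ δ, δ = b * g / (16 * N ^ 2) := ⟨_, rfl⟩
  have hδ0 : 0 < δ := by rw [hδ]; positivity
  have hδN : δ * (16 * N ^ 2) = b * g := by rw [hδ]; field_simp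
  have hδb : δ ≤ b := by
    have h1 : (1:ℝ) ≤ 16 * (N:ℝ) ^ 2 := by nlinarith
    have h2 : δ * 1 ≤ δ * (16 * N ^ 2) := mul_le_mul_of_nonneg_left h1 hδ0.le
    have h3 : b * g ≤ b * 1 := mul_le_mul_of_nonneg_left hg1.le hb0.le
    linarith
  obtain ⟨μ, hμ0, hμ1, hμ⟩ := rpow_unif hs0 hδ0
  refine ⟨b * g / (2 * N), by positivity, μ, hμ0, δ / 2, by positivity, ?_⟩
  intro Q β₀ Λ n P P' X₁ X₂ hQ hβ hΛ hΛl hn hP hP' hX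
  rw [← hs]
  have hnk : ∀ k, |n k| ≤ 1 := by
    intro k
    rw [← hn]
    exact PiLp.norm_apply_le n k
  -- scaling
  have hscale : ∀ R : EuclideanSpace ℝ (Fin N), (∀ k, |R k - Q * n k| ≤ μ * Q) → ∀ k,
      |(|R k / Q| ^ s - |n k| ^ s)| ≤ δ ∧ |R k| ^ s = Q ^ s * |R k / Q| ^ s := by
    intro R hR k
    have h1 : |R k / Q - n k| ≤ μ := by
      have : R k / Q - n k = (R k - Q * n k) / Q := by field_simp
      rw [this, abs_div, abs_of_pos hQ, div_le_iff₀ hQ]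
      exact hR k
    have h2 : |R k / Q| ≤ 2 := by
      have := abs_sub_abs_le_abs_sub (R k / Q) (n k)
      linarith [hnk k]
    refine ⟨hμ _ _ h2 ((hnk k).trans one_le_two) h1, ?_⟩
    rw [← Real.mul_rpow hQ.le (abs_nonneg _), abs_div, abs_of_pos hQ]
    congr 1
    field_simp
  -- the vector m
  let m : EuclideanSpace ℝ (Fin N) := WithLp.toLp 2 (fun k => if σ ≤ |n k| then n k else 0)
  have hmk : ∀ k, m k = if σ ≤ |n k| then n k else 0 := fun k => rfl
  have hms : m = ∑ k, m k • EuclideanSpace.single k (1:ℝ) := by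
    have := (EuclideanSpace.basisFun (Fin N) ℝ).sum_repr m
    simpa using this.symm
  have hnsq : ∑ k, (n k) ^ 2 = 1 := by
    rw [← EuclideanSpace.real_norm_sq_eq, hn]; norm_num
  have hmsq : ‖m‖ ^ 2 = ∑ k, (m k) ^ 2 := EuclideanSpace.real_norm_sq_eq m
  have hnm : inner ℝ n m = ‖m‖ ^ 2 := by
    rw [hmsq, PiLp.inner_apply]
    refine Finset.sum_congr rfl fun k _ => ?_
    rw [hmk]
    split_ifs <;> simp [sq]
  have hw1 : 1 - g / 4 ≤ ‖m‖ ^ 2 := by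
    have h1 : ∀ k ∈ Finset.univ, (n k) ^ 2 - σ ^ 2 ≤ (m k) ^ 2 := by
      intro k _
      rw [hmk]
      split_ifs with h
      · linarith [sq_nonneg σ]
      · push Not at h
        have := pow_le_pow_left₀ (abs_nonneg _) h.le 2
        rw [sq_abs] at this
        nlinarith
    have h2 := Finset.sum_le_sum h1
    rw [Finset.sum_sub_distrib, hnsq, ← hmsq] at h2
    simp only [Finset.sum_const, Finset.card_univ, Fintype.card_fin, nsmul_eq_mul] at h2
    linarith
  have hwneg : ‖m‖ ^ 2 - (2 - γ) * (‖m‖ ^ 2) ^ 2 ≤ - (g / 4) := by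
    obtain ⟨w, hw⟩ : ∃ w, w = ‖m‖ ^ 2 := ⟨_, rfl⟩
    rw [← hw] at hw1 ⊢
    have e1 : 1 + g / 2 ≤ (2 - γ) * w := by
      have : (2 - γ) * (1 - g / 4) ≤ (2 - γ) * w :=
        mul_le_mul_of_nonneg_left hw1 (by linarith)
      have h2 : 2 - γ = 1 + g := by linarith
      rw [h2] at this ⊢
      nlinarith
    have e2 : 3 / 4 ≤ w := by linarith
    nlinarith
  -- the form Z
  let Z : EuclideanSpace ℝ (Fin N) →L[ℝ] EuclideanSpace ℝ (Fin N) :=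
    X₁ + X₂ - (2 * Λ) • ContinuousLinearMap.id ℝ _
  have hZa : ∀ a, inner ℝ (Z a) a = inner ℝ (X₁ a) a + inner ℝ (X₂ a) a - 2 * Λ * ‖a‖ ^ 2 := by
    intro a
    simp only [Z, sub_apply, add_apply, smul_apply, ContinuousLinearMap.id_apply, inner_sub_left,
      inner_add_left, real_inner_smul_left, real_inner_self_eq_norm_sq]
  have hZ : ∀ a, inner ℝ (Z a) a ≤ 0 := by
    intro a
    have := hX a a
    rw [hZa]
    simp only [qS, sub_self, norm_zero, inner_zero_right] at this
    nlinarith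
  have hZm : inner ℝ (Z m) m ≤ - (β₀ * g) := by
    have h1 := hX m (-m)
    have h2 : m - -m = (2:ℝ) • m := by module
    simp only [qS, h2, norm_smul, real_inner_smul_right, hnm, map_neg, inner_neg_left,
      inner_neg_right, neg_neg, norm_neg, Real.norm_ofNat, mul_pow] at h1
    rw [hZa]
    have h3 := mul_le_mul_of_nonneg_left hwneg (show 0 ≤ 4 * β₀ by positivity)
    nlinarith
  have hJ := quad_jensen Z hZ (fun k => m k • EuclideanSpace.single k (1:ℝ))
  rw [← hms] at hJ
  have hZk : ∀ k, inner ℝ (Z (m k • EuclideanSpace.single k (1:ℝ)))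
      (m k • EuclideanSpace.single k (1:ℝ))
      = (m k) ^ 2 * inner ℝ (Z (EuclideanSpace.single k (1:ℝ))) (EuclideanSpace.single k (1:ℝ)) := by
    intro k
    rw [map_smul, real_inner_smul_left, real_inner_smul_right]; ring
  simp only [hZk] at hJ
  have hk : ∀ k ∈ Finset.univ, |P k / Q| ^ s *
        inner ℝ (X₁ (EuclideanSpace.single k 1)) (EuclideanSpace.single k 1)
      + |P' k / Q| ^ s *
        inner ℝ (X₂ (EuclideanSpace.single k 1)) (EuclideanSpace.single k 1)
      ≤ b * ((m k) ^ 2 *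
        inner ℝ (Z (EuclideanSpace.single k (1:ℝ))) (EuclideanSpace.single k (1:ℝ)))
        + (4 * Λ + 4 * δ * (β₀ + Λ)) := by
    intro k _
    have hE : ‖(EuclideanSpace.single k (1:ℝ) : EuclideanSpace ℝ (Fin N))‖ = 1 := by simp
    have e1 : inner ℝ (X₁ (EuclideanSpace.single k 1)) (EuclideanSpace.single k (1:ℝ))
        ≤ β₀ + Λ := by
      have := hX (EuclideanSpace.single k 1) 0
      simp only [qS, map_zero, inner_zero_left, sub_zero, hE, norm_zero] at this
      have h2 : 0 ≤ β₀ * (2 - γ) * (inner ℝ n (EuclideanSpace.single k (1:ℝ))) ^ 2 :=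
        mul_nonneg (mul_nonneg hβ.le (by linarith)) (sq_nonneg _)
      linarith
    have e2 : inner ℝ (X₂ (EuclideanSpace.single k 1)) (EuclideanSpace.single k (1:ℝ))
        ≤ β₀ + Λ := by
      have := hX 0 (EuclideanSpace.single k 1)
      simp only [qS, map_zero, inner_zero_left, zero_sub, norm_neg, inner_neg_right, hE,
        norm_zero] at this
      have h2 : 0 ≤ β₀ * (2 - γ) * (- inner ℝ n (EuclideanSpace.single k (1:ℝ))) ^ 2 :=
        mul_nonneg (mul_nonneg hβ.le (by linarith)) (sq_nonneg _)
      linarith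
    have e3 := hZ (EuclideanSpace.single k 1)
    rw [hZa, hE] at e3 ⊢
    have hmk2 : (m k) ^ 2 ≤ 1 := by
      rw [hmk]
      split_ifs
      · rw [sq_le_one_iff_abs_le_one]; exact hnk k
      · norm_num
    have := alg_k (b := b) (m := (m k) ^ 2) (Λ := Λ) (Real.rpow_nonneg (abs_nonneg (P k / Q)) s)
      (Real.rpow_nonneg (abs_nonneg (P' k / Q)) s)
      (hscale P hP k).1 (hscale P' hP' k).1
      (Real.rpow_le_one (abs_nonneg _) (hnk k) hs0.le) (by linarith) hΛ (by linarith)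
      hmk2 hb0.le (by
        rw [hmk]
        split_ifs with h
        · right
          have := Real.rpow_le_rpow hσ0.le h hs0.le
          linarith
        · left; norm_num) e1 e2 (by linarith)
    simp only [one_pow, mul_one] at *
    linarith
  have hsum := Finset.sum_le_sum hk
  rw [Finset.sum_add_distrib, Finset.sum_add_distrib, ← Finset.mul_sum] at hsum
  simp only [Finset.sum_const, Finset.card_univ, Fintype.card_fin, nsmul_eq_mul] at hsum
  obtain ⟨S, hS⟩ : ∃ S, S = ∑ k, (m k) ^ 2 *
    inner ℝ (Z (EuclideanSpace.single k (1:ℝ))) (EuclideanSpace.single k (1:ℝ)) := ⟨_, rfl⟩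
  rw [← hS] at hsum hJ
  have hL : ∀ (R : EuclideanSpace ℝ (Fin N)) (Y : Fin N → ℝ),
      (∀ k, |R k - Q * n k| ≤ μ * Q) → ∑ k, |R k| ^ s * Y k
        = Q ^ s * ∑ k, |R k / Q| ^ s * Y k := by
    intro R Y hR
    rw [Finset.mul_sum]
    refine Finset.sum_congr rfl fun k _ => ?_
    rw [(hscale R hR k).2, mul_assoc]
  rw [hL P _ hP, hL P' _ hP', ← mul_add]
  have hfin : b * S + N * (4 * Λ + 4 * δ * (β₀ + Λ)) ≤ - (b * g / (2 * N)) * β₀ := by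
    have f1 : N * (b * S) ≤ - (b * g * β₀) := by
      have := mul_le_mul_of_nonneg_left (hJ.trans hZm) hb0.le
      linarith
    have f2 : (N:ℝ) * (N * (4 * Λ + 4 * δ * (β₀ + Λ))) ≤ b * g * β₀ / 2 := by
      have g1 : 4 * Λ + 4 * δ * (β₀ + Λ) ≤ 8 * δ * β₀ := by
        have : δ * Λ ≤ 1 * Λ := mul_le_mul_of_nonneg_right (by linarith) hΛ
        linarith
      have g2 := mul_le_mul_of_nonneg_left g1 (show 0 ≤ (N:ℝ) ^ 2 by positivity)
      have g3 : b * g * β₀ = δ * (16 * N ^ 2) * β₀ := by rw [hδN]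
      rw [g3]
      linarith
    have f3 : (N:ℝ) * (b * S + N * (4 * Λ + 4 * δ * (β₀ + Λ)))
        ≤ N * (- (b * g / (2 * N)) * β₀) := by
      have : (N:ℝ) * (- (b * g / (2 * N)) * β₀) = - (b * g * β₀ / 2) := by field_simp
      rw [this]; linarith
    exact le_of_mul_le_mul_left f3 (by linarith)
  have := mul_le_mul_of_nonneg_left (hsum.trans hfin) (Real.rpow_nonneg hQ.le s)
  linarith

theorem sub_test {p : ℝ} {N : ℕ} {Ω : Set (EuclideanSpace ℝ (Fin N))}
    {u f : EuclideanSpace ℝ (Fin N) → ℝ} (h : IsViscSubsol p Ω u f)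
    {x₁ P : EuclideanSpace ℝ (Fin N)} (hx : x₁ ∈ Ω)
    {X : EuclideanSpace ℝ (Fin N) →L[ℝ] EuclideanSpace ℝ (Fin N)}
    (hk : ∀ᶠ k in 𝓝 (0 : EuclideanSpace ℝ (Fin N)),
      u (x₁ + k) ≤ u x₁ + inner ℝ P k + 1 / 2 * inner ℝ (X k) k) :
    f x₁ ≤ ∑ i : Fin N, |P i| ^ (p - 2) *
        inner ℝ (X (EuclideanSpace.single i 1)) (EuclideanSpace.single i 1) := by
  obtain ⟨h1, h2⟩ := quad_test p (u x₁) P x₁ X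
  rw [← h2]
  refine h x₁ hx _ ⟨1, one_pos, h1.contDiffOn⟩ (by simp) ?_
  have ht : Tendsto (fun x => x - x₁) (𝓝 x₁) (𝓝 0) := by
    have h3 : Continuous fun x => x - x₁ := by fun_prop
    simpa using h3.tendsto x₁
  filter_upwards [ht.eventually hk] with x hx
  simpa using hx

theorem super_test {p : ℝ} {N : ℕ} {Ω : Set (EuclideanSpace ℝ (Fin N))}
    {u f : EuclideanSpace ℝ (Fin N) → ℝ} (h : IsViscSupersol p Ω u f)
    {x₁ P : EuclideanSpace ℝ (Fin N)} (hx : x₁ ∈ Ω)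
    {X : EuclideanSpace ℝ (Fin N) →L[ℝ] EuclideanSpace ℝ (Fin N)}
    (hk : ∀ᶠ k in 𝓝 (0 : EuclideanSpace ℝ (Fin N)),
      u x₁ + inner ℝ P k - 1 / 2 * inner ℝ (X k) k ≤ u (x₁ + k)) :
    - f x₁ ≤ ∑ i : Fin N, |P i| ^ (p - 2) *
        inner ℝ (X (EuclideanSpace.single i 1)) (EuclideanSpace.single i 1) := by
  obtain ⟨h1, h2⟩ := quad_test p (u x₁) P x₁ (-X)
  have h3 := h x₁ hx _ ⟨1, one_pos, h1.contDiffOn⟩ (by simp) (by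
    have ht : Tendsto (fun x => x - x₁) (𝓝 x₁) (𝓝 0) := by
      have h3 : Continuous fun x => x - x₁ := by fun_prop
      simpa using h3.tendsto x₁
    filter_upwards [ht.eventually hk] with x hx
    rw [add_sub_cancel] at hx
    rw [neg_apply, inner_neg_left]
    linarith)
  rw [h2] at h3
  simp only [neg_apply, inner_neg_left, mul_neg, Finset.sum_neg_distrib] at h3
  linarith

set_option maxHeartbeats 2000000 in
theorem one_sided (N : ℕ) (hN : 1 ≤ N) (p : ℝ) (hp : 2 < p)
    (r : ℝ) (hr0 : 0 < r) (hr : r < 1) (γ : ℝ) (hγ : γ ∈ Ioo (0 : ℝ) 1) :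
    ∃ M₀ : ℝ, ∀ (f u : EuclideanSpace ℝ (Fin N) → ℝ) (U F K : ℝ),
      0 ≤ F → 0 < K → K = U + F ^ (1 / (p - 1)) →
      (∀ x ∈ ball (0 : EuclideanSpace ℝ (Fin N)) 1, |u x| ≤ U) →
      (∀ x ∈ ball (0 : EuclideanSpace ℝ (Fin N)) 1, |f x| ≤ F) →
      ContinuousOn u (ball 0 1) →
      IsViscSubsol p (ball 0 1) u f →
      IsViscSupersol p (ball 0 1) u f →
      ∀ x ∈ ball (0 : EuclideanSpace ℝ (Fin N)) r,
        ∀ y ∈ ball (0 : EuclideanSpace ℝ (Fin N)) r,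
          u x - u y ≤ M₀ * K * ‖x - y‖ ^ γ := by
  obtain ⟨c, hc, μ, hμ, lam, hlam, halg⟩ := alg_main N hN p hp γ hγ
  obtain ⟨hγ0, hγ1⟩ := hγ
  obtain ⟨d, hd⟩ : ∃ d, d = (1 - r) / 8 := ⟨_, rfl⟩
  have hd0 : 0 < d := by rw [hd]; linarith
  have hd1 : d ≤ 1 := by rw [hd]; linarith
  obtain ⟨L₀, hL₀⟩ : ∃ L₀, L₀ = 2 / d ^ 2 := ⟨_, rfl⟩
  have hL₀0 : 0 < L₀ := by rw [hL₀]; positivity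
  obtain ⟨A, hA⟩ : ∃ A, A = 1 + 3 / c + 3 * L₀ / μ + 6 * L₀ / lam := ⟨_, rfl⟩
  have q1 : 0 < 3 / c := by positivity
  have q2 : 0 < 3 * L₀ / μ := by positivity
  have q3 : 0 < 6 * L₀ / lam := by positivity
  have hA0 : 0 < A := by linarith
  obtain ⟨M₀, hM₀⟩ : ∃ M₀, M₀ = A / γ + 2 / d ^ γ := ⟨_, rfl⟩
  have hM₀0 : 0 < M₀ := by rw [hM₀]; positivity
  have hMA : A ≤ M₀ * γ := by
    have : A / γ ≤ M₀ := by
      rw [hM₀]; have : 0 < 2 / d ^ γ := by positivity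
      linarith
    rwa [div_le_iff₀ hγ0] at this
  have hM1 : 1 ≤ M₀ * γ := by linarith
  have hMc : 3 ≤ c * (M₀ * γ) := by
    have : 3 / c ≤ M₀ * γ := by linarith
    rw [div_le_iff₀ hc] at this; linarith
  have hMμ : 3 * L₀ ≤ μ * (M₀ * γ) := by
    have : 3 * L₀ / μ ≤ M₀ * γ := by linarith
    rw [div_le_iff₀ hμ] at this; linarith
  have hMl : 6 * L₀ ≤ lam * (M₀ * γ) := by
    have : 6 * L₀ / lam ≤ M₀ * γ := by linarith
    rw [div_le_iff₀ hlam] at this; linarith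
  have hMd : 2 ≤ M₀ * d ^ γ := by
    have : 2 / d ^ γ ≤ M₀ := by
      rw [hM₀]; have : 0 < A / γ := by positivity
      linarith
    rwa [div_le_iff₀ (by positivity)] at this
  refine ⟨M₀, ?_⟩
  intro f u U F K hF hK hKdef hU hFb hu hsub hsup x₀ hx₀ y₀ hy₀
  by_contra hcon
  push Not at hcon
  have hFK : F ≤ K ^ (p - 1) := by
    have hU0 : 0 ≤ U := (abs_nonneg _).trans (hU 0 (by simp))
    have h1 : F ^ (1 / (p - 1)) ≤ K := by linarith
    have h2 := Real.rpow_le_rpow (by positivity) h1 (show 0 ≤ p - 1 by linarith)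
    rw [← Real.rpow_mul hF, one_div_mul_cancel (by linarith), Real.rpow_one] at h2
    exact h2
  have hUK : U ≤ K := by
    have : 0 ≤ F ^ (1 / (p - 1)) := by positivity
    linarith
  obtain ⟨M, hM⟩ : ∃ M, M = M₀ * K := ⟨_, rfl⟩
  obtain ⟨L, hL⟩ : ∃ L, L = L₀ * K := ⟨_, rfl⟩
  have hM0 : 0 < M := by rw [hM]; positivity
  have hL0 : 0 < L := by rw [hL]; positivity
  rw [← hM] at hcon
  rw [mem_ball_zero_iff] at hx₀ hy₀
  have hR1 : r + 4 * d < 1 := by rw [hd]; linarith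
  have hsubset : closedBall (0 : EuclideanSpace ℝ (Fin N)) (r + 4 * d) ⊆ ball 0 1 :=
    closedBall_subset_ball hR1
  have huc := hu.mono hsubset
  obtain ⟨⟨xb, yb⟩, hxy, hmax⟩ := ((isCompact_closedBall (0 : EuclideanSpace ℝ (Fin N))
    (r + 4 * d)).prod (isCompact_closedBall (0 : EuclideanSpace ℝ (Fin N))
    (r + 4 * d))).exists_isMaxOn (f := fun ζ : EuclideanSpace ℝ (Fin N) × EuclideanSpace ℝ (Fin N)
      => u ζ.1 - u ζ.2 - M * ‖ζ.1 - ζ.2‖ ^ γ - L * ‖ζ.1 - x₀‖ ^ 2)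
    ⟨(x₀, y₀), by
      refine ⟨?_, ?_⟩ <;> rw [mem_closedBall_zero_iff] <;> simp only <;> linarith⟩ (by
      have a1 := huc.comp (continuous_fst.continuousOn
        (s := closedBall (0 : EuclideanSpace ℝ (Fin N)) (r + 4 * d) ×ˢ
          closedBall (0 : EuclideanSpace ℝ (Fin N)) (r + 4 * d))) (fun ζ hζ => hζ.1)
      have a2 := huc.comp (continuous_snd.continuousOn
        (s := closedBall (0 : EuclideanSpace ℝ (Fin N)) (r + 4 * d) ×ˢ
          closedBall (0 : EuclideanSpace ℝ (Fin N)) (r + 4 * d))) (fun ζ hζ => hζ.2)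
      have a3 : Continuous fun ζ : EuclideanSpace ℝ (Fin N) × EuclideanSpace ℝ (Fin N) =>
          ‖ζ.1 - ζ.2‖ ^ γ :=
        (by fun_prop : Continuous fun ζ : EuclideanSpace ℝ (Fin N) × EuclideanSpace ℝ (Fin N) =>
          ‖ζ.1 - ζ.2‖).rpow_const fun _ => Or.inr hγ0.le
      have a4 : Continuous fun ζ : EuclideanSpace ℝ (Fin N) × EuclideanSpace ℝ (Fin N) =>
          L * ‖ζ.1 - x₀‖ ^ 2 := by fun_prop
      exact ((a1.sub a2).sub (continuous_const.mul a3).continuousOn).sub a4.continuousOn)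
  have hmax' : ∀ x ∈ closedBall (0 : EuclideanSpace ℝ (Fin N)) (r + 4 * d),
      ∀ y ∈ closedBall (0 : EuclideanSpace ℝ (Fin N)) (r + 4 * d),
      u x - u y - M * ‖x - y‖ ^ γ - L * ‖x - x₀‖ ^ 2
        ≤ u xb - u yb - M * ‖xb - yb‖ ^ γ - L * ‖xb - x₀‖ ^ 2 := by
    intro x hx y hy
    exact hmax (show (x, y) ∈ _ from ⟨hx, hy⟩)
  have hxb1 : xb ∈ ball (0 : EuclideanSpace ℝ (Fin N)) 1 := hsubset hxy.1
  have hyb1 : yb ∈ ball (0 : EuclideanSpace ℝ (Fin N)) 1 := hsubset hxy.2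
  have hpos : 0 < u xb - u yb - M * ‖xb - yb‖ ^ γ - L * ‖xb - x₀‖ ^ 2 := by
    have := hmax' x₀ (by rw [mem_closedBall_zero_iff]; linarith) y₀
      (by rw [mem_closedBall_zero_iff]; linarith)
    simp only [sub_self, norm_zero] at this
    linarith
  clear hmax hxy
  obtain ⟨t, ht⟩ : ∃ t, t = xb - yb := ⟨_, rfl⟩
  have ht0 : t ≠ 0 := by
    intro h
    rw [h] at ht
    have hxy : xb = yb := (sub_eq_zero.1 ht.symm)
    rw [hxy] at hpos
    simp only [sub_self, norm_zero, Real.zero_rpow hγ0.ne', mul_zero] at hpos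
    have : 0 ≤ L * ‖yb - x₀‖ ^ 2 := by positivity
    linarith
  rw [← ht] at hpos
  obtain ⟨ρ, hρ⟩ : ∃ ρ, ρ = ‖t‖ := ⟨_, rfl⟩
  have hρ0 : 0 < ρ := by rw [hρ]; exact norm_pos_iff.2 ht0
  have hbd : M * ‖t‖ ^ γ + L * ‖xb - x₀‖ ^ 2 < 2 * K := by
    have h1 := (abs_le.1 (hU xb hxb1)).2
    have h2 := (abs_le.1 (hU yb hyb1)).1
    linarith
  have hp1 : 0 ≤ M * ‖t‖ ^ γ := by positivity
  have hp2 : 0 ≤ L * ‖xb - x₀‖ ^ 2 := by positivity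
  have hρd : ρ < d := by
    have h1 : M₀ * ‖t‖ ^ γ < 2 := by
      have : (M₀ * ‖t‖ ^ γ) * K < 2 * K := by rw [hM] at hbd hp1; linarith
      exact lt_of_mul_lt_mul_right this hK.le
    have h2 : ‖t‖ ^ γ < d ^ γ := lt_of_mul_lt_mul_left (h1.trans_le hMd) hM₀0.le
    rw [← hρ] at h2
    exact (Real.rpow_lt_rpow_iff hρ0.le hd0.le hγ0).1 h2
  have hxd : ‖xb - x₀‖ < d := by
    have h1 : L₀ * ‖xb - x₀‖ ^ 2 < 2 := by
      have : (L₀ * ‖xb - x₀‖ ^ 2) * K < 2 * K := by rw [hL] at hbd hp2; linarith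
      exact lt_of_mul_lt_mul_right this hK.le
    have h2 : L₀ * d ^ 2 = 2 := by rw [hL₀]; field_simp
    have h3 : ‖xb - x₀‖ ^ 2 < d ^ 2 := by
      refine lt_of_mul_lt_mul_left ?_ hL₀0.le
      linarith
    exact lt_of_pow_lt_pow_left₀ 2 hd0.le h3
  have hxbn : ‖xb‖ < r + d := by
    have : ‖xb‖ ≤ ‖x₀‖ + ‖xb - x₀‖ := by
      have := norm_add_le x₀ (xb - x₀)
      rwa [add_sub_cancel] at this
    linarith
  have hybn : ‖yb‖ < r + 2 * d := by
    have : ‖yb‖ ≤ ‖xb‖ + ‖t‖ := by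
      have := norm_sub_le xb t
      rw [ht] at this ⊢
      rwa [sub_sub_cancel] at this
    linarith
  obtain ⟨B, hB⟩ : ∃ B, B = M * γ * ‖t‖ ^ (γ - 2) := ⟨_, rfl⟩
  have hρ1 : ρ ≤ 1 := by linarith
  have hBM : M * γ ≤ B := by
    have : 1 ≤ ‖t‖ ^ (γ - 2) := by
      rw [← hρ]
      exact Real.one_le_rpow_of_pos_of_le_one_of_nonpos hρ0 hρ1 (by linarith)
    rw [hB]
    exact le_mul_of_one_le_right (by positivity) this
  have hMγ : 0 < M * γ := by positivity
  have hB0 : 0 < B := by linarith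
  obtain ⟨Q, hQ⟩ : ∃ Q, Q = B * ρ := ⟨_, rfl⟩
  have hQM : M * γ ≤ Q := by
    have h1 : 1 ≤ ‖t‖ ^ (γ - 1) := by
      rw [← hρ]
      exact Real.one_le_rpow_of_pos_of_le_one_of_nonpos hρ0 hρ1 (by linarith)
    have h2 : Q = M * γ * ‖t‖ ^ (γ - 1) := by
      rw [hQ, hB, ← hρ, mul_assoc, mul_assoc, mul_assoc]
      congr 2
      conv_lhs => rw [← Real.rpow_one ρ, ← Real.rpow_mul hρ0.le, ← Real.rpow_add hρ0]
      congr 1; ring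
    rw [h2]
    exact le_mul_of_one_le_right (by positivity) h1
  have hQ0 : 0 < Q := by linarith
  obtain ⟨n, hn⟩ : ∃ n, n = ‖t‖⁻¹ • t := ⟨_, rfl⟩
  have hn1 : ‖n‖ = 1 := by
    rw [hn, norm_smul, norm_inv, norm_norm, ← hρ]; field_simp
  have hl : B • t = Q • n := by
    rw [hn, hQ, smul_smul, ← hρ]; congr 1; field_simp
  have hpt := pow_taylor (M := M) (γ := γ) hM0.le (half_pos hL0) ht0
  rw [← hB, ← hn] at hpt
  obtain ⟨ε, hε, hptb⟩ := Metric.eventually_nhds_iff_ball.1 hpt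
  obtain ⟨ρ₁, hρ₁⟩ : ∃ ρ₁, ρ₁ = min (ε / 4) d := ⟨_, rfl⟩
  have hρ₁0 : 0 < ρ₁ := by rw [hρ₁]; positivity
  have hρ₁e : ρ₁ ≤ ε / 4 := by rw [hρ₁]; exact min_le_left _ _
  have hρ₁d : ρ₁ ≤ d := by rw [hρ₁]; exact min_le_right _ _
  obtain ⟨v, hv⟩ : ∃ v, v = B • t + (2 * L) • (xb - x₀) := ⟨_, rfl⟩
  let g₁ : EuclideanSpace ℝ (Fin N) → ℝ := fun x => u (xb + x) - u xb - inner ℝ v x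
  let g₂ : EuclideanSpace ℝ (Fin N) → ℝ := fun y => - u (yb + y) + u yb + inner ℝ (B • t) y
  have hmx : ∀ x ∈ closedBall (0 : EuclideanSpace ℝ (Fin N)) ρ₁,
      xb + x ∈ closedBall (0 : EuclideanSpace ℝ (Fin N)) (r + 4 * d) := by
    intro x hx
    rw [mem_closedBall_zero_iff] at hx ⊢
    have := norm_add_le xb x
    linarith
  have hmy : ∀ x ∈ closedBall (0 : EuclideanSpace ℝ (Fin N)) ρ₁,
      yb + x ∈ closedBall (0 : EuclideanSpace ℝ (Fin N)) (r + 4 * d) := by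
    intro x hx
    rw [mem_closedBall_zero_iff] at hx ⊢
    have := norm_add_le yb x
    linarith
  have hg₁ : ContinuousOn g₁ (closedBall 0 ρ₁) := by
    have a1 : ContinuousOn (fun x => u (xb + x)) (closedBall 0 ρ₁) :=
      huc.comp (by fun_prop : Continuous fun x => xb + x).continuousOn hmx
    have a2 : Continuous fun x : EuclideanSpace ℝ (Fin N) => (inner ℝ v x : ℝ) := by fun_prop
    exact (a1.sub continuousOn_const).sub a2.continuousOn
  have hg₂ : ContinuousOn g₂ (closedBall 0 ρ₁) := by
    have a1 : ContinuousOn (fun x => u (yb + x)) (closedBall 0 ρ₁) :=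
      huc.comp (by fun_prop : Continuous fun x => yb + x).continuousOn hmy
    have a2 : Continuous fun x : EuclideanSpace ℝ (Fin N) => (inner ℝ (B • t) x : ℝ) := by
      fun_prop
    exact (a1.neg.add continuousOn_const).add a2.continuousOn
  have hθ0 : 0 ≤ B * (2 - γ) := mul_nonneg hB0.le (by linarith)
  obtain ⟨η, hη⟩ : ∃ η, η = min (L * d) d := ⟨_, rfl⟩
  have hη0 : 0 < η := by rw [hη]; positivity
  have hηL : η ≤ L * d := by rw [hη]; exact min_le_left _ _
  have hηd : η ≤ d := by rw [hη]; exact min_le_right _ _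
  have hLd : L * d ≤ L := mul_le_of_le_one_right hL0.le hd1
  have hS : ∀ x ∈ closedBall (0 : EuclideanSpace ℝ (Fin N)) ρ₁,
      ∀ y ∈ closedBall (0 : EuclideanSpace ℝ (Fin N)) ρ₁,
      g₁ x + g₂ y ≤ 1 / 2 * qS B (B * (2 - γ)) (4 * L) n x y := by
    intro x hx y hy
    have h1 := hmax' _ (hmx x hx) _ (hmy y hy)
    rw [mem_closedBall_zero_iff] at hx hy
    have h2 := hptb (x - y) (by
      rw [mem_ball_zero_iff]
      have := norm_sub_le x y
      linarith)
    have h3 : xb + x - (yb + y) = t + (x - y) := by rw [ht]; abel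
    have h4 : xb + x - x₀ = (xb - x₀) + x := by abel
    rw [h3, h4, norm_add_sq_real, ← ht] at h1
    have h5 : ‖x - y‖ ^ 2 ≤ 2 * (‖x‖ ^ 2 + ‖y‖ ^ 2) := by
      have := pow_le_pow_left₀ (norm_nonneg _) (norm_sub_le x y) 2
      nlinarith [sq_nonneg (‖x‖ - ‖y‖)]
    have h6 := mul_le_mul_of_nonneg_left h5 hL0.le
    have h7 : 0 ≤ L * ‖y‖ ^ 2 := by positivity
    simp only [g₁, g₂, qS, hv, inner_add_left, real_inner_smul_left, inner_sub_right] at h1 h2 ⊢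
    linarith
  obtain ⟨z₁, z₂, q₁, q₂, X₁, X₂, hz₁, hz₂, hq₁, hq₂, ht₁, ht₂, hXX⟩ :=
    core_sums hρ₁0 hg₁ hg₂ (by simp [g₁]) (by simp [g₂]) hB0.le hθ0
      (show 0 ≤ 4 * L by positivity) hη0 hn1.le hS
  have hx₁ : xb + z₁ ∈ ball (0 : EuclideanSpace ℝ (Fin N)) 1 := by
    rw [mem_ball_zero_iff]
    have := norm_add_le xb z₁
    linarith
  have hy₁ : yb + z₂ ∈ ball (0 : EuclideanSpace ℝ (Fin N)) 1 := by
    rw [mem_ball_zero_iff]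
    have := norm_add_le yb z₂
    linarith
  have T1 := sub_test hsub hx₁ (P := v + q₁) (X := X₁) (by
    filter_upwards [ht₁] with k hk
    simp only [g₁, inner_add_right, inner_add_left, ← add_assoc] at hk ⊢
    linarith)
  have T2 := super_test hsup hy₁ (P := B • t - q₂) (X := X₂) (by
    filter_upwards [ht₂] with k hk
    simp only [g₂, inner_add_right, inner_sub_left, ← add_assoc] at hk ⊢
    linarith)
  have f1 := (abs_le.1 (hFb _ hx₁)).1
  have f2 := (abs_le.1 (hFb _ hy₁)).2
  have hcoord : ∀ (w : EuclideanSpace ℝ (Fin N)) k, |w k| ≤ ‖w‖ := fun w k =>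
    PiLp.norm_apply_le w k
  have hμQ : 3 * (L * d) ≤ μ * Q := by
    have h1 : 3 * L ≤ μ * (M * γ) := by
      have := mul_le_mul_of_nonneg_right hMμ hK.le
      rw [hL, hM]; linarith
    have h2 := mul_le_mul_of_nonneg_left hQM hμ.le
    linarith
  have T3 := halg Q B (4 * L + 2 * η) n (v + q₁) (B • t - q₂) X₁ X₂ hQ0 hB0 (by positivity)
    (by
      have h1 : 6 * L ≤ lam * (M * γ) := by
        have := mul_le_mul_of_nonneg_right hMl hK.le
        rw [hL, hM]; linarith
      have h2 := mul_le_mul_of_nonneg_left hBM hlam.le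
      linarith) hn1
    (by
      intro k
      have e1 : (v + q₁) k - Q * n k = ((2 * L) • (xb - x₀) + q₁) k := by
        rw [hv, hl]
        simp only [PiLp.add_apply, PiLp.smul_apply, smul_eq_mul]
        ring
      rw [e1]
      refine (hcoord _ _).trans ((norm_add_le _ _).trans ?_)
      rw [norm_smul, Real.norm_eq_abs, abs_of_pos (by positivity)]
      have := mul_le_mul_of_nonneg_left hxd.le (show 0 ≤ 2 * L by positivity)
      linarith)
    (by
      intro k
      have e1 : (B • t - q₂) k - Q * n k = (-q₂) k := by
        rw [hl]
        simp only [PiLp.sub_apply, PiLp.smul_apply, smul_eq_mul, PiLp.neg_apply]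
        ring
      rw [e1]
      refine (hcoord _ _).trans ?_
      rw [norm_neg]
      have : 0 < L * d := by positivity
      linarith)
    hXX
  have T4 : c * B * Q ^ (p - 2) ≤ 2 * F := by linarith
  have T5 : c * (M * γ) ^ (p - 1) ≤ c * B * Q ^ (p - 2) := by
    have e1 : (M * γ) ^ (p - 1) = (M * γ) * (M * γ) ^ (p - 2) := by
      have : p - 1 = 1 + (p - 2) := by ring
      rw [this, Real.rpow_add hMγ, Real.rpow_one]
    rw [e1, mul_assoc c B]
    refine mul_le_mul_of_nonneg_left ?_ hc.le
    exact mul_le_mul hBM (Real.rpow_le_rpow hMγ.le hQM (by linarith)) (by positivity) hB0.le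
  have T6 : (M₀ * γ) * K ^ (p - 1) ≤ (M * γ) ^ (p - 1) := by
    have e1 : M * γ = (M₀ * γ) * K := by rw [hM]; ring
    rw [e1, Real.mul_rpow (by positivity) hK.le]
    refine mul_le_mul_of_nonneg_right ?_ (by positivity)
    have := Real.rpow_le_rpow_of_exponent_le hM1 (show (1:ℝ) ≤ p - 1 by linarith)
    rwa [Real.rpow_one] at this
  have T7 := mul_le_mul_of_nonneg_left T6 hc.le
  have hKp : 0 < K ^ (p - 1) := by positivity
  have T8 := mul_le_mul_of_nonneg_right hMc hKp.le
  linarith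

/-- **Interior Hölder regularity (viscosity case).**
For `p > 2`, `r < 1` and `γ ∈ (0,1)` there is a constant `C = C(p, γ, N, r)` such that every
bounded viscosity solution `u` of `Σᵢ |∂ᵢu|^(p-2) ∂ᵢᵢu = f` in `B₁`, with `f` continuous on the
closed unit ball, satisfies `|u x - u y| ≤ C (‖u‖_∞ + ‖f‖_∞^(1/(p-1))) ‖x - y‖ ^ γ`
for `x, y ∈ B_r`. -/
theorem holder_regularity_viscosity (N : ℕ) (hN : 1 ≤ N) (p : ℝ) (hp : 2 < p)
    (r : ℝ) (hr : r < 1) (γ : ℝ) (hγ : γ ∈ Ioo (0 : ℝ) 1) :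
    ∃ C : ℝ, ∀ f u : EuclideanSpace ℝ (Fin N) → ℝ,
      ContinuousOn f (closedBall 0 1) →
      ContinuousOn u (ball 0 1) →
      (∃ B : ℝ, ∀ x ∈ ball (0 : EuclideanSpace ℝ (Fin N)) 1, |u x| ≤ B) →
      IsViscSubsol p (ball 0 1) u f →
      IsViscSupersol p (ball 0 1) u f →
      ∀ x ∈ ball (0 : EuclideanSpace ℝ (Fin N)) r,
        ∀ y ∈ ball (0 : EuclideanSpace ℝ (Fin N)) r,
          |u x - u y| ≤
            C * (sSup ((fun z => |u z|) '' ball 0 1) +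
                (sSup ((fun z => |f z|) '' ball 0 1)) ^ (1 / (p - 1))) * ‖x - y‖ ^ γ := by
  rcases le_or_gt r 0 with hr0 | hr0
  · refine ⟨0, fun f u _ _ _ _ _ x hx => ?_⟩
    rw [ball_eq_empty.2 hr0] at hx
    exact absurd hx (notMem_empty x)
  obtain ⟨M₀, hM₀⟩ := one_sided N hN p hp r hr0 hr γ hγ
  refine ⟨M₀, ?_⟩
  intro f u hf hu hB hsub hsup x hx y hy
  obtain ⟨U, hUdef⟩ : ∃ U, U = sSup ((fun z => |u z|) '' ball 0 1) := ⟨_, rfl⟩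
  obtain ⟨F, hFdef⟩ : ∃ F, F = sSup ((fun z => |f z|) '' ball 0 1) := ⟨_, rfl⟩
  rw [← hUdef, ← hFdef]
  have hU : ∀ z ∈ ball (0 : EuclideanSpace ℝ (Fin N)) 1, |u z| ≤ U := by
    intro z hz
    rw [hUdef]
    obtain ⟨B, hB⟩ := hB
    refine le_csSup ⟨B, ?_⟩ (mem_image_of_mem _ hz)
    rintro _ ⟨w, hw, rfl⟩
    exact hB w hw
  have hF : ∀ z ∈ ball (0 : EuclideanSpace ℝ (Fin N)) 1, |f z| ≤ F := by
    intro z hz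
    rw [hFdef]
    have h1 : BddAbove ((fun z => |f z|) '' closedBall (0 : EuclideanSpace ℝ (Fin N)) 1) :=
      ((isCompact_closedBall _ _).image_of_continuousOn hf.abs).bddAbove
    exact le_csSup (h1.mono (image_mono ball_subset_closedBall)) (mem_image_of_mem _ hz)
  have hF0 : 0 ≤ F := (abs_nonneg _).trans (hF 0 (by simp))
  have hU0 : 0 ≤ U := (abs_nonneg _).trans (hU 0 (by simp))
  have hFp : 0 ≤ F ^ (1 / (p - 1)) := by positivity
  have hsub1 : ball (0 : EuclideanSpace ℝ (Fin N)) r ⊆ ball 0 1 := ball_subset_ball hr.le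
  rcases (add_nonneg hU0 hFp).eq_or_lt with hK | hK
  · have hUz : U ≤ 0 := by linarith
    have hz : ∀ z ∈ ball (0 : EuclideanSpace ℝ (Fin N)) 1, u z = 0 := fun z hz =>
      abs_nonpos_iff.1 ((hU z hz).trans hUz)
    rw [← hK, hz x (hsub1 hx), hz y (hsub1 hy)]
    simp
  · have h1 := hM₀ f u U F _ hF0 hK rfl hU hF hu hsub hsup x hx y hy
    have h2 := hM₀ f u U F _ hF0 hK rfl hU hF hu hsub hsup y hy x hx
    rw [norm_sub_rev] at h2
    rw [abs_le]
    constructor <;> linarith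
end

section
/- Let u : ℝᴺ → ℝ be upper semicontinuous, v : ℝᴺ → ℝ lower semicontinuous, M > 1 a constant, x₀ ∈ ℝᴺ, and Φ a function that is C² in a neighborhood of (x̄, ȳ) ∈ ℝᴺ × ℝᴺ. Suppose that for all (x, y) ∈ ℝᴺ × ℝᴺ: u(x) − v(y) − M|x − x₀|² − M|y − x₀|² − Φ(x, y) ≤ u(x̄) − v(ȳ) − M|x̄ − x₀|² − M|ȳ − x₀|² − Φ(x̄, ȳ). Then for every ι > 0 there exist symmetric N×N matrices X_ι, Y_ι such that (D₁Φ(x̄, ȳ) + 2M(x̄ − x₀), X_ι) ∈ J̄^{2,+}u(x̄), (−D₂Φ(x̄, ȳ) − 2M(ȳ − x₀), −Y_ι) ∈ J̄^{2,−}v(ȳ), and, with A = D²Φ(x̄, ȳ) (the full Hessian of Φ as a 2N×2N matrix): −(1/ι + |A| + 1) I_{2N} ≤ diag(X_ι − 2M·Id, Y_ι − 2M·Id) ≤ A + ι A² + I_{2N}. -/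
open Metric MeasureTheory Topology Filter Set

/-- `(q, X) ∈ J^{2,+} u (xb)`: the second-order super-jet, i.e.
`u x ≤ u xb + ⟨q, x - xb⟩ + ½ ᵗ(x-xb) X (x-xb) + o(|x-xb|²)` as `x → xb`. -/
def InSuperjet {N : ℕ} (u : EuclideanSpace ℝ (Fin N) → ℝ)
    (xb q : EuclideanSpace ℝ (Fin N)) (X : Matrix (Fin N) (Fin N) ℝ) : Prop :=
  ∀ ε > 0, ∀ᶠ x in 𝓝 xb,
    u x ≤ u xb + (∑ i, q i * (x i - xb i)) +
      (1/2) * (∑ i, ∑ j, (x i - xb i) * X i j * (x j - xb j)) + ε * ‖x - xb‖ ^ 2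

/-- `(q, X) ∈ J^{2,-} u (xb)`: the second-order sub-jet. -/
def InSubjet {N : ℕ} (u : EuclideanSpace ℝ (Fin N) → ℝ)
    (xb q : EuclideanSpace ℝ (Fin N)) (X : Matrix (Fin N) (Fin N) ℝ) : Prop :=
  ∀ ε > 0, ∀ᶠ x in 𝓝 xb,
    u xb + (∑ i, q i * (x i - xb i)) +
      (1/2) * (∑ i, ∑ j, (x i - xb i) * X i j * (x j - xb j)) - ε * ‖x - xb‖ ^ 2 ≤ u x

/-- `(q, X) ∈ J̄^{2,+} u (xb)`: the closed super-jet, obtained as limits of super-jets. -/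
def InClosedSuperjet {N : ℕ} (u : EuclideanSpace ℝ (Fin N) → ℝ)
    (xb q : EuclideanSpace ℝ (Fin N)) (X : Matrix (Fin N) (Fin N) ℝ) : Prop :=
  ∃ (xs qs : ℕ → EuclideanSpace ℝ (Fin N)) (Xs : ℕ → Matrix (Fin N) (Fin N) ℝ),
    (∀ n, InSuperjet u (xs n) (qs n) (Xs n)) ∧
    Tendsto xs atTop (𝓝 xb) ∧ Tendsto qs atTop (𝓝 q) ∧ Tendsto Xs atTop (𝓝 X)

/-- `(q, X) ∈ J̄^{2,-} u (xb)`: the closed sub-jet. -/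
def InClosedSubjet {N : ℕ} (u : EuclideanSpace ℝ (Fin N) → ℝ)
    (xb q : EuclideanSpace ℝ (Fin N)) (X : Matrix (Fin N) (Fin N) ℝ) : Prop :=
  ∃ (xs qs : ℕ → EuclideanSpace ℝ (Fin N)) (Xs : ℕ → Matrix (Fin N) (Fin N) ℝ),
    (∀ n, InSubjet u (xs n) (qs n) (Xs n)) ∧
    Tendsto xs atTop (𝓝 xb) ∧ Tendsto qs atTop (𝓝 q) ∧ Tendsto Xs atTop (𝓝 X)

/-- The norm `|A| = sup_{|v|=1} |ᵗv A v|` of a (symmetric) matrix, the supremum being over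
unit vectors for the Euclidean norm. -/
noncomputable def symNorm {n : Type*} [Fintype n] (A : Matrix n n ℝ) : ℝ :=
  sSup {r : ℝ | ∃ v : EuclideanSpace ℝ n, ‖v‖ = 1 ∧ r = |∑ i, ∑ j, v i * A i j * v j|}

/-- The canonical basis directions of `ℝᴺ × ℝᴺ`, indexed by `Fin N ⊕ Fin N`. -/
noncomputable def prodDir {N : ℕ} :
    Fin N ⊕ Fin N → EuclideanSpace ℝ (Fin N) × EuclideanSpace ℝ (Fin N) :=
  Sum.elim (fun i => (EuclideanSpace.single i 1, 0)) (fun i => (0, EuclideanSpace.single i 1))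

/-- The full Hessian of `Φ : ℝᴺ × ℝᴺ → ℝ` at a point, as a `2N × 2N` matrix. -/
noncomputable def hessProd {N : ℕ}
    (Φ : EuclideanSpace ℝ (Fin N) × EuclideanSpace ℝ (Fin N) → ℝ)
    (z : EuclideanSpace ℝ (Fin N) × EuclideanSpace ℝ (Fin N)) :
    Matrix (Fin N ⊕ Fin N) (Fin N ⊕ Fin N) ℝ :=
  Matrix.of fun i j => iteratedFDeriv ℝ 2 Φ z ![prodDir i, prodDir j]

set_option linter.unusedSectionVars false


section core
variable {E : Type*} [NormedAddCommGroup E] [InnerProductSpace ℝ E] [FiniteDimensional ℝ E]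

lemma sup_pkg (a : E → ℝ) (ha : UpperSemicontinuous a) (r lam : ℝ) (hr : 0 < r) :
    ∃ (f : E → ℝ) (Ξ : E → E), (∀ y, ‖Ξ y‖ ≤ r) ∧
      (∀ y ξ, ‖ξ‖ ≤ r → a ξ - lam / 2 * ‖ξ‖ ^ 2 + lam * inner ℝ y ξ ≤ f y) ∧
      (∀ y, f y = a (Ξ y) - lam / 2 * ‖Ξ y‖ ^ 2 + lam * inner ℝ y (Ξ y)) := by
  have key : ∀ y : E, ∃ ξ : E, ‖ξ‖ ≤ r ∧ ∀ ξ', ‖ξ'‖ ≤ r →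
      a ξ' - lam / 2 * ‖ξ'‖ ^ 2 + lam * inner ℝ y ξ' ≤
        a ξ - lam / 2 * ‖ξ‖ ^ 2 + lam * inner ℝ y ξ := by
    intro y
    have hc : Continuous (fun ξ : E => - (lam / 2 * ‖ξ‖ ^ 2) + lam * inner ℝ y ξ) := by fun_prop
    have husc : UpperSemicontinuous
        (fun ξ : E => a ξ + (- (lam / 2 * ‖ξ‖ ^ 2) + lam * inner ℝ y ξ)) :=
      ha.add hc.upperSemicontinuous
    obtain ⟨ξ, hξ, hm⟩ := UpperSemicontinuousOn.exists_isMaxOn (s := closedBall (0:E) r)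
      ⟨0, by simp [hr.le]⟩ (isCompact_closedBall 0 r) (husc.upperSemicontinuousOn _)
    refine ⟨ξ, by simpa using hξ, fun ξ' h' => ?_⟩
    have := hm (show ξ' ∈ closedBall (0:E) r by simpa using h')
    simp only [mem_ofPred_eq] at this
    linarith
  choose Ξ h1 h2 using key
  exact ⟨fun y => a (Ξ y) - lam / 2 * ‖Ξ y‖ ^ 2 + lam * inner ℝ y (Ξ y), Ξ, h1,
    fun y ξ h => h2 y ξ h, fun y => rfl⟩

lemma env_pkg (f : E → ℝ) (g : E → E) (hf0 : ∀ y, 0 ≤ f y) (hfc : Continuous f)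
    (hsub : ∀ y y', f y + inner ℝ (g y) (y' - y) ≤ f y') (m : ℝ) (hm : 0 < m) :
    ∃ (e : E → ℝ) (P J : E → E),
      (∀ z, P z = m • (z - J z)) ∧ (∀ z, e z = f (J z) + m / 2 * ‖z - J z‖ ^ 2) ∧
      (∀ z z', e z + inner ℝ (P z) (z' - z) ≤ e z') ∧
      (∀ z y, e z ≤ f y + m / 2 * ‖z - y‖ ^ 2) ∧
      (∀ y, f y ≤ e (y + m⁻¹ • g y) - m / 2 * ‖m⁻¹ • g y‖ ^ 2) ∧
      (∀ z y', f (J z) + inner ℝ (P z) (y' - J z) ≤ f y') := by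
  have hmin : ∀ z : E, ∃ y : E, ∀ y', f y + m / 2 * ‖z - y‖ ^ 2 ≤ f y' + m / 2 * ‖z - y'‖ ^ 2 := by
    intro z
    have hc : Continuous (fun y => f y + m / 2 * ‖z - y‖ ^ 2) := by fun_prop
    apply hc.exists_forall_le
    have h1 : Tendsto (fun y : E => ‖z - y‖) (cocompact E) atTop := by
      have := tendsto_dist_left_cocompact_atTop z
      exact this.congr (fun y => dist_eq_norm z y)
    have h2 : Tendsto (fun y : E => m / 2 * ‖z - y‖ ^ 2) (cocompact E) atTop :=
      ((tendsto_pow_atTop two_ne_zero).comp h1).const_mul_atTop (by positivity)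
    exact tendsto_atTop_mono (fun y => by linarith [hf0 y]) h2
  choose J hJ using hmin
  have hJsub : ∀ z y', f (J z) + inner ℝ (m • (z - J z)) (y' - J z) ≤ f y' := by
    intro z y'
    set d := y' - J z with hd
    have hconv : ∀ t : ℝ, 0 < t → t ≤ 1 → f (J z + t • d) ≤ (1 - t) * f (J z) + t * f y' := by
      intro t ht ht1
      have a1 := hsub (J z + t • d) (J z)
      have a2 := hsub (J z + t • d) y'
      have e1 : J z - (J z + t • d) = (-t) • d := by simp
      have e2 : y' - (J z + t • d) = (1 - t) • d := by
        rw [hd]; module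
      rw [e1, inner_smul_right] at a1
      rw [e2, inner_smul_right] at a2
      nlinarith [mul_le_mul_of_nonneg_left a1 (sub_nonneg.2 ht1),
        mul_le_mul_of_nonneg_left a2 ht.le]
    have hstep : ∀ t : ℝ, 0 < t → t ≤ 1 →
        f (J z) + inner ℝ (m • (z - J z)) d ≤ f y' + t * (m / 2 * ‖d‖ ^ 2) := by
      intro t ht ht1
      have b1 := hJ z (J z + t • d)
      have b2 := hconv t ht ht1
      have e3 : z - (J z + t • d) = (z - J z) - t • d := by abel
      rw [e3, norm_sub_sq_real (z - J z), inner_smul_right, norm_smul] at b1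
      rw [inner_smul_left]
      simp only [Real.norm_eq_abs, mul_pow, sq_abs, conj_trivial] at *
      have : t * (f (J z) + m * inner ℝ (z - J z) d) ≤ t * (f y' + t * (m / 2 * ‖d‖ ^ 2)) := by
        nlinarith
      exact le_of_mul_le_mul_left this ht
    have hlim : Tendsto (fun t : ℝ => f y' + t * (m / 2 * ‖d‖ ^ 2)) (𝓝[>] 0) (𝓝 (f y')) := by
      have : Tendsto (fun t : ℝ => f y' + t * (m / 2 * ‖d‖ ^ 2)) (𝓝 0)
          (𝓝 (f y' + 0 * (m / 2 * ‖d‖ ^ 2))) := by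
        apply Continuous.tendsto; fun_prop
      simpa using this.mono_left nhdsWithin_le_nhds
    refine ge_of_tendsto hlim ?_
    filter_upwards [Ioc_mem_nhdsGT (zero_lt_one' ℝ)] with t ht
    exact hstep t ht.1 ht.2
  refine ⟨fun z => f (J z) + m / 2 * ‖z - J z‖ ^ 2, fun z => m • (z - J z), J, fun _ => rfl,
    fun _ => rfl, ?_, fun z y => hJ z y, ?_, hJsub⟩
  · intro z z'
    have h := hJsub z (J z')
    simp only
    set a := z - J z with ha
    set b := z' - J z' with hb
    have e1 : J z' - J z = (z' - z) + a - b := by rw [ha, hb]; abel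
    rw [e1] at h
    simp only [inner_smul_left, inner_add_right, inner_sub_right, real_inner_self_eq_norm_sq,
      conj_trivial] at h ⊢
    have := norm_sub_sq_real a b
    nlinarith [sq_nonneg ‖a - b‖, mul_nonneg hm.le (sq_nonneg ‖a - b‖)]
  · intro y
    simp only
    set z := y + m⁻¹ • g y with hz
    have h := hsub y (J z)
    set b := z - J z with hb
    have e1 : J z - y = m⁻¹ • g y - b := by rw [hb, hz]; abel
    rw [e1, inner_sub_right] at h
    have e2 : g y = m • (m⁻¹ • g y) := by rw [smul_smul, mul_inv_cancel₀ hm.ne', one_smul]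
    set c := m⁻¹ • g y with hc
    rw [e2] at h
    simp only [inner_smul_left, real_inner_self_eq_norm_sq, conj_trivial] at h
    have := norm_sub_sq_real c b
    nlinarith [mul_nonneg hm.le (sq_nonneg ‖c - b‖)]

lemma c11_pkg (e : E → ℝ) (P : E → E) (m : ℝ) (hm : 0 < m)
    (lo : ∀ z z', e z + inner ℝ (P z) (z' - z) ≤ e z')
    (hi : ∀ z z', e z' ≤ e z + inner ℝ (P z) (z' - z) + m / 2 * ‖z' - z‖ ^ 2) :
    (∀ z z', ‖P z - P z'‖ ≤ m * ‖z - z'‖) ∧ (∀ z, HasFDerivAt e (innerSL ℝ (P z)) z) := by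
  constructor
  · intro z z'
    have h1 := hi z' (z' + m⁻¹ • (P z - P z'))
    have h2 := lo z (z' + m⁻¹ • (P z - P z'))
    have h3 := hi z z'
    set d := P z - P z' with hd
    have e1 : z' + m⁻¹ • d - z' = m⁻¹ • d := by abel
    have e2 : z' + m⁻¹ • d - z = (z' - z) + m⁻¹ • d := by abel
    rw [e1, norm_smul] at h1
    rw [e2, inner_add_right] at h2
    have h4 : inner ℝ (P z) (m⁻¹ • d) - inner ℝ (P z') (m⁻¹ • d) = m⁻¹ * ‖d‖ ^ 2 := by
      rw [← inner_sub_left, ← hd, inner_smul_right, real_inner_self_eq_norm_sq]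
    have h5 : m / 2 * (‖m⁻¹‖ * ‖d‖) ^ 2 = m⁻¹ / 2 * ‖d‖ ^ 2 := by
      rw [Real.norm_of_nonneg (by positivity)]; field_simp
    rw [h5] at h1
    rw [norm_sub_rev z z']
    have h6 : m⁻¹ * ‖d‖ ^ 2 ≤ m * ‖z' - z‖ ^ 2 := by linarith
    have h7 : ‖d‖ ^ 2 ≤ (m * ‖z' - z‖) ^ 2 := by
      have := mul_le_mul_of_nonneg_left h6 hm.le
      rw [← mul_assoc, mul_inv_cancel₀ hm.ne', one_mul] at this
      linarith [this, mul_pow m ‖z' - z‖ 2, sq m]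
    exact abs_le_of_sq_le_sq' h7 (by positivity) |>.2
  · intro z
    rw [hasFDerivAt_iff_isLittleO_nhds_zero]
    refine Asymptotics.IsBigO.trans_isLittleO (g := fun h : E => ‖h‖ ^ 2) ?_ ?_
    · refine Asymptotics.IsBigO.of_bound (m / 2) (Eventually.of_forall fun h => ?_)
      have h1 := hi z (z + h)
      have h2 := lo z (z + h)
      simp only [add_sub_cancel_left] at h1 h2
      rw [Real.norm_eq_abs, Real.norm_of_nonneg (by positivity), abs_le]
      simp only [innerSL_apply_apply]
      constructor <;> nlinarith [sq_nonneg ‖h‖]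
    · have := (Asymptotics.isLittleO_norm_pow_id (E' := E) one_lt_two)
      simpa using this

end core

lemma taylor2_s5 {V : Type*} [NormedAddCommGroup V] [NormedSpace ℝ V] {f : V → ℝ}
    {f' : V → V →L[ℝ] ℝ} {f'' : V →L[ℝ] V →L[ℝ] ℝ} {x : V}
    (hf : ∀ᶠ y in 𝓝 x, HasFDerivAt f (f' y) y) (hf' : HasFDerivAt f' f'' x) (ε : ℝ) (hε : 0 < ε) :
    ∀ᶠ h in 𝓝 (0 : V), |f (x + h) - f x - f' x h - (1 / 2) * f'' h h| ≤ ε * ‖h‖ ^ 2 := by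
  have hsymm := second_derivative_symmetric_of_eventually hf hf'
  have h1 := (hasFDerivAt_iff_isLittleO_nhds_zero.1 hf').def hε
  have h2 : ∀ᶠ h in 𝓝 (0 : V), HasFDerivAt f (f' (x + h)) (x + h) := by
    have : Tendsto (fun h : V => x + h) (𝓝 0) (𝓝 x) := by
      have : Tendsto (fun h : V => x + h) (𝓝 0) (𝓝 (x + 0)) := by
        apply Continuous.tendsto; fun_prop
      simpa using this
    exact this.eventually hf
  obtain ⟨r, hr, hb⟩ := Metric.eventually_nhds_iff_ball.1 (h1.and h2)
  filter_upwards [ball_mem_nhds (0 : V) hr] with h hh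
  have hh' : ‖h‖ < r := by simpa using hh
  have hsub : ∀ k ∈ closedBall (0 : V) ‖h‖, k ∈ ball (0 : V) r := fun k hk => by
    simp at hk ⊢; linarith
  have := Convex.norm_image_sub_le_of_norm_hasFDerivWithin_le (𝕜 := ℝ)
    (f := fun k => f (x + k) - f x - f' x k - (1 / 2) * f'' k k)
    (f' := fun k => f' (x + k) - f' x - f'' k) (s := closedBall (0 : V) ‖h‖)
    (C := ε * ‖h‖) (x := 0) (y := h) ?_ ?_ (convex_closedBall _ _) (by simp) (by simp)
  · simp only [add_zero, sub_self, map_zero, mul_zero, sub_zero, Real.norm_eq_abs] at this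
    calc _ ≤ _ := this
      _ = _ := by ring
  · intro k hk
    apply HasFDerivAt.hasFDerivWithinAt
    have d1 : HasFDerivAt (fun k => f (x + k)) (f' (x + k)) k := by
      have := (hb k (hsub k hk)).2
      exact (hasFDerivAt_comp_add_left x).2 this
    have d2 : HasFDerivAt (fun k => f' x k) (f' x) k := (f' x).hasFDerivAt
    have d3 : HasFDerivAt (fun k => (1 / 2 : ℝ) * f'' k k) (f'' k) k := by
      have := (f''.hasFDerivAt (x := k)).clm_apply (hasFDerivAt_id k)
      have := this.const_mul (1 / 2 : ℝ)
      refine this.congr_fderiv ?_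
      ext v
      simp [hsymm v k]
      ring
    exact ((d1.sub_const _).sub d2).sub d3
  · intro k hk
    have := (hb k (hsub k hk)).1
    refine this.trans ?_
    gcongr
    simpa using hk

lemma lin_zero {V : Type*} [NormedAddCommGroup V] [NormedSpace ℝ V] (l : V →L[ℝ] ℝ) (C : ℝ)
    (h : ∀ᶠ x in 𝓝 (0 : V), l x ≤ C * ‖x‖ ^ 2) : l = 0 := by
  have key : ∀ v, l v ≤ 0 := by
    intro v
    have h1 : Tendsto (fun t : ℝ => t • v) (𝓝[>] 0) (𝓝 0) := by
      have : Tendsto (fun t : ℝ => t • v) (𝓝 0) (𝓝 ((0:ℝ) • v)) := by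
        apply Continuous.tendsto; fun_prop
      simpa using this.mono_left nhdsWithin_le_nhds
    have h2 : Tendsto (fun t : ℝ => t * (C * ‖v‖ ^ 2)) (𝓝[>] 0) (𝓝 0) := by
      have : Tendsto (fun t : ℝ => t * (C * ‖v‖ ^ 2)) (𝓝 0) (𝓝 ((0:ℝ) * (C * ‖v‖ ^ 2))) := by
        apply Continuous.tendsto; fun_prop
      simpa using this.mono_left nhdsWithin_le_nhds
    refine ge_of_tendsto h2 ?_
    filter_upwards [h1.eventually h, self_mem_nhdsWithin] with t ht ht0
    have ht0 : 0 < t := ht0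
    rw [map_smul, norm_smul, Real.norm_of_nonneg ht0.le, smul_eq_mul] at ht
    refine le_of_mul_le_mul_left ?_ ht0
    linarith [ht, show C * (t * ‖v‖) ^ 2 = t * (t * (C * ‖v‖ ^ 2)) by ring]
  ext v
  have h1 := key v
  have h2 := key (-v)
  simp at h2 ⊢
  linarith

lemma quad_le {V : Type*} [NormedAddCommGroup V] [NormedSpace ℝ V] (q : V → ℝ)
    (hq : ∀ (t : ℝ) v, q (t • v) = t ^ 2 * q v)
    (h : ∀ ε > 0, ∀ᶠ x in 𝓝 (0 : V), q x ≤ ε * ‖x‖ ^ 2) (v : V) : q v ≤ 0 := by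
  have key : ∀ ε > 0, q v ≤ ε * ‖v‖ ^ 2 := by
    intro ε hε
    have h1 : Tendsto (fun t : ℝ => t • v) (𝓝[>] 0) (𝓝 0) := by
      have : Tendsto (fun t : ℝ => t • v) (𝓝 0) (𝓝 ((0:ℝ) • v)) := by
        apply Continuous.tendsto; fun_prop
      simpa using this.mono_left nhdsWithin_le_nhds
    obtain ⟨t, ht, ht0⟩ := ((h1.eventually (h ε hε)).and self_mem_nhdsWithin).exists
    have ht0 : 0 < t := ht0
    rw [hq, norm_smul, Real.norm_of_nonneg ht0.le, mul_pow] at ht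
    refine le_of_mul_le_mul_left (a := t ^ 2) ?_ (by positivity)
    linarith
  refine ge_of_tendsto (f := fun ε : ℝ => ε * ‖v‖ ^ 2) (x := 𝓝[>] 0) ?_ ?_
  · have : Tendsto (fun ε : ℝ => ε * ‖v‖ ^ 2) (𝓝 0) (𝓝 (0 * ‖v‖ ^ 2)) := by
      apply Continuous.tendsto; fun_prop
    simpa using this.mono_left nhdsWithin_le_nhds
  · filter_upwards [self_mem_nhdsWithin] with ε hε using key ε hε

lemma exists_diff {V W F : Type*} [NormedAddCommGroup V] [NormedSpace ℝ V]
    [FiniteDimensional ℝ V] [NormedAddCommGroup W] [NormedSpace ℝ W] [FiniteDimensional ℝ W]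
    [NormedAddCommGroup F] [NormedSpace ℝ F] [FiniteDimensional ℝ F]
    (hd : Module.finrank ℝ W = Module.finrank ℝ V)
    (P : V → F) (T : V → W) (C1 C2 : NNReal) (hP : LipschitzWith C1 P) (hT : LipschitzWith C2 T)
    (K : Set V) (ρ : ℝ) (hρ : 0 < ρ) (hK : ball (0 : W) ρ ⊆ Set.image T K) :
    ∃ z ∈ K, DifferentiableAt ℝ P z := by
  let _ : MeasurableSpace V := borel V
  have : BorelSpace V := ⟨rfl⟩
  let _ : MeasurableSpace W := borel W
  have : BorelSpace W := ⟨rfl⟩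
  by_contra! hcon
  have h1 := hP.ae_differentiableAt (μ := Measure.hausdorffMeasure (Module.finrank ℝ V : ℝ))
  have h2 : Measure.hausdorffMeasure (Module.finrank ℝ V : ℝ) K = 0 :=
    measure_mono_null (fun z hz => hcon z hz) h1
  have h3 := hT.hausdorffMeasure_image_le (d := (Module.finrank ℝ V : ℝ)) (by positivity) K
  rw [h2, mul_zero] at h3
  have h4 : Measure.hausdorffMeasure (Module.finrank ℝ W : ℝ) (ball (0 : W) ρ) = 0 := by
    rw [hd]
    exact measure_mono_null hK (le_antisymm h3 bot_le)
  exact (measure_ball_pos (Measure.hausdorffMeasure (Module.finrank ℝ W : ℝ)) (0 : W) hρ).ne' h4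

lemma bil_bound {V : Type*} [NormedAddCommGroup V] [NormedSpace ℝ V]
    (B : V →L[ℝ] V →L[ℝ] ℝ) : ∃ b : ℝ, 0 ≤ b ∧ ∀ z w, |B z w| ≤ b * ‖z‖ * ‖w‖ :=
  ⟨‖B‖, B.opNorm_nonneg, fun z w => B.le_opNorm₂ z w⟩

section core2
variable {E : Type*} [NormedAddCommGroup E] [InnerProductSpace ℝ E] [FiniteDimensional ℝ E]

set_option synthInstance.maxHeartbeats 200000 in
lemma jensen (e1 e2 : E → ℝ) (P1 P2 : E → E) (m : ℝ) (hm : 0 < m)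
    (lo1 : ∀ z z', e1 z + inner ℝ (P1 z) (z' - z) ≤ e1 z')
    (hi1 : ∀ z z', e1 z' ≤ e1 z + inner ℝ (P1 z) (z' - z) + m / 2 * ‖z' - z‖ ^ 2)
    (lo2 : ∀ z z', e2 z + inner ℝ (P2 z) (z' - z) ≤ e2 z')
    (hi2 : ∀ z z', e2 z' ≤ e2 z + inner ℝ (P2 z) (z' - z) + m / 2 * ‖z' - z‖ ^ 2)
    (h10 : ∀ z, 0 ≤ e1 z) (h20 : ∀ z, 0 ≤ e2 z)
    (B : (E × E) →L[ℝ] (E × E) →L[ℝ] ℝ) (hsymm : ∀ z w, B z w = B w z)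
    (δ : ℝ) (hδ : 0 < δ)
    (hB : ∀ x y, e1 x + e2 y + δ / 2 * ‖(x, y)‖ ^ 2 ≤ (1 / 2) * B (x, y) (x, y))
    (η : ℝ) (hη : 0 < η) :
    ∃ x y : E, ‖x‖ ≤ η ∧ ‖y‖ ≤ η ∧ DifferentiableAt ℝ P1 x ∧ DifferentiableAt ℝ P2 y ∧
      ∀ h k, e1 (x + h) + e2 (y + k) ≤ e1 x + e2 y + inner ℝ (P1 x) h + inner ℝ (P2 y) k +
        (1 / 2) * B (h, k) (h, k) := by
  obtain ⟨L1, D1⟩ := c11_pkg e1 P1 m hm lo1 hi1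
  obtain ⟨L2, D2⟩ := c11_pkg e2 P2 m hm lo2 hi2
  obtain ⟨b, hb0, hb⟩ := bil_bound B
  set PP : E × E → (E × E →L[ℝ] ℝ) := fun z =>
    (innerSL ℝ (P1 z.1)).comp (ContinuousLinearMap.fst ℝ E E) +
      (innerSL ℝ (P2 z.2)).comp (ContinuousLinearMap.snd ℝ E E) with hPP
  have PPap : ∀ z h, PP z h = inner ℝ (P1 z.1) h.1 + inner ℝ (P2 z.2) h.2 := by
    intro z h; simp [hPP]
  set T : E × E → (E × E →L[ℝ] ℝ) := fun z => PP z - B z with hTdef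
  set P : E × E → E × E := fun z => (P1 z.1, P2 z.2) with hPdef
  have hP : LipschitzWith (m.toNNReal) P := by
    refine LipschitzWith.of_dist_le_mul fun z z' => ?_
    rw [Real.coe_toNNReal _ hm.le, dist_eq_norm, dist_eq_norm, Prod.norm_def]
    refine max_le ?_ ?_
    · exact (L1 _ _).trans (by gcongr; exact norm_fst_le (z - z'))
    · exact (L2 _ _).trans (by gcongr; exact norm_snd_le (z - z'))
  have hT : LipschitzWith (m + m + b).toNNReal T := by
    refine LipschitzWith.of_dist_le_mul fun z z' => ?_
    rw [Real.coe_toNNReal _ (by positivity), dist_eq_norm, dist_eq_norm]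
    refine ContinuousLinearMap.opNorm_le_bound _ (by positivity) fun h => ?_
    have e : (T z - T z') h = inner ℝ (P1 z.1 - P1 z'.1) h.1 + inner ℝ (P2 z.2 - P2 z'.2) h.2
        - B (z - z') h := by
      simp only [hTdef, sub_apply, PPap, inner_sub_left, map_sub]
      ring
    rw [e]
    have a1 : ‖(inner ℝ (P1 z.1 - P1 z'.1) h.1 : ℝ)‖ ≤ m * ‖z - z'‖ * ‖h‖ := by
      refine (norm_inner_le_norm _ _).trans ?_
      refine mul_le_mul ((L1 _ _).trans ?_) (norm_fst_le h) (norm_nonneg _) (by positivity)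
      gcongr; exact norm_fst_le (z - z')
    have a2 : ‖(inner ℝ (P2 z.2 - P2 z'.2) h.2 : ℝ)‖ ≤ m * ‖z - z'‖ * ‖h‖ := by
      refine (norm_inner_le_norm _ _).trans ?_
      refine mul_le_mul ((L2 _ _).trans ?_) (norm_snd_le h) (norm_nonneg _) (by positivity)
      gcongr; exact norm_snd_le (z - z')
    have a3 : ‖B (z - z') h‖ ≤ _ := hb (z - z') h
    refine (norm_sub_le _ _).trans ((add_le_add (norm_add_le _ _) le_rfl).trans ?_)
    linarith
  have c1 : Continuous e1 := continuous_iff_continuousAt.2 fun z => (D1 z).continuousAt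
  have c2 : Continuous e2 := continuous_iff_continuousAt.2 fun z => (D2 z).continuousAt
  set K : Set (E × E) := {z | ‖z‖ ≤ η ∧ ∀ h, e1 (z.1 + h.1) + e2 (z.2 + h.2) ≤
    e1 z.1 + e2 z.2 + PP z h + (1 / 2) * B h h} with hK
  have e00 : e1 0 + e2 0 = 0 := by
    have := hB 0 0
    have h0 : ((0 : E), (0 : E)) = 0 := rfl
    rw [h0] at this
    simp at this
    linarith [h10 0, h20 0]
  have hcov : ball (0 : E × E →L[ℝ] ℝ) (δ * η / 2) ⊆ Set.image T K := by
    intro p hp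
    have hp' : ‖p‖ < δ * η / 2 := by
      have := mem_ball.1 hp
      have h0 : dist p 0 = ‖p - 0‖ := dist_eq_norm p 0
      rw [sub_zero] at h0
      rwa [h0] at this
    have hcont : Continuous (fun z : E × E => e1 z.1 + e2 z.2 - (1 / 2) * B z z - p z) := by
      fun_prop
    obtain ⟨z, hz, hzm⟩ := (isCompact_closedBall (0 : E × E) η).exists_isMaxOn
      ⟨0, by simp [hη.le]⟩ hcont.continuousOn
    have hz' : ‖z‖ ≤ η := by simpa using hz
    have hglob : ∀ w, e1 w.1 + e2 w.2 - (1 / 2) * B w w - p w ≤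
        e1 z.1 + e2 z.2 - (1 / 2) * B z z - p z := by
      intro w
      by_cases hw : ‖w‖ ≤ η
      · exact hzm (show w ∈ closedBall (0 : E × E) η by simpa using hw)
      · push Not at hw
        have h0 : e1 (0 : E × E).1 + e2 (0 : E × E).2 - (1 / 2) * B 0 0 - p 0 ≤ _ :=
          hzm (show (0 : E × E) ∈ closedBall (0 : E × E) η by simp [hη.le])
        have h0' : (0:ℝ) ≤ e1 z.1 + e2 z.2 - (1 / 2) * B z z - p z := by
          refine le_trans (le_of_eq ?_) h0
          simp [e00]
        refine le_trans ?_ h0'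
        have hw1 := hB w.1 w.2
        have hw2 := p.le_opNorm w
        rw [Real.norm_eq_abs] at hw2
        have hw3 := neg_abs_le (p w)
        have hw4 : ‖p‖ * ‖w‖ ≤ δ * η / 2 * ‖w‖ := by gcongr
        have hw5 : δ * η / 2 * ‖w‖ ≤ δ / 2 * ‖w‖ ^ 2 := by
          have : η * ‖w‖ ≤ ‖w‖ * ‖w‖ := by gcongr
          nlinarith
        simp only [Prod.mk.eta] at hw1
        linarith
    have hinc : ∀ h : E × E, e1 (z.1 + h.1) + e2 (z.2 + h.2) ≤
        e1 z.1 + e2 z.2 + (B z h + p h) + (1 / 2) * B h h := by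
      intro h
      have := hglob (z + h)
      simp only [Prod.fst_add, Prod.snd_add, map_add, add_apply] at this
      rw [hsymm h z] at this
      linarith
    have hPz : PP z - (B z + p) = 0 := by
      refine lin_zero _ ((1 / 2) * b) (Eventually.of_forall fun h => ?_)
      have h1 := hinc h
      have h2 := lo1 z.1 (z.1 + h.1)
      have h3 := lo2 z.2 (z.2 + h.2)
      simp only [add_sub_cancel_left] at h2 h3
      have h4 : B h h ≤ b * ‖h‖ * ‖h‖ := (le_abs_self _).trans (hb h h)
      simp only [sub_apply, add_apply, PPap]
      linarith
    have hPz' : PP z = B z + p := sub_eq_zero.1 hPz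
    refine ⟨z, ⟨hz', fun h => ?_⟩, ?_⟩
    · rw [hPz']; exact hinc h
    · simp only [hTdef, hPz']; abel
  have hfin : Module.finrank ℝ (E × E →L[ℝ] ℝ) = Module.finrank ℝ (E × E) := by
    rw [← (LinearMap.toContinuousLinearMap (𝕜 := ℝ) (E := E × E) (F' := ℝ)).finrank_eq]
    exact Subspace.dual_finrank_eq
  obtain ⟨z, hzK, hzd⟩ := exists_diff hfin P T _ _ hP hT K (δ * η / 2) (by positivity) hcov
  refine ⟨z.1, z.2, (norm_fst_le z).trans hzK.1, (norm_snd_le z).trans hzK.1, ?_, ?_, ?_⟩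
  · have h1 : DifferentiableAt ℝ (fun x : E => (x, z.2)) z.1 := by fun_prop
    have h2 : DifferentiableAt ℝ (fun x : E => (P (x, z.2)).1) z.1 :=
      (DifferentiableAt.comp (g := P) z.1 hzd h1).fst
    exact h2
  · have h1 : DifferentiableAt ℝ (fun x : E => (z.1, x)) z.2 := by fun_prop
    have h2 : DifferentiableAt ℝ (fun x : E => (P (z.1, x)).2) z.2 :=
      (DifferentiableAt.comp (g := P) z.2 hzd h1).snd
    exact h2
  · intro h k
    have := hzK.2 (h, k)
    rw [PPap] at this
    simp only at this
    linarith

end core2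

section core3
variable {E : Type*} [NormedAddCommGroup E] [InnerProductSpace ℝ E] [FiniteDimensional ℝ E]

lemma transfer (a f e : E → ℝ) (Ξ P J : E → E) (r lam m c s σ : ℝ) (hlam : 0 < lam)
    (hm : 0 < m) (hs : 0 < s) (hc : 0 < c) (hmc : 4 * c ≤ m) (hsc : s * c ≤ σ)
    (hsm : (1 + s⁻¹) * c ≤ m)
    (hfa : ∀ y ξ, ‖ξ‖ ≤ r → a ξ - lam / 2 * ‖ξ‖ ^ 2 + lam * inner ℝ y ξ ≤ f y)
    (hfe : ∀ y, f y = a (Ξ y) - lam / 2 * ‖Ξ y‖ ^ 2 + lam * inner ℝ y (Ξ y))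
    (hfs : ∀ y y', f y + inner ℝ (lam • Ξ y) (y' - y) ≤ f y')
    (hPJ : ∀ z, P z = m • (z - J z)) (heJ : ∀ z, e z = f (J z) + m / 2 * ‖z - J z‖ ^ 2)
    (hfe2 : ∀ y, f y ≤ e (y + m⁻¹ • (lam • Ξ y)) - m / 2 * ‖m⁻¹ • (lam • Ξ y)‖ ^ 2)
    (hfJ : ∀ z y', f (J z) + inner ℝ (P z) (y' - J z) ≤ f y')
    (x0 : E) (hr : ‖P x0‖ < lam * r)
    (hglob : ∀ ζ, e (x0 + ζ) ≤ e x0 + inner ℝ (P x0) ζ + c / 2 * ‖ζ‖ ^ 2)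
    (L : E →L[ℝ] E) (hL0 : ∀ h, 0 ≤ inner ℝ (L h) h) (hLc : ∀ h, inner ℝ (L h) h ≤ c * ‖h‖ ^ 2)
    (hexp : ∀ ε > 0, ∀ᶠ h in 𝓝 (0 : E),
      e (x0 + h) ≤ e x0 + inner ℝ (P x0) h + (1 / 2) * inner ℝ (L h) h + ε * ‖h‖ ^ 2) :
    ∀ ε > 0, ∀ᶠ h in 𝓝 (0 : E), a (lam⁻¹ • P x0 + h) ≤ a (lam⁻¹ • P x0) +
      inner ℝ (P x0 - lam • (x0 - m⁻¹ • P x0)) h + (1 / 2) * inner ℝ (L h) h + σ / 2 * ‖h‖ ^ 2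
        - lam / 2 * ‖h‖ ^ 2 + ε * ‖h‖ ^ 2 := by
  have hJ : J x0 = x0 - m⁻¹ • P x0 := by
    rw [hPJ, smul_smul, inv_mul_cancel₀ hm.ne', one_smul]; abel
  rw [← hJ]
  set y0 := J x0 with hy0
  set p := P x0 with hp
  have hxy : x0 - y0 = m⁻¹ • p := by rw [hJ]; abel
  have main : ∀ η : E, ∃ ζ : E, f (y0 + η) ≤ f y0 + inner ℝ p η +
      (e (x0 + ζ) - e x0 - inner ℝ p ζ) - m / 2 * ‖ζ - η‖ ^ 2 := by
    intro η
    refine ⟨y0 + η + m⁻¹ • (lam • Ξ (y0 + η)) - x0, ?_⟩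
    set k := m⁻¹ • (lam • Ξ (y0 + η)) with hk
    set ζ := y0 + η + k - x0 with hζ
    have h1 := hfe2 (y0 + η)
    have h2 := heJ x0
    rw [← hk, show y0 + η + k = x0 + ζ by rw [hζ]; abel] at h1
    rw [hxy] at h2
    have h3 : k = m⁻¹ • p + (ζ - η) := by rw [← hxy, hζ]; abel
    rw [h3, norm_add_sq_real, inner_smul_left, inner_sub_right] at h1
    simp only [conj_trivial] at h1
    have h4 : m / 2 * (2 * (m⁻¹ * (inner ℝ p ζ - inner ℝ p η))) = inner ℝ p ζ - inner ℝ p η := by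
      field_simp
    linarith
  have hz : ∀ η ζ : E, f (y0 + η) ≤ f y0 + inner ℝ p η +
      (e (x0 + ζ) - e x0 - inner ℝ p ζ) - m / 2 * ‖ζ - η‖ ^ 2 → ‖ζ‖ ≤ 2 * ‖η‖ := by
    intro η ζ h
    have h1 := hfJ x0 (y0 + η)
    rw [← hy0, ← hp, add_sub_cancel_left] at h1
    have h2 := hglob ζ
    have h3 : m / 2 * ‖ζ - η‖ ^ 2 ≤ c / 2 * ‖ζ‖ ^ 2 := by linarith
    have h4 : 4 * c * ‖ζ‖ ^ 2 ≤ m * ‖ζ‖ ^ 2 := by gcongr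
    have h5 : ‖ζ - η‖ ^ 2 ≤ (‖ζ‖ / 2) ^ 2 := by
      refine le_of_mul_le_mul_left (a := m) ?_ hm
      nlinarith
    have h6 : ‖ζ - η‖ ≤ ‖ζ‖ / 2 := (abs_le_of_sq_le_sq' h5 (by positivity)).2
    have h7 : ‖ζ‖ ≤ ‖ζ - η‖ + ‖η‖ := by
      have := norm_add_le (ζ - η) η
      simpa using this
    linarith
  have hf2 : ∀ ε > 0, ∀ᶠ η in 𝓝 (0 : E), f (y0 + η) ≤ f y0 + inner ℝ p η +
      (1 / 2) * inner ℝ (L η) η + σ / 2 * ‖η‖ ^ 2 + ε * ‖η‖ ^ 2 := by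
    intro ε hε
    obtain ⟨ρ, hρ, hb⟩ := Metric.eventually_nhds_iff_ball.1 (hexp (ε / 4) (by positivity))
    filter_upwards [ball_mem_nhds (0 : E) (half_pos hρ)] with η hη
    have hη' : ‖η‖ < ρ / 2 := by simpa using hη
    obtain ⟨ζ, hζ⟩ := main η
    have h1 := hz η ζ hζ
    have h2 := hb ζ (by simp; linarith)
    set θ := ζ - η with hθ
    have h3 : ζ = η + θ := by rw [hθ]; abel
    have h4 : ε / 4 * ‖ζ‖ ^ 2 ≤ ε * ‖η‖ ^ 2 := by
      have : ‖ζ‖ ^ 2 ≤ (2 * ‖η‖) ^ 2 := by gcongr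
      nlinarith
    have h5 := hL0 (s • η - θ)
    have h6 : inner ℝ (L ζ) ζ = inner ℝ (L η) η + (inner ℝ (L η) θ + inner ℝ (L θ) η)
        + inner ℝ (L θ) θ := by
      rw [h3]; simp only [map_add, inner_add_left, inner_add_right]; ring
    simp only [map_sub, map_smul, inner_sub_left, inner_sub_right, inner_smul_left,
      inner_smul_right, conj_trivial] at h5
    have h7 : inner ℝ (L η) θ + inner ℝ (L θ) η ≤ s * inner ℝ (L η) η + s⁻¹ * inner ℝ (L θ) θ := by
      refine le_of_mul_le_mul_left (a := s) ?_ hs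
      rw [mul_add s (s * _), ← mul_assoc s s⁻¹, mul_inv_cancel₀ hs.ne']
      linarith
    have h8 : s * inner ℝ (L η) η ≤ σ * ‖η‖ ^ 2 := by
      calc s * inner ℝ (L η) η ≤ s * (c * ‖η‖ ^ 2) := by gcongr; exact hLc η
        _ = (s * c) * ‖η‖ ^ 2 := by ring
        _ ≤ _ := by gcongr
    have h9 : (1 + s⁻¹) * inner ℝ (L θ) θ ≤ m * ‖θ‖ ^ 2 := by
      calc (1 + s⁻¹) * inner ℝ (L θ) θ ≤ (1 + s⁻¹) * (c * ‖θ‖ ^ 2) := by gcongr; exact hLc θ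
        _ = ((1 + s⁻¹) * c) * ‖θ‖ ^ 2 := by ring
        _ ≤ _ := by gcongr
    rw [add_mul, one_mul] at h9
    linarith
  have hΞ : lam • Ξ y0 = p := by
    have : innerSL ℝ (lam • Ξ y0 - p) = 0 := by
      refine lin_zero _ (2 * c) (Eventually.of_forall fun η => ?_)
      obtain ⟨ζ, hζ⟩ := main η
      have h1 := hz η ζ hζ
      have h2 := hglob ζ
      have h3 := hfs y0 (y0 + η)
      rw [add_sub_cancel_left] at h3
      have h4 : c / 2 * ‖ζ‖ ^ 2 ≤ 2 * c * ‖η‖ ^ 2 := by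
        have : ‖ζ‖ ^ 2 ≤ (2 * ‖η‖) ^ 2 := by gcongr
        nlinarith
      have h5 : 0 ≤ m / 2 * ‖ζ - η‖ ^ 2 := by positivity
      rw [innerSL_apply_apply, inner_sub_left]
      linarith
    have h2 := congrArg (fun l => l (lam • Ξ y0 - p)) this
    simp only [innerSL_apply_apply, zero_apply, inner_self_eq_zero] at h2
    exact sub_eq_zero.1 h2
  have hΞ' : Ξ y0 = lam⁻¹ • p := by
    rw [← hΞ, smul_smul, inv_mul_cancel₀ hlam.ne', one_smul]
  set ξ0 := lam⁻¹ • p with hξ0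
  have hpξ : p = lam • ξ0 := by rw [← hΞ, hΞ']
  have hξr : ‖ξ0‖ < r := by
    rw [hξ0, norm_smul, norm_inv, Real.norm_of_nonneg hlam.le]
    rw [inv_mul_lt_iff₀ hlam]; exact hr
  intro ε hε
  have hnear : ∀ᶠ h in 𝓝 (0 : E), ‖ξ0 + h‖ < r := by
    have hc : Continuous (fun h : E => ‖ξ0 + h‖) := by fun_prop
    exact hc.continuousAt.eventually_lt continuousAt_const (by simpa using hξr)
  filter_upwards [hf2 ε hε, hnear] with h h1 h2
  have h3 := hfa (y0 + h) (ξ0 + h) h2.le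
  have h4 := hfe y0
  rw [hΞ'] at h4
  rw [hpξ] at h1 ⊢
  rw [norm_add_sq_real] at h3
  simp only [inner_add_left, inner_add_right, inner_sub_left, inner_smul_left,
    conj_trivial, real_inner_self_eq_norm_sq] at h1 h3 h4 ⊢
  rw [real_inner_comm ξ0 h] at h3
  linarith

end core3

section core4
variable {E : Type*} [NormedAddCommGroup E] [InnerProductSpace ℝ E] [FiniteDimensional ℝ E]

/-- Second order expansion of a `C^{1,1}` convex function at a point where the gradient is
differentiable. -/
lemma expansion (e : E → ℝ) (P : E → E) (L : E →L[ℝ] E) (x : E)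
    (hD : ∀ z, HasFDerivAt e (innerSL ℝ (P z)) z) (hP : HasFDerivAt P L x) :
    (∀ h k, inner ℝ (L h) k = inner ℝ (L k) h) ∧ ∀ ε > 0, ∀ᶠ h in 𝓝 (0 : E),
      |e (x + h) - e x - inner ℝ (P x) h - (1 / 2) * inner ℝ (L h) h| ≤ ε * ‖h‖ ^ 2 := by
  set I : E →L[ℝ] E →L[ℝ] ℝ := innerSL ℝ with hI
  have h1 : HasFDerivAt (fun y => I (P y)) (I.comp L) x := I.hasFDerivAt.comp x hP
  have hD' : ∀ᶠ z in 𝓝 x, HasFDerivAt e (I (P z)) z := Eventually.of_forall hD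
  refine ⟨fun h k => second_derivative_symmetric_of_eventually hD' h1 h k, fun ε hε => ?_⟩
  exact taylor2_s5 hD' h1 ε hε

lemma full_pkg (a : E → ℝ) (ha : UpperSemicontinuous a) (ha0 : a 0 = 0) (r lam m : ℝ)
    (hr : 0 < r) (hlam : 0 < lam) (hm : 0 < m) :
    ∃ (f e : E → ℝ) (Ξ P J : E → E), (∀ y, ‖Ξ y‖ ≤ r) ∧
      (∀ y ξ, ‖ξ‖ ≤ r → a ξ - lam / 2 * ‖ξ‖ ^ 2 + lam * inner ℝ y ξ ≤ f y) ∧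
      (∀ y, f y = a (Ξ y) - lam / 2 * ‖Ξ y‖ ^ 2 + lam * inner ℝ y (Ξ y)) ∧
      (∀ y y', f y + inner ℝ (lam • Ξ y) (y' - y) ≤ f y') ∧
      (∀ z, P z = m • (z - J z)) ∧ (∀ z, e z = f (J z) + m / 2 * ‖z - J z‖ ^ 2) ∧
      (∀ y, f y ≤ e (y + m⁻¹ • (lam • Ξ y)) - m / 2 * ‖m⁻¹ • (lam • Ξ y)‖ ^ 2) ∧
      (∀ z y', f (J z) + inner ℝ (P z) (y' - J z) ≤ f y') ∧
      (∀ z z', e z + inner ℝ (P z) (z' - z) ≤ e z') ∧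
      (∀ z z', e z' ≤ e z + inner ℝ (P z) (z' - z) + m / 2 * ‖z' - z‖ ^ 2) ∧
      (∀ z, 0 ≤ e z) ∧ (∀ z, e z ≤ f z) := by
  obtain ⟨f, Ξ, h1, h2, h3⟩ := sup_pkg a ha r lam hr
  have hfs : ∀ y y', f y + inner ℝ (lam • Ξ y) (y' - y) ≤ f y' := by
    intro y y'
    have := h2 y' (Ξ y) (h1 y)
    rw [h3 y, inner_smul_left, inner_sub_right, real_inner_comm y' (Ξ y), real_inner_comm y (Ξ y)]
    simp only [conj_trivial]
    rw [real_inner_comm (Ξ y) y', real_inner_comm (Ξ y) y] at *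
    linarith
  have hf0 : ∀ y, 0 ≤ f y := by
    intro y
    have := h2 y 0 (by simp [hr.le])
    simpa [ha0] using this
  have hfc : Continuous f := by
    have : LipschitzWith (lam * r).toNNReal f := by
      refine LipschitzWith.of_le_add_mul _ fun y y' => ?_
      rw [Real.coe_toNNReal _ (by positivity), dist_eq_norm]
      have h4 := hfs y y'
      have h5 := abs_real_inner_le_norm (lam • Ξ y) (y' - y)
      have h6 := neg_abs_le (inner ℝ (lam • Ξ y) (y' - y))
      have h7 : ‖lam • Ξ y‖ ≤ lam * r := by
        rw [norm_smul, Real.norm_of_nonneg hlam.le]; gcongr; exact h1 y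
      have h8 : ‖lam • Ξ y‖ * ‖y' - y‖ ≤ lam * r * ‖y - y'‖ := by
        rw [norm_sub_rev y' y]; gcongr
      linarith
    exact this.continuous
  obtain ⟨e, P, J, g1, g2, g3, g4, g5, g6⟩ := env_pkg f (fun y => lam • Ξ y) hf0 hfc hfs m hm
  refine ⟨f, e, Ξ, P, J, h1, h2, h3, hfs, g1, g2, g5, g6, g3, ?_, ?_, ?_⟩
  · intro z z'
    have := g4 z' (J z)
    rw [g2 z]
    rw [show z' - J z = (z - J z) + (z' - z) by abel, norm_add_sq_real] at this
    rw [g1 z, inner_smul_left]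
    simp only [conj_trivial]
    linarith
  · intro z; rw [g2]; have := hf0 (J z); positivity
  · intro z; simpa using g4 z z

lemma P_zero (e : E → ℝ) (P : E → E) (m : ℝ)
    (hi : ∀ z z', e z' ≤ e z + inner ℝ (P z) (z' - z) + m / 2 * ‖z' - z‖ ^ 2)
    (h0 : ∀ z, 0 ≤ e z) (he : e 0 = 0) : P 0 = 0 := by
  have : innerSL ℝ (-P 0) = 0 := by
    refine lin_zero _ (m / 2) (Eventually.of_forall fun η => ?_)
    have h1 := hi 0 η
    have h2 := h0 η
    rw [he, sub_zero] at h1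
    rw [innerSL_apply_apply, inner_neg_left]
    linarith
  have h2 := congrArg (fun l => l (-P 0)) this
  simp only [innerSL_apply_apply, zero_apply, inner_self_eq_zero] at h2
  exact neg_eq_zero.1 h2

lemma core (w1 w2 : E → ℝ) (hw1 : UpperSemicontinuous w1) (hw2 : UpperSemicontinuous w2)
    (h10 : w1 0 = 0) (h20 : w2 0 = 0) (r lam δ σ : ℝ) (hr : 0 < r) (hlam : 0 < lam) (hδ : 0 < δ)
    (hσ : 0 < σ) (B : (E × E) →L[ℝ] (E × E) →L[ℝ] ℝ) (hsymm : ∀ z w, B z w = B w z)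
    (hH : ∀ ξ1 ξ2, ‖ξ1‖ ≤ r → ‖ξ2‖ ≤ r → ∀ x y, w1 ξ1 + w2 ξ2 - lam / 2 * (‖ξ1‖ ^ 2 + ‖ξ2‖ ^ 2)
      + lam * (inner ℝ x ξ1 + inner ℝ y ξ2) + δ / 2 * ‖(x, y)‖ ^ 2 ≤ (1 / 2) * B (x, y) (x, y))
    (η : ℝ) (hη : 0 < η) :
    ∃ (ξ1 ξ2 q1 q2 : E) (L1 L2 : E →L[ℝ] E), ‖ξ1‖ ≤ η ∧ ‖ξ2‖ ≤ η ∧ ‖q1‖ ≤ η ∧ ‖q2‖ ≤ η ∧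
      (∀ h k, inner ℝ (L1 h) k = inner ℝ (L1 k) h) ∧
      (∀ h k, inner ℝ (L2 h) k = inner ℝ (L2 k) h) ∧
      (∀ h, 0 ≤ inner ℝ (L1 h) h) ∧ (∀ h, 0 ≤ inner ℝ (L2 h) h) ∧
      (∀ h k, inner ℝ (L1 h) h + inner ℝ (L2 k) k ≤
        B (h, k) (h, k) + σ * (‖h‖ ^ 2 + ‖k‖ ^ 2)) ∧
      (∀ ε > 0, ∀ᶠ h in 𝓝 (0 : E), w1 (ξ1 + h) ≤ w1 ξ1 + inner ℝ q1 h +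
        (1 / 2) * inner ℝ (L1 h) h - lam / 2 * ‖h‖ ^ 2 + ε * ‖h‖ ^ 2) ∧
      (∀ ε > 0, ∀ᶠ h in 𝓝 (0 : E), w2 (ξ2 + h) ≤ w2 ξ2 + inner ℝ q2 h +
        (1 / 2) * inner ℝ (L2 h) h - lam / 2 * ‖h‖ ^ 2 + ε * ‖h‖ ^ 2) := by
  obtain ⟨b, hb0, hb⟩ := bil_bound B
  obtain ⟨c, hc⟩ : ∃ c : ℝ, c = b + 1 := ⟨_, rfl⟩
  have hc0 : 0 < c := by linarith
  obtain ⟨s, hs⟩ : ∃ s : ℝ, s = σ / c := ⟨_, rfl⟩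
  have hs0 : 0 < s := by rw [hs]; positivity
  obtain ⟨m, hmdef⟩ : ∃ m : ℝ, m = 4 * c + (1 + s⁻¹) * c := ⟨_, rfl⟩
  have hm1 : 4 * c ≤ m := by rw [hmdef]; linarith [show 0 < (1 + s⁻¹) * c by positivity]
  have hm2 : (1 + s⁻¹) * c ≤ m := by rw [hmdef]; linarith
  have hm : 0 < m := by linarith
  have hsc : s * c ≤ σ := by rw [hs, div_mul_cancel₀ _ hc0.ne']
  obtain ⟨f1, e1, Ξ1, P1, J1, a1, a2, a3, a4, a5, a6, a7, a8, a9, a10, a11, a12⟩ :=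
    full_pkg w1 hw1 h10 r lam m hr hlam hm
  obtain ⟨f2, e2, Ξ2, P2, J2, b1, b2, b3, b4, b5, b6, b7, b8, b9, b10, b11, b12⟩ :=
    full_pkg w2 hw2 h20 r lam m hr hlam hm
  obtain ⟨Lip1, D1⟩ := c11_pkg e1 P1 m hm a9 a10
  obtain ⟨Lip2, D2⟩ := c11_pkg e2 P2 m hm b9 b10
  have hB : ∀ x y, e1 x + e2 y + δ / 2 * ‖(x, y)‖ ^ 2 ≤ (1 / 2) * B (x, y) (x, y) := by
    intro x y
    have := hH (Ξ1 x) (Ξ2 y) (a1 x) (b1 y) x y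
    have h1 := a12 x
    have h2 := b12 y
    rw [a3] at h1
    rw [b3] at h2
    linarith
  have e00 : e1 0 = 0 ∧ e2 0 = 0 := by
    have := hB 0 0
    have h0 : ((0 : E), (0 : E)) = 0 := rfl
    rw [h0] at this
    simp at this
    constructor <;> linarith [a11 0, b11 0]
  have P10 := P_zero e1 P1 m a10 a11 e00.1
  have P20 := P_zero e2 P2 m b10 b11 e00.2
  obtain ⟨η', hη0, hη1, hη2, hη3⟩ : ∃ η' : ℝ, 0 < η' ∧ m * η' < lam * r ∧ m * η' ≤ lam * η ∧
      (m + 2 * lam) * η' ≤ η := by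
    refine ⟨min (η / (m + 2 * lam)) (min (lam * η / m) (lam * r / (2 * m))), by positivity,
      ?_, ?_, ?_⟩
    · calc _ ≤ m * (lam * r / (2 * m)) := by
            gcongr; exact (min_le_right _ _).trans (min_le_right _ _)
        _ = lam * r / 2 := by field_simp
        _ < _ := by linarith [show 0 < lam * r by positivity]
    · calc _ ≤ m * (lam * η / m) := by
            gcongr; exact (min_le_right _ _).trans (min_le_left _ _)
        _ = _ := by field_simp
    · calc _ ≤ (m + 2 * lam) * (η / (m + 2 * lam)) := by gcongr; exact min_le_left _ _
        _ = _ := by field_simp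
  obtain ⟨x, y, hx, hy, dx, dy, htouch⟩ := jensen e1 e2 P1 P2 m hm a9 a10 b9 b10 a11 b11 B hsymm
    δ hδ hB η' hη0
  obtain ⟨sym1, ex1⟩ := expansion e1 P1 (fderiv ℝ P1 x) x D1 dx.hasFDerivAt
  obtain ⟨sym2, ex2⟩ := expansion e2 P2 (fderiv ℝ P2 y) y D2 dy.hasFDerivAt
  set L1 := fderiv ℝ P1 x with hL1
  set L2 := fderiv ℝ P2 y with hL2
  have psd1 : ∀ h, 0 ≤ inner ℝ (L1 h) h := by
    intro h
    have := quad_le (fun h => -((1 / 2) * inner ℝ (L1 h) h))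
      (fun t v => by simp [inner_smul_left, inner_smul_right]; ring) (fun ε hε => by
        filter_upwards [ex1 ε hε] with k hk
        have h1 := (abs_le.1 hk).2
        have h2 := a9 x (x + k)
        rw [add_sub_cancel_left] at h2
        linarith) h
    linarith
  have psd2 : ∀ h, 0 ≤ inner ℝ (L2 h) h := by
    intro h
    have := quad_le (fun h => -((1 / 2) * inner ℝ (L2 h) h))
      (fun t v => by simp [inner_smul_left, inner_smul_right]; ring) (fun ε hε => by
        filter_upwards [ex2 ε hε] with k hk
        have h1 := (abs_le.1 hk).2
        have h2 := b9 y (y + k)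
        rw [add_sub_cancel_left] at h2
        linarith) h
    linarith
  have upp : ∀ h k, inner ℝ (L1 h) h + inner ℝ (L2 k) k ≤ B (h, k) (h, k) := by
    intro h k
    have := quad_le (fun z : E × E => (1 / 2) * (inner ℝ (L1 z.1) z.1 + inner ℝ (L2 z.2) z.2)
        - (1 / 2) * B z z)
      (fun t v => by simp [inner_smul_left, inner_smul_right]; ring) (fun ε hε => by
        have t1 : Tendsto (fun z : E × E => z.1) (𝓝 0) (𝓝 0) := continuous_fst.tendsto 0
        have t2 : Tendsto (fun z : E × E => z.2) (𝓝 0) (𝓝 0) := continuous_snd.tendsto 0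
        filter_upwards [t1.eventually (ex1 (ε / 2) (half_pos hε)),
          t2.eventually (ex2 (ε / 2) (half_pos hε))] with z hz1 hz2
        have h1 := (abs_le.1 hz1).1
        have h2 := (abs_le.1 hz2).1
        have h3 := htouch z.1 z.2
        have h4 : ‖z.1‖ ^ 2 ≤ ‖z‖ ^ 2 := by gcongr; exact norm_fst_le z
        have h5 : ‖z.2‖ ^ 2 ≤ ‖z‖ ^ 2 := by gcongr; exact norm_snd_le z
        simp only [Prod.mk.eta] at h3
        nlinarith) (h, k)
    simp only at this
    linarith
  have Bc1 : ∀ h : E, B (h, 0) (h, 0) ≤ c * ‖h‖ ^ 2 := by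
    intro h
    have h1 := (le_abs_self _).trans (hb (h, 0) (h, 0))
    have h2 : ‖(h, (0 : E))‖ = ‖h‖ := by simp
    rw [h2] at h1
    rw [hc]; nlinarith [sq_nonneg ‖h‖]
  have Bc2 : ∀ h : E, B (0, h) (0, h) ≤ c * ‖h‖ ^ 2 := by
    intro h
    have h1 := (le_abs_self _).trans (hb (0, h) (0, h))
    have h2 : ‖((0 : E), h)‖ = ‖h‖ := by simp
    rw [h2] at h1
    rw [hc]; nlinarith [sq_nonneg ‖h‖]
  have nP1 : ‖P1 x‖ ≤ m * η' := by
    have := Lip1 x 0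
    rw [P10, sub_zero, sub_zero] at this
    exact this.trans (by gcongr)
  have nP2 : ‖P2 y‖ ≤ m * η' := by
    have := Lip2 y 0
    rw [P20, sub_zero, sub_zero] at this
    exact this.trans (by gcongr)
  have smallξ : ∀ p : E, ‖p‖ ≤ m * η' → ‖lam⁻¹ • p‖ ≤ η := by
    intro p hp
    rw [norm_smul, norm_inv, Real.norm_of_nonneg hlam.le, inv_mul_le_iff₀ hlam]
    linarith
  have smallq : ∀ p z : E, ‖p‖ ≤ m * η' → ‖z‖ ≤ η' → ‖p - lam • (z - m⁻¹ • p)‖ ≤ η := by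
    intro p z hp hz
    refine (norm_sub_le _ _).trans ?_
    rw [norm_smul, Real.norm_of_nonneg hlam.le]
    have h1 : ‖m⁻¹ • p‖ ≤ η' := by
      rw [norm_smul, norm_inv, Real.norm_of_nonneg hm.le, inv_mul_le_iff₀ hm]
      linarith
    have h2 : ‖z - m⁻¹ • p‖ ≤ 2 * η' := (norm_sub_le _ _).trans (by linarith)
    have h3 : lam * ‖z - m⁻¹ • p‖ ≤ lam * (2 * η') := by gcongr
    linarith
  have T1 := transfer w1 f1 e1 Ξ1 P1 J1 r lam m c s σ hlam hm hs0 hc0 hm1 hsc hm2 a2 a3 a4 a5 a6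
    a7 a8 x (nP1.trans_lt hη1) (fun ζ => by
      have := htouch ζ 0
      simp only [add_zero, inner_zero_right] at this
      linarith [Bc1 ζ]) L1 psd1 (fun h => by
      have := upp h 0
      simp only [inner_zero_right] at this
      linarith [Bc1 h]) (fun ε hε => by
      filter_upwards [ex1 ε hε] with h hh
      linarith [(abs_le.1 hh).2])
  have T2 := transfer w2 f2 e2 Ξ2 P2 J2 r lam m c s σ hlam hm hs0 hc0 hm1 hsc hm2 b2 b3 b4 b5 b6
    b7 b8 y (nP2.trans_lt hη1) (fun ζ => by
      have := htouch 0 ζ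
      simp only [add_zero, inner_zero_right] at this
      linarith [Bc2 ζ]) L2 psd2 (fun h => by
      have := upp 0 h
      simp only [inner_zero_right] at this
      linarith [Bc2 h]) (fun ε hε => by
      filter_upwards [ex2 ε hε] with h hh
      linarith [(abs_le.1 hh).2])
  have apL : ∀ (L : E →L[ℝ] E) h k, inner ℝ ((L + σ • ContinuousLinearMap.id ℝ E) h) k =
      inner ℝ (L h) k + σ * inner ℝ h k := by
    intro L h k
    simp [inner_add_left, inner_smul_left]
  refine ⟨lam⁻¹ • P1 x, lam⁻¹ • P2 y, _, _, L1 + σ • ContinuousLinearMap.id ℝ E,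
    L2 + σ • ContinuousLinearMap.id ℝ E, smallξ _ nP1, smallξ _ nP2, smallq _ x nP1 hx,
    smallq _ y nP2 hy, ?_, ?_, ?_, ?_, ?_, ?_, ?_⟩
  · intro h k; rw [apL, apL, sym1 h k, real_inner_comm h k]
  · intro h k; rw [apL, apL, sym2 h k, real_inner_comm h k]
  · intro h; rw [apL, real_inner_self_eq_norm_sq]; have := psd1 h; positivity
  · intro h; rw [apL, real_inner_self_eq_norm_sq]; have := psd2 h; positivity
  · intro h k; rw [apL, apL, real_inner_self_eq_norm_sq, real_inner_self_eq_norm_sq]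
    linarith [upp h k]
  · intro ε hε
    filter_upwards [T1 ε hε] with h hh
    rw [apL, real_inner_self_eq_norm_sq]
    linarith
  · intro ε hε
    filter_upwards [T2 ε hε] with h hh
    rw [apL, real_inner_self_eq_norm_sq]
    linarith

end core4

/-- The quadratic form of a matrix is controlled by `symNorm`. -/
lemma quad_le_symNorm {n : Type*} [Fintype n] (A : Matrix n n ℝ) (θ : n → ℝ) :
    ∑ i, ∑ j, θ i * A i j * θ j ≤ symNorm A * ∑ i, θ i ^ 2 := by
  have hb : BddAbove {r : ℝ | ∃ v : EuclideanSpace ℝ n, ‖v‖ = 1 ∧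
      r = |∑ i, ∑ j, v i * A i j * v j|} := by
    refine ⟨∑ i, ∑ j, |A i j|, ?_⟩
    rintro r ⟨v, hv, rfl⟩
    have hvi : ∀ i, |v i| ≤ 1 := fun i => by
      have := PiLp.norm_apply_le v i
      rwa [hv, Real.norm_eq_abs] at this
    refine (Finset.abs_sum_le_sum_abs _ _).trans (Finset.sum_le_sum fun i _ => ?_)
    refine (Finset.abs_sum_le_sum_abs _ _).trans (Finset.sum_le_sum fun j _ => ?_)
    rw [abs_mul, abs_mul]
    have h1 : |v i| * |A i j| ≤ 1 * |A i j| := by gcongr; exact hvi i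
    calc |v i| * |A i j| * |v j| ≤ (1 * |A i j|) * 1 := by
          gcongr
          exact hvi j
      _ = |A i j| := by ring
  set v : EuclideanSpace ℝ n := WithLp.toLp 2 θ with hv
  have hvi : ∀ i, v i = θ i := fun i => rfl
  have hn : ‖v‖ ^ 2 = ∑ i, θ i ^ 2 := by
    rw [EuclideanSpace.real_norm_sq_eq]
  by_cases h0 : v = 0
  · have : ∀ i, θ i = 0 := fun i => by rw [← hvi, h0]; rfl
    simp [this]
  have hpos : 0 < ‖v‖ := norm_pos_iff.2 h0
  have key : |∑ i, ∑ j, (‖v‖⁻¹ • v) i * A i j * (‖v‖⁻¹ • v) j| ≤ symNorm A := by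
    refine le_csSup hb ⟨‖v‖⁻¹ • v, ?_, rfl⟩
    rw [norm_smul, norm_inv, norm_norm]
    field_simp
  have e : ∑ i, ∑ j, (‖v‖⁻¹ • v) i * A i j * (‖v‖⁻¹ • v) j
      = ‖v‖⁻¹ ^ 2 * ∑ i, ∑ j, θ i * A i j * θ j := by
    rw [Finset.mul_sum]
    refine Finset.sum_congr rfl fun i _ => ?_
    rw [Finset.mul_sum]
    refine Finset.sum_congr rfl fun j _ => ?_
    simp only [PiLp.smul_apply, smul_eq_mul, hvi]
    ring
  rw [e] at key
  have k2 := (le_abs_self _).trans key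
  rw [← hn]
  have : ∑ i, ∑ j, θ i * A i j * θ j
      = (‖v‖⁻¹ ^ 2 * ∑ i, ∑ j, θ i * A i j * θ j) * ‖v‖ ^ 2 := by
    field_simp
  rw [this]
  gcongr

lemma sum_eq_dot {n : Type*} [Fintype n] (A : Matrix n n ℝ) (x y : n → ℝ) :
    ∑ i, ∑ j, x i * A i j * y j = dotProduct x (A.mulVec y) := by
  simp only [dotProduct, Matrix.mulVec, Finset.mul_sum, mul_assoc]

/-- The basic matrix inequality. -/
lemma mat_ineq {n : Type*} [Fintype n] [DecidableEq n] (A : Matrix n n ℝ) (hA : A.IsSymm)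
    (ι : ℝ) (hι : 0 < ι) (ξ z : n → ℝ) :
    dotProduct ξ (A.mulVec ξ) ≤ dotProduct z (A.mulVec z) + ι * dotProduct z ((A ^ 2).mulVec z)
      + (1 / ι + symNorm A) * ∑ i, (ξ i - z i) ^ 2 := by
  have h1 := quad_le_symNorm A (ξ - z)
  rw [sum_eq_dot] at h1
  have h2 : dotProduct z ((A ^ 2).mulVec z) = ∑ i, (A.mulVec z i) ^ 2 := by
    rw [pow_two, ← Matrix.mulVec_mulVec, Matrix.dotProduct_mulVec, ← Matrix.mulVec_transpose, hA.eq]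
    simp [dotProduct, pow_two]
  have h3 : dotProduct z (A.mulVec (ξ - z)) = dotProduct (ξ - z) (A.mulVec z) := by
    rw [Matrix.dotProduct_mulVec, ← Matrix.mulVec_transpose, hA.eq, dotProduct_comm]
  have h4 : dotProduct ξ (A.mulVec ξ) = dotProduct z (A.mulVec z)
      + 2 * dotProduct (ξ - z) (A.mulVec z) + dotProduct (ξ - z) (A.mulVec (ξ - z)) := by
    have : ξ = z + (ξ - z) := by abel
    conv_lhs => rw [this]
    rw [Matrix.mulVec_add, add_dotProduct, dotProduct_add, dotProduct_add, h3]
    ring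
  have h5 : 2 * dotProduct (ξ - z) (A.mulVec z) ≤ ι * (∑ i, (A.mulVec z i) ^ 2)
      + 1 / ι * ∑ i, (ξ i - z i) ^ 2 := by
    simp only [dotProduct, Finset.mul_sum, ← Finset.sum_add_distrib]
    refine Finset.sum_le_sum fun i _ => ?_
    simp only [Pi.sub_apply]
    have : ι * A.mulVec z i ^ 2 + 1 / ι * (ξ i - z i) ^ 2 - 2 * ((ξ i - z i) * A.mulVec z i)
        = 1 / ι * (ι * A.mulVec z i - (ξ i - z i)) ^ 2 := by
      field_simp; ring
    have : 0 ≤ 1 / ι * (ι * A.mulVec z i - (ξ i - z i)) ^ 2 := by positivity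
    linarith
  simp only [Pi.sub_apply] at h1
  rw [h4, h2]
  linarith

/-- Coordinates of a pair. -/
lemma pair_norm {N : ℕ} (a b : EuclideanSpace ℝ (Fin N)) :
    ∑ i, (Sum.elim a b i) ^ 2 = ‖a‖ ^ 2 + ‖b‖ ^ 2 := by
  rw [Fintype.sum_sum_type, EuclideanSpace.real_norm_sq_eq, EuclideanSpace.real_norm_sq_eq]
  simp

lemma pair_decomp {N : ℕ} (a b : EuclideanSpace ℝ (Fin N)) :
    (a, b) = ∑ i, (Sum.elim a b i : ℝ) • (prodDir i) := by
  have hh : ∀ a : EuclideanSpace ℝ (Fin N), ∑ i, a i • EuclideanSpace.single i (1:ℝ) = a := by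
    intro a
    ext j
    simp [Pi.single_apply, WithLp.ofLp_sum]
  rw [Fintype.sum_sum_type]
  simp only [prodDir, Sum.elim_inl, Sum.elim_inr]
  ext1
  · simp only [Prod.fst_add, Prod.fst_sum, Prod.smul_fst, smul_zero, Finset.sum_const_zero, add_zero, hh]
  · simp only [Prod.snd_add, Prod.snd_sum, Prod.smul_snd, smul_zero, Finset.sum_const_zero, zero_add, hh]

/-- Bilinear form on the product attached to a matrix. -/
lemma exists_bil {N : ℕ} (G : Matrix (Fin N ⊕ Fin N) (Fin N ⊕ Fin N) ℝ) :
    ∃ B : (EuclideanSpace ℝ (Fin N) × EuclideanSpace ℝ (Fin N)) →L[ℝ]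
      (EuclideanSpace ℝ (Fin N) × EuclideanSpace ℝ (Fin N)) →L[ℝ] ℝ,
      ∀ z w, B z w = dotProduct (Sum.elim z.1 z.2) (G.mulVec (Sum.elim w.1 w.2)) := by
  let l : Fin N ⊕ Fin N → ((EuclideanSpace ℝ (Fin N) × EuclideanSpace ℝ (Fin N)) →L[ℝ] ℝ) :=
    Sum.elim (fun i => (EuclideanSpace.proj i).comp (ContinuousLinearMap.fst ℝ _ _))
      (fun i => (EuclideanSpace.proj i).comp (ContinuousLinearMap.snd ℝ _ _))
  have hl : ∀ i z, l i z = Sum.elim z.1 z.2 i := by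
    rintro (i | i) z <;> rfl
  refine ⟨∑ i, ∑ j, G i j • (l i).smulRight (l j), fun z w => ?_⟩
  rw [← sum_eq_dot]
  simp only [sum_apply, smul_apply, ContinuousLinearMap.smulRight_apply, smul_eq_mul, hl]
  refine Finset.sum_congr rfl fun i _ => Finset.sum_congr rfl fun j _ => ?_
  ring

lemma pair_norm_sq_le {N : ℕ} (h k : EuclideanSpace ℝ (Fin N)) :
    ‖(h, k)‖ ^ 2 ≤ ‖h‖ ^ 2 + ‖k‖ ^ 2 := by
  rw [Prod.norm_def]
  rcases max_cases ‖h‖ ‖k‖ with ⟨e, _⟩ | ⟨e, _⟩ <;> simp only [e] <;> nlinarith [sq_nonneg ‖h‖, sq_nonneg ‖k‖]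

lemma op_quad {N : ℕ} (L : EuclideanSpace ℝ (Fin N) →L[ℝ] EuclideanSpace ℝ (Fin N))
    (h : EuclideanSpace ℝ (Fin N)) :
    inner ℝ (L h) h = ∑ i, ∑ j, h i * (inner ℝ (L (EuclideanSpace.single i 1))
      (EuclideanSpace.single j (1:ℝ))) * h j := by
  have hh : ∑ i, h i • EuclideanSpace.single i (1:ℝ) = h := by
    ext j
    simp [Pi.single_apply, WithLp.ofLp_sum]
  conv_lhs => rw [← hh]
  rw [map_sum, sum_inner]
  refine Finset.sum_congr rfl fun i _ => ?_
  rw [inner_sum]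
  refine Finset.sum_congr rfl fun j _ => ?_
  rw [map_smul, inner_smul_left, inner_smul_right]
  simp only [conj_trivial]
  ring

lemma op_entry_bound {N : ℕ} (L : EuclideanSpace ℝ (Fin N) →L[ℝ] EuclideanSpace ℝ (Fin N)) (c : ℝ)
    (hs : ∀ h k, inner ℝ (L h) k = inner ℝ (L k) h)
    (h0 : ∀ h, 0 ≤ inner ℝ (L h) h) (hc : ∀ h, inner ℝ (L h) h ≤ c * ‖h‖ ^ 2)
    (i j : Fin N) :
    inner ℝ (L (EuclideanSpace.single i 1)) (EuclideanSpace.single j (1:ℝ)) ∈ Icc (-c) c := by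
  set a : EuclideanSpace ℝ (Fin N) := EuclideanSpace.single i 1
  set b : EuclideanSpace ℝ (Fin N) := EuclideanSpace.single j 1
  have na : ‖a‖ = 1 := by simp [a]
  have nb : ‖b‖ = 1 := by simp [b]
  have e1 : inner ℝ (L (a + b)) (a + b) = inner ℝ (L a) a + 2 * inner ℝ (L a) b + inner ℝ (L b) b := by
    rw [map_add, inner_add_left, inner_add_right, inner_add_right, hs b a]; ring
  have e2 : inner ℝ (L (a - b)) (a - b) = inner ℝ (L a) a - 2 * inner ℝ (L a) b + inner ℝ (L b) b := by
    rw [map_sub, inner_sub_left, inner_sub_right, inner_sub_right, hs b a]; ring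
  have ha := hc a
  have hb := hc b
  rw [na] at ha
  rw [nb] at hb
  have p1 := h0 (a + b)
  have p2 := h0 (a - b)
  constructor <;> linarith

lemma core_lim {N : ℕ} (w1 w2 : EuclideanSpace ℝ (Fin N) → ℝ) (hw1 : UpperSemicontinuous w1)
    (hw2 : UpperSemicontinuous w2) (h10 : w1 0 = 0) (h20 : w2 0 = 0) (r lam δ σ : ℝ) (hr : 0 < r)
    (hlam : 0 < lam) (hδ : 0 < δ) (hσ : 0 < σ)
    (B : (EuclideanSpace ℝ (Fin N) × EuclideanSpace ℝ (Fin N)) →L[ℝ]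
      (EuclideanSpace ℝ (Fin N) × EuclideanSpace ℝ (Fin N)) →L[ℝ] ℝ)
    (hsymm : ∀ z w, B z w = B w z)
    (hH : ∀ ξ1 ξ2, ‖ξ1‖ ≤ r → ‖ξ2‖ ≤ r → ∀ x y, w1 ξ1 + w2 ξ2 - lam/2*(‖ξ1‖^2+‖ξ2‖^2)
      + lam*(inner ℝ x ξ1 + inner ℝ y ξ2) + δ/2*‖(x,y)‖^2 ≤ (1/2)*B (x,y) (x,y)) :
    ∃ (ξ1 ξ2 q1 q2 : ℕ → EuclideanSpace ℝ (Fin N)) (X Y : ℕ → Matrix (Fin N) (Fin N) ℝ)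
      (X' Y' : Matrix (Fin N) (Fin N) ℝ),
      Tendsto ξ1 atTop (𝓝 0) ∧ Tendsto ξ2 atTop (𝓝 0) ∧ Tendsto q1 atTop (𝓝 0) ∧
      Tendsto q2 atTop (𝓝 0) ∧ Tendsto X atTop (𝓝 X') ∧ Tendsto Y atTop (𝓝 Y') ∧
      X'.IsSymm ∧ Y'.IsSymm ∧
      (∀ h : EuclideanSpace ℝ (Fin N), 0 ≤ ∑ i, ∑ j, h i * X' i j * h j) ∧
      (∀ h : EuclideanSpace ℝ (Fin N), 0 ≤ ∑ i, ∑ j, h i * Y' i j * h j) ∧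
      (∀ h k : EuclideanSpace ℝ (Fin N), (∑ i, ∑ j, h i * X' i j * h j) +
        (∑ i, ∑ j, k i * Y' i j * k j) ≤ B (h,k) (h,k) + σ * (‖h‖^2+‖k‖^2)) ∧
      (∀ n, ∀ ε > 0, ∀ᶠ h : EuclideanSpace ℝ (Fin N) in 𝓝 0, w1 (ξ1 n + h) ≤ w1 (ξ1 n) +
        inner ℝ (q1 n) h + (1/2) * (∑ i, ∑ j, h i * X n i j * h j) - lam/2*‖h‖^2 + ε*‖h‖^2) ∧
      (∀ n, ∀ ε > 0, ∀ᶠ h : EuclideanSpace ℝ (Fin N) in 𝓝 0, w2 (ξ2 n + h) ≤ w2 (ξ2 n) +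
        inner ℝ (q2 n) h + (1/2) * (∑ i, ∑ j, h i * Y n i j * h j) - lam/2*‖h‖^2 + ε*‖h‖^2) := by
  choose ξ1 ξ2 q1 q2 L1 L2 hξ1 hξ2 hq1 hq2 s1 s2 p1 p2 up j1 j2 using fun n : ℕ =>
    core w1 w2 hw1 hw2 h10 h20 r lam δ σ hr hlam hδ hσ B hsymm hH (1/((n:ℝ)+1)) (by positivity)
  set X : ℕ → Fin N → Fin N → ℝ := fun n i j =>
    inner ℝ (L1 n (EuclideanSpace.single i 1)) (EuclideanSpace.single j (1:ℝ)) with hX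
  set Y : ℕ → Fin N → Fin N → ℝ := fun n i j =>
    inner ℝ (L2 n (EuclideanSpace.single i 1)) (EuclideanSpace.single j (1:ℝ)) with hY
  obtain ⟨c, hc0, hc⟩ : ∃ c, 0 ≤ c ∧ ∀ h k, B (h,k) (h,k) + σ * (‖h‖^2+‖k‖^2)
      ≤ c * (‖h‖^2+‖k‖^2) := by
    obtain ⟨c, hc0, hc⟩ := bil_bound B
    refine ⟨c + σ, by positivity, fun h k => ?_⟩
    have h1 := (le_abs_self _).trans (hc (h, k) (h, k))
    have h2 : ‖(h, k)‖ ^ 2 ≤ ‖h‖ ^ 2 + ‖k‖ ^ 2 := pair_norm_sq_le h k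
    have h3 : c * ‖(h, k)‖ ^ 2 ≤ c * (‖h‖ ^ 2 + ‖k‖ ^ 2) := by gcongr
    linarith
  have b1 : ∀ n i j, X n i j ∈ Icc (-c) c := fun n i j =>
    op_entry_bound (L1 n) c (s1 n) (p1 n) (fun h => by
      have h1 := up n h 0
      have h2 := hc h 0
      simp only [map_zero, inner_zero_right, norm_zero] at h1 h2
      linarith) i j
  have b2 : ∀ n i j, Y n i j ∈ Icc (-c) c := fun n i j =>
    op_entry_bound (L2 n) c (s2 n) (p2 n) (fun h => by
      have h1 := up n 0 h
      have h2 := hc 0 h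
      simp only [map_zero, inner_zero_right, norm_zero] at h1 h2
      linarith) i j
  have hK : IsCompact ((Set.univ.pi fun _ : Fin N => Set.univ.pi fun _ : Fin N => Icc (-c) c) ×ˢ
      (Set.univ.pi fun _ : Fin N => Set.univ.pi fun _ : Fin N => Icc (-c) c)) :=
    (isCompact_univ_pi fun _ => isCompact_univ_pi fun _ => isCompact_Icc).prod
      (isCompact_univ_pi fun _ => isCompact_univ_pi fun _ => isCompact_Icc)
  obtain ⟨⟨X', Y'⟩, -, φ, hφ, hlim⟩ := hK.tendsto_subseq (x := fun n => (X n, Y n)) (fun n =>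
    ⟨fun i _ j _ => b1 n i j, fun i _ j _ => b2 n i j⟩)
  have hlX : Tendsto (fun n => X (φ n)) atTop (𝓝 X') := (continuous_fst.tendsto _).comp hlim
  have hlY : Tendsto (fun n => Y (φ n)) atTop (𝓝 Y') := (continuous_snd.tendsto _).comp hlim
  have hlXij : ∀ i j, Tendsto (fun n => X (φ n) i j) atTop (𝓝 (X' i j)) := fun i j =>
    (tendsto_pi_nhds.1 (tendsto_pi_nhds.1 hlX i) j)
  have hlYij : ∀ i j, Tendsto (fun n => Y (φ n) i j) atTop (𝓝 (Y' i j)) := fun i j =>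
    (tendsto_pi_nhds.1 (tendsto_pi_nhds.1 hlY i) j)
  have qX : ∀ n (h : EuclideanSpace ℝ (Fin N)), inner ℝ (L1 n h) h =
      ∑ i, ∑ j, h i * X n i j * h j := fun n h => op_quad _ _
  have qY : ∀ n (h : EuclideanSpace ℝ (Fin N)), inner ℝ (L2 n h) h =
      ∑ i, ∑ j, h i * Y n i j * h j := fun n h => op_quad _ _
  have lqX : ∀ h : EuclideanSpace ℝ (Fin N), Tendsto (fun n => ∑ i, ∑ j, h i * X (φ n) i j * h j)
      atTop (𝓝 (∑ i, ∑ j, h i * X' i j * h j)) := fun h =>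
    tendsto_finsetSum _ fun i _ => tendsto_finsetSum _ fun j _ =>
      ((hlXij i j).const_mul _).mul_const _
  have lqY : ∀ h : EuclideanSpace ℝ (Fin N), Tendsto (fun n => ∑ i, ∑ j, h i * Y (φ n) i j * h j)
      atTop (𝓝 (∑ i, ∑ j, h i * Y' i j * h j)) := fun h =>
    tendsto_finsetSum _ fun i _ => tendsto_finsetSum _ fun j _ =>
      ((hlYij i j).const_mul _).mul_const _
  have sm : ∀ a : ℕ → EuclideanSpace ℝ (Fin N), (∀ n, ‖a n‖ ≤ 1/((n:ℝ)+1)) →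
      Tendsto (fun n => a (φ n)) atTop (𝓝 0) := fun a ha =>
    (squeeze_zero_norm ha tendsto_one_div_add_atTop_nhds_zero_nat).comp hφ.tendsto_atTop
  refine ⟨fun n => ξ1 (φ n), fun n => ξ2 (φ n), fun n => q1 (φ n), fun n => q2 (φ n),
    fun n => X (φ n), fun n => Y (φ n), X', Y', sm _ hξ1, sm _ hξ2, sm _ hq1, sm _ hq2, hlX, hlY,
    ?_, ?_, ?_, ?_, ?_, ?_, ?_⟩
  · ext i j
    exact tendsto_nhds_unique (hlXij j i) ((hlXij i j).congr fun n => s1 _ _ _)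
  · ext i j
    exact tendsto_nhds_unique (hlYij j i) ((hlYij i j).congr fun n => s2 _ _ _)
  · exact fun h => ge_of_tendsto' (lqX h) fun n => by rw [← qX]; exact p1 _ _
  · exact fun h => ge_of_tendsto' (lqY h) fun n => by rw [← qY]; exact p2 _ _
  · exact fun h k => le_of_tendsto' ((lqX h).add (lqY k)) fun n => by
      rw [← qX, ← qY]; exact up _ _ _
  · intro n ε hε
    filter_upwards [j1 (φ n) ε hε] with h hh
    rw [qX] at hh
    exact hh
  · intro n ε hε
    filter_upwards [j2 (φ n) ε hε] with h hh
    rw [qY] at hh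
    exact hh

lemma jet_conv {N : ℕ} (f w : EuclideanSpace ℝ (Fin N) → ℝ) (M C lam : ℝ)
    (xb x₀ g ξ q : EuclideanSpace ℝ (Fin N)) (X : Matrix (Fin N) (Fin N) ℝ)
    (hf : ∀ ξ, f (xb + ξ) = w ξ + M * ‖xb + ξ - x₀‖ ^ 2 + inner ℝ g ξ + C)
    (hw : ∀ ε > 0, ∀ᶠ h : EuclideanSpace ℝ (Fin N) in 𝓝 0, w (ξ + h) ≤ w ξ +
        inner ℝ q h + (1/2) * (∑ i, ∑ j, h i * X i j * h j) - lam/2*‖h‖^2 + ε*‖h‖^2) :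
    InSuperjet f (xb + ξ) (q + (2 * M) • (xb + ξ - x₀) + g) (X + (2 * M - lam) • 1) := by
  intro ε hε
  have ht : Tendsto (fun x => x - (xb + ξ)) (𝓝 (xb + ξ)) (𝓝 0) := by
    have : Continuous fun x => x - (xb + ξ) := by fun_prop
    simpa using this.tendsto (xb + ξ)
  filter_upwards [ht.eventually (hw ε hε)] with x hx
  set h := x - (xb + ξ) with hh
  have hxe : x = xb + (ξ + h) := by rw [hh]; abel
  have e0 : ∀ i, x i - (xb + ξ) i = h i := fun i => rfl
  simp only [e0]
  have e1 : ∑ i, (q + (2 * M) • (xb + ξ - x₀) + g) i * h i =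
      inner ℝ q h + 2 * M * inner ℝ (xb + ξ - x₀) h + inner ℝ g h := by
    have : ∀ a b : EuclideanSpace ℝ (Fin N), ∑ i, a i * b i = inner ℝ a b := by
      intro a b
      rw [PiLp.inner_apply]
      refine Finset.sum_congr rfl fun i _ => ?_
      simp [mul_comm]
    rw [this, inner_add_left, inner_add_left, inner_smul_left]
    simp
  have e2 : ∑ i, ∑ j, h i * (X + (2 * M - lam) • (1 : Matrix (Fin N) (Fin N) ℝ)) i j * h j =
      (∑ i, ∑ j, h i * X i j * h j) + (2 * M - lam) * ‖h‖ ^ 2 := by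
    rw [sum_eq_dot, sum_eq_dot, Matrix.add_mulVec, dotProduct_add, Matrix.smul_mulVec,
      Matrix.one_mulVec, dotProduct_smul, EuclideanSpace.real_norm_sq_eq]
    simp [dotProduct, pow_two]
  rw [e1, e2, hxe, hf, hf]
  have e3 : ‖xb + (ξ + h) - x₀‖ ^ 2 = ‖xb + ξ - x₀‖ ^ 2 + 2 * inner ℝ (xb + ξ - x₀) h + ‖h‖ ^ 2 := by
    rw [← norm_add_sq_real]; congr 2; abel
  have e4 : inner ℝ g (ξ + h) = inner ℝ g ξ + inner ℝ g h := inner_add_right _ _ _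
  rw [e3, e4]
  linarith

lemma subjet_of_neg {N : ℕ} (v : EuclideanSpace ℝ (Fin N) → ℝ) (x q : EuclideanSpace ℝ (Fin N))
    (X : Matrix (Fin N) (Fin N) ℝ) (h : InSuperjet (fun x => - v x) x q X) :
    InSubjet v x (-q) (-X) := by
  intro ε hε
  filter_upwards [h ε hε] with y hy
  simp only [PiLp.neg_apply, Matrix.neg_apply, neg_mul, mul_neg, Finset.sum_neg_distrib]
  linarith

lemma block_quad {N : ℕ} (P Q : Matrix (Fin N) (Fin N) ℝ) (a b : EuclideanSpace ℝ (Fin N)) :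
    dotProduct (Sum.elim a b) ((Matrix.fromBlocks P 0 0 Q).mulVec (Sum.elim a b)) =
      (∑ i, ∑ j, a i * P i j * a j) + ∑ i, ∑ j, b i * Q i j * b j := by
  rw [Matrix.fromBlocks_mulVec, sum_eq_dot, sum_eq_dot]
  simp [dotProduct, Fintype.sum_sum_type]

lemma shift_quad {N : ℕ} (P : Matrix (Fin N) (Fin N) ℝ) (c : ℝ) (a : EuclideanSpace ℝ (Fin N)) :
    ∑ i, ∑ j, a i * (P + c • (1 : Matrix (Fin N) (Fin N) ℝ)) i j * a j =
      (∑ i, ∑ j, a i * P i j * a j) + c * ‖a‖ ^ 2 := by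
  rw [sum_eq_dot, sum_eq_dot, Matrix.add_mulVec, dotProduct_add, Matrix.smul_mulVec,
    Matrix.one_mulVec, dotProduct_smul, EuclideanSpace.real_norm_sq_eq]
  simp [dotProduct, pow_two]

lemma psd_of_pairs {N : ℕ} (G : Matrix (Fin N ⊕ Fin N) (Fin N ⊕ Fin N) ℝ) (hG : G.IsSymm)
    (h : ∀ a b : EuclideanSpace ℝ (Fin N),
      0 ≤ dotProduct (Sum.elim a b) (G.mulVec (Sum.elim a b))) : G.PosSemidef := by
  refine Matrix.PosSemidef.of_dotProduct_mulVec_nonneg (by simpa using hG) fun x => ?_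
  have := h (WithLp.toLp 2 (x ∘ Sum.inl)) (WithLp.toLp 2 (x ∘ Sum.inr))
  have e : (Sum.elim (WithLp.toLp 2 (x ∘ Sum.inl) : EuclideanSpace ℝ (Fin N))
      (WithLp.toLp 2 (x ∘ Sum.inr) : EuclideanSpace ℝ (Fin N)) : Fin N ⊕ Fin N → ℝ) = x := by
    ext (i | i) <;> rfl
  rw [e] at this
  simpa using this

lemma one_quad {N : ℕ} (a b : EuclideanSpace ℝ (Fin N)) :
    dotProduct (Sum.elim a b) (Sum.elim a b : Fin N ⊕ Fin N → ℝ) = ‖a‖ ^ 2 + ‖b‖ ^ 2 := by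
  rw [← pair_norm]; simp [dotProduct, pow_two]

set_option maxHeartbeats 2000000

/-- **Lemma 2.4.** If `u` USC, `v` LSC and
`(x,y) ↦ u x - v y - M|x-x₀|² - M|y-x₀|² - Φ(x,y)` attains a global maximum at `(xb, yb)` with `Φ`
`C²` near `(xb, yb)`, then for every `ι > 0` there are symmetric matrices `X_ι, Y_ι` with
`(D₁Φ(xb,yb) + 2M(xb-x₀), X_ι) ∈ J̄^{2,+} u (xb)`, `(-D₂Φ(xb,yb) - 2M(yb-x₀), -Y_ι) ∈ J̄^{2,-} v (yb)`
and, with `A = D²Φ(xb,yb)`,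
`-(1/ι + |A| + 1) I ≤ diag(X_ι - 2M Id, Y_ι - 2M Id) ≤ A + ι A² + I`. -/
theorem jets_at_max_point (N : ℕ) (hN : 1 ≤ N)
    (u v : EuclideanSpace ℝ (Fin N) → ℝ)
    (hu : UpperSemicontinuous u) (hv : LowerSemicontinuous v)
    (M : ℝ) (hM : 1 < M)
    (x₀ xb yb : EuclideanSpace ℝ (Fin N))
    (Φ : EuclideanSpace ℝ (Fin N) × EuclideanSpace ℝ (Fin N) → ℝ)
    (hΦ : ∃ ε > 0, ContDiffOn ℝ 2 Φ (ball (xb, yb) ε))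
    (hmax : ∀ x y : EuclideanSpace ℝ (Fin N),
      u x - v y - M * ‖x - x₀‖ ^ 2 - M * ‖y - x₀‖ ^ 2 - Φ (x, y) ≤
      u xb - v yb - M * ‖xb - x₀‖ ^ 2 - M * ‖yb - x₀‖ ^ 2 - Φ (xb, yb)) :
    ∀ ι > (0 : ℝ), ∃ X Y : Matrix (Fin N) (Fin N) ℝ, X.IsSymm ∧ Y.IsSymm ∧
      (∃ qx : EuclideanSpace ℝ (Fin N),
        (∀ i, qx i = fderiv ℝ Φ (xb, yb) (EuclideanSpace.single i 1, 0)
            + 2 * M * (xb i - x₀ i)) ∧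
        InClosedSuperjet u xb qx X) ∧
      (∃ qy : EuclideanSpace ℝ (Fin N),
        (∀ i, qy i = -(fderiv ℝ Φ (xb, yb) (0, EuclideanSpace.single i 1))
            - 2 * M * (yb i - x₀ i)) ∧
        InClosedSubjet v yb qy (-Y)) ∧
      (Matrix.fromBlocks (X - (2 * M) • 1) 0 0 (Y - (2 * M) • 1) -
        (-(1/ι + symNorm (hessProd Φ (xb, yb)) + 1)) •
          (1 : Matrix (Fin N ⊕ Fin N) (Fin N ⊕ Fin N) ℝ)).PosSemidef ∧
      (hessProd Φ (xb, yb) + ι • hessProd Φ (xb, yb) ^ 2 +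
          (1 : Matrix (Fin N ⊕ Fin N) (Fin N ⊕ Fin N) ℝ) -
        Matrix.fromBlocks (X - (2 * M) • 1) 0 0 (Y - (2 * M) • 1)).PosSemidef := by
  intro ι hι
  obtain ⟨ε0, hε0, hC⟩ := hΦ
  have hCA : ContDiffAt ℝ 2 Φ (xb, yb) := hC.contDiffAt (ball_mem_nhds _ hε0)
  have hd : ∀ᶠ z in 𝓝 (xb, yb), HasFDerivAt Φ (fderiv ℝ Φ z) z := by
    filter_upwards [hCA.eventually (by simp)] with z hz
    exact (hz.differentiableAt (by norm_num)).hasFDerivAt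
  have hd2 : HasFDerivAt (fderiv ℝ Φ) (fderiv ℝ (fderiv ℝ Φ) (xb, yb)) (xb, yb) :=
    ((hCA.fderiv_right (m := 1) (by norm_num)).differentiableAt (by norm_num)).hasFDerivAt
  have hSs := hCA.isSymmSndFDerivAt (by simp)
  set A := hessProd Φ (xb, yb) with hA
  set D := fderiv ℝ Φ (xb, yb) with hD
  set S := fderiv ℝ (fderiv ℝ Φ) (xb, yb) with hS
  have hAij : ∀ i j, A i j = S (prodDir i) (prodDir j) := by
    intro i j
    rw [hA, hessProd, Matrix.of_apply, iteratedFDeriv_two_apply]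
    rfl
  have hAs : A.IsSymm := by
    ext i j
    rw [Matrix.transpose_apply, hAij, hAij]
    exact hSs _ _
  have hSq : ∀ a b, S (a, b) (a, b) = dotProduct (Sum.elim a b) (A.mulVec (Sum.elim a b)) := by
    intro a b
    rw [← sum_eq_dot]
    conv_lhs => rw [pair_decomp a b]
    rw [map_sum, Finset.sum_comm]
    refine Finset.sum_congr rfl fun j _ => ?_
    rw [map_smul, map_sum, sum_apply, smul_eq_mul, Finset.mul_sum]
    refine Finset.sum_congr rfl fun i _ => ?_
    rw [map_smul, smul_apply, hAij, smul_eq_mul]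
    ring
  obtain ⟨g1, hg1⟩ : ∃ g : EuclideanSpace ℝ (Fin N), ∀ h, inner ℝ g h = D (h, 0) :=
    ⟨(InnerProductSpace.toDual ℝ _).symm (D.comp (ContinuousLinearMap.inl ℝ _ _)), fun h => by
      rw [InnerProductSpace.toDual_symm_apply]; rfl⟩
  obtain ⟨g2, hg2⟩ : ∃ g : EuclideanSpace ℝ (Fin N), ∀ h, inner ℝ g h = D (0, h) :=
    ⟨(InnerProductSpace.toDual ℝ _).symm (D.comp (ContinuousLinearMap.inr ℝ _ _)), fun h => by
      rw [InnerProductSpace.toDual_symm_apply]; rfl⟩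
  set C1 := u xb - M * ‖xb - x₀‖ ^ 2 with hC1
  set C2 := - v yb - M * ‖yb - x₀‖ ^ 2 with hC2
  set w1 : EuclideanSpace ℝ (Fin N) → ℝ :=
    fun ξ => u (xb + ξ) + (-(M * ‖xb + ξ - x₀‖ ^ 2) - inner ℝ g1 ξ - C1) with hw1
  set w2 : EuclideanSpace ℝ (Fin N) → ℝ :=
    fun ξ => - v (yb + ξ) + (-(M * ‖yb + ξ - x₀‖ ^ 2) - inner ℝ g2 ξ - C2) with hw2
  have usc1 : UpperSemicontinuous w1 := by
    refine UpperSemicontinuous.add (hu.comp (by fun_prop)) (Continuous.upperSemicontinuous ?_)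
    fun_prop
  have usc2 : UpperSemicontinuous w2 := by
    refine UpperSemicontinuous.add ?_ (Continuous.upperSemicontinuous ?_)
    · have h1 : LowerSemicontinuous fun ξ => v (yb + ξ) := hv.comp (by fun_prop)
      intro x a ha
      filter_upwards [h1 x (-a) (by linarith)] with y hy
      linarith
    · fun_prop
  have z1 : w1 0 = 0 := by simp [hw1, hC1]; ring
  have z2 : w2 0 = 0 := by simp [hw2, hC2]; ring
  obtain ⟨r, hr, hloc⟩ : ∃ r > 0, ∀ ξ1 ξ2, ‖ξ1‖ ≤ r → ‖ξ2‖ ≤ r →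
      w1 ξ1 + w2 ξ2 ≤ (1/2) * S (ξ1, ξ2) (ξ1, ξ2) + (1/16) * (‖ξ1‖ ^ 2 + ‖ξ2‖ ^ 2) := by
    have ht := taylor2_s5 hd hd2 (1/16) (by norm_num)
    obtain ⟨r, hr, hb⟩ := Metric.eventually_nhds_iff_ball.1 ht
    refine ⟨r / 2, by positivity, fun ξ1 ξ2 h1 h2 => ?_⟩
    have hm : (ξ1, ξ2) ∈ ball (0 : EuclideanSpace ℝ (Fin N) × EuclideanSpace ℝ (Fin N)) r := by
      rw [mem_ball_zero_iff, Prod.norm_def]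
      exact max_lt (by simp only; linarith) (by simp only; linarith)
    have h3 := (abs_le.1 (hb _ hm)).2
    have h4 := hmax (xb + ξ1) (yb + ξ2)
    have h5 := pair_norm_sq_le ξ1 ξ2
    have h6 : D (ξ1, ξ2) = inner ℝ g1 ξ1 + inner ℝ g2 ξ2 := by
      rw [hg1, hg2, ← map_add]; simp
    rw [Prod.mk_add_mk, ← hD, h6] at h3
    simp only [hw1, hw2, hC1, hC2]
    linarith
  set lam := 1 / ι + symNorm A + 1 / 4 with hlam
  have hsn : 0 ≤ symNorm A := by
    refine Real.sSup_nonneg ?_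
    rintro x ⟨v, -, rfl⟩
    exact abs_nonneg _
  have hlam0 : 0 < lam := by positivity
  set G := A + ι • A ^ 2 + (lam + 1 / 2) • (1 : Matrix (Fin N ⊕ Fin N) (Fin N ⊕ Fin N) ℝ) with hG
  have hA2s : (A ^ 2).IsSymm := hAs.pow 2
  have hGs : G.IsSymm := (hAs.add (hA2s.smul ι)).add (Matrix.isSymm_one.smul _)
  have hGq : ∀ a b : EuclideanSpace ℝ (Fin N),
      dotProduct (Sum.elim a b) (G.mulVec (Sum.elim a b)) =
      dotProduct (Sum.elim a b) (A.mulVec (Sum.elim a b)) +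
      ι * dotProduct (Sum.elim a b) ((A ^ 2).mulVec (Sum.elim a b)) +
      (lam + 1 / 2) * (‖a‖ ^ 2 + ‖b‖ ^ 2) := by
    intro a b
    rw [hG, Matrix.add_mulVec, Matrix.add_mulVec, dotProduct_add, dotProduct_add,
      Matrix.smul_mulVec, Matrix.smul_mulVec, Matrix.one_mulVec, dotProduct_smul, dotProduct_smul,
      one_quad, smul_eq_mul, smul_eq_mul]
  obtain ⟨B, hB⟩ := exists_bil G
  have hBs : ∀ z w, B z w = B w z := by
    intro z w
    rw [hB, hB, Matrix.dotProduct_mulVec, ← Matrix.mulVec_transpose, hGs.eq, dotProduct_comm]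
  have hBq : ∀ a b, B (a, b) (a, b) = dotProduct (Sum.elim a b) (A.mulVec (Sum.elim a b)) +
      ι * dotProduct (Sum.elim a b) ((A ^ 2).mulVec (Sum.elim a b)) +
      (lam + 1 / 2) * (‖a‖ ^ 2 + ‖b‖ ^ 2) := fun a b => (hB _ _).trans (hGq a b)
  have hH : ∀ ξ1 ξ2, ‖ξ1‖ ≤ r → ‖ξ2‖ ≤ r → ∀ x y, w1 ξ1 + w2 ξ2 - lam/2*(‖ξ1‖^2+‖ξ2‖^2)
      + lam*(inner ℝ x ξ1 + inner ℝ y ξ2) + (1/4)/2*‖(x,y)‖^2 ≤ (1/2)*B (x,y) (x,y) := by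
    intro ξ1 ξ2 h1 h2 x y
    have k1 := hloc ξ1 ξ2 h1 h2
    rw [hSq] at k1
    have k2 := mat_ineq A hAs ι hι (Sum.elim ξ1 ξ2) (Sum.elim x y)
    have k3 : ∑ i, ((Sum.elim ξ1 ξ2 : Fin N ⊕ Fin N → ℝ) i - (Sum.elim x y : Fin N ⊕ Fin N → ℝ) i) ^ 2
        = ‖ξ1 - x‖ ^ 2 + ‖ξ2 - y‖ ^ 2 := by
      rw [← pair_norm]
      refine Finset.sum_congr rfl fun i _ => ?_
      rcases i with i | i <;> rfl
    have k4 := pair_norm_sq_le x y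
    rw [k3] at k2
    have k5 := norm_sub_sq_real ξ1 x
    have k6 := norm_sub_sq_real ξ2 y
    have pl : ∀ a b : EuclideanSpace ℝ (Fin N), ‖a‖ ^ 2 ≤ 2 * ‖b‖ ^ 2 + 2 * ‖a - b‖ ^ 2 := by
      intro a b
      have h1 : ‖a‖ ≤ ‖b‖ + ‖a - b‖ := by
        calc ‖a‖ = ‖b + (a - b)‖ := by congr 1; abel
          _ ≤ _ := norm_add_le _ _
      nlinarith [norm_nonneg a, norm_nonneg b, norm_nonneg (a - b), sq_nonneg (‖b‖ - ‖a - b‖)]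
    have k7 := pl ξ1 x
    have k8 := pl ξ2 y
    rw [hBq, real_inner_comm ξ1 x, real_inner_comm ξ2 y]
    have k9 : 1 / ι + symNorm A = lam - 1 / 4 := by rw [hlam]; ring
    rw [k9] at k2
    have k10 : lam * (‖ξ1 - x‖ ^ 2 + ‖ξ2 - y‖ ^ 2) =
        lam * (‖ξ1‖ ^ 2 + ‖ξ2‖ ^ 2) - 2 * (lam * (inner ℝ ξ1 x + inner ℝ ξ2 y)) +
        lam * (‖x‖ ^ 2 + ‖y‖ ^ 2) := by rw [k5, k6]; ring
    linarith
  obtain ⟨ξ1, ξ2, q1, q2, X, Y, X', Y', tξ1, tξ2, tq1, tq2, tX, tY, sX, sY, pX, pY, up, j1, j2⟩ :=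
    core_lim w1 w2 usc1 usc2 z1 z2 r lam (1/4) (1/4) hr hlam0 (by norm_num) (by norm_num) B hBs hH
  have eM : ∀ Z : Matrix (Fin N) (Fin N) ℝ, Z + (2 * M - lam) • (1 : Matrix (Fin N) (Fin N) ℝ)
      - (2 * M) • 1 = Z + (-lam) • (1 : Matrix (Fin N) (Fin N) ℝ) := by
    intro Z; rw [sub_smul, neg_smul]; abel
  refine ⟨X' + (2 * M - lam) • 1, Y' + (2 * M - lam) • 1, sX.add (Matrix.isSymm_one.smul _),
    sY.add (Matrix.isSymm_one.smul _), ⟨(0 : EuclideanSpace ℝ (Fin N)) + (2 * M) • (xb + 0 - x₀) + g1, ?_, ?_⟩,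
    ⟨-((0 : EuclideanSpace ℝ (Fin N)) + (2 * M) • (yb + 0 - x₀) + g2), ?_, ?_⟩, ?_, ?_⟩
  · intro i
    rw [← hg1]
    simp [EuclideanSpace.inner_single_right]
    ring
  · refine ⟨fun n => xb + ξ1 n, fun n => q1 n + (2 * M) • (xb + ξ1 n - x₀) + g1,
      fun n => X n + (2 * M - lam) • 1, fun n => ?_, ?_, ?_, ?_⟩
    · refine jet_conv u w1 M C1 lam xb x₀ g1 (ξ1 n) (q1 n) (X n) (fun ξ => ?_) (j1 n)
      simp only [hw1]; ring
    · simpa using tξ1.const_add xb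
    · exact ((tq1.add (((tξ1.const_add xb).sub_const x₀).const_smul (2 * M)))).add_const g1
    · exact tX.add_const _
  · intro i
    rw [← hg2]
    simp [EuclideanSpace.inner_single_right]
    ring
  · refine ⟨fun n => yb + ξ2 n, fun n => -(q2 n + (2 * M) • (yb + ξ2 n - x₀) + g2),
      fun n => -(Y n + (2 * M - lam) • 1), fun n => ?_, ?_, ?_, ?_⟩
    · refine subjet_of_neg v _ _ _ ?_
      refine jet_conv (fun x => - v x) w2 M C2 lam yb x₀ g2 (ξ2 n) (q2 n) (Y n) (fun ξ => ?_) (j2 n)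
      simp only [hw2]; ring
    · simpa using tξ2.const_add yb
    · exact (((tq2.add (((tξ2.const_add yb).sub_const x₀).const_smul (2 * M)))).add_const g2).neg
    · exact (tY.add_const _).neg
  · rw [eM, eM]
    have sX2 : (X' + (-lam) • (1 : Matrix (Fin N) (Fin N) ℝ)).IsSymm :=
      sX.add (Matrix.isSymm_one.smul _)
    have sY2 : (Y' + (-lam) • (1 : Matrix (Fin N) (Fin N) ℝ)).IsSymm :=
      sY.add (Matrix.isSymm_one.smul _)
    refine psd_of_pairs _ ((Matrix.IsSymm.fromBlocks sX2 (by simp) sY2).sub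
      (Matrix.isSymm_one.smul _)) fun a b => ?_
    rw [Matrix.sub_mulVec, dotProduct_sub, block_quad, shift_quad, shift_quad, Matrix.smul_mulVec,
      Matrix.one_mulVec, dotProduct_smul, one_quad, smul_eq_mul]
    have h1 := pX a
    have h2 := pY b
    have h3 : lam ≤ 1 / ι + symNorm A + 1 := by rw [hlam]; linarith
    have h4 : lam * (‖a‖ ^ 2 + ‖b‖ ^ 2) ≤ (1 / ι + symNorm A + 1) * (‖a‖ ^ 2 + ‖b‖ ^ 2) := by
      gcongr
    linarith
  · rw [eM, eM]
    have sX2 : (X' + (-lam) • (1 : Matrix (Fin N) (Fin N) ℝ)).IsSymm :=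
      sX.add (Matrix.isSymm_one.smul _)
    have sY2 : (Y' + (-lam) • (1 : Matrix (Fin N) (Fin N) ℝ)).IsSymm :=
      sY.add (Matrix.isSymm_one.smul _)
    refine psd_of_pairs _ (((hAs.add (hA2s.smul ι)).add Matrix.isSymm_one).sub
      (Matrix.IsSymm.fromBlocks sX2 (by simp) sY2)) fun a b => ?_
    rw [Matrix.sub_mulVec, dotProduct_sub, block_quad, shift_quad, shift_quad, Matrix.add_mulVec,
      Matrix.add_mulVec, dotProduct_add, dotProduct_add, Matrix.smul_mulVec,
      Matrix.one_mulVec, dotProduct_smul, one_quad, smul_eq_mul]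
    have h1 := up a b
    rw [hBq] at h1
    have h2 : 0 ≤ ‖a‖ ^ 2 + ‖b‖ ^ 2 := by positivity
    linarith
end
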